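/- Let u be a smooth solution to the special Lagrangian equation ∑_{i=1}^n arctan λᵢ(x) = c on all of ℝⁿ. Suppose the eigenvalues of the Hessian are bounded, |λᵢ(x)| ≤ K for all i and x for some constant K, and satisfy 3 + λᵢ(x)² + 2λᵢ(x)λⱼ(x) ≥ 0 for all indices i, j and all x. Then u is a quadratic polynomial. -/

import Mathlib

noncomputable section

/-- The Hessian matrix `D²u(x)`, with entries `∂ᵢ∂ⱼ u (x)`. -/
def Hess {n : ℕ} (u : EuclideanSpace ℝ (Fin n) → ℝ) (x : EuclideanSpace ℝ (Fin n)) :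
    Matrix (Fin n) (Fin n) ℝ :=
  Matrix.of fun i j =>
    iteratedFDeriv ℝ 2 u x ![EuclideanSpace.single i 1, EuclideanSpace.single j 1]

/-- The induced metric `g = I + D²u · D²u` on the gradient graph `(x, ∇u(x))`. -/
def gMat {n : ℕ} (u : EuclideanSpace ℝ (Fin n) → ℝ) (x : EuclideanSpace ℝ (Fin n)) :
    Matrix (Fin n) (Fin n) ℝ :=
  1 + Hess u x * Hess u x

/-- The Laplace–Beltrami operator `Δ_g v = ∑ g^{ij} ∂ᵢ∂ⱼ v` of the induced metric. -/
def lapg {n : ℕ} (u v : EuclideanSpace ℝ (Fin n) → ℝ) (x : EuclideanSpace ℝ (Fin n)) : ℝ :=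
  ∑ i, ∑ j, (gMat u x)⁻¹ i j *
    iteratedFDeriv ℝ 2 v x ![EuclideanSpace.single i 1, EuclideanSpace.single j 1]

/-- The squared metric gradient norm `|∇_g v|²_g = ∑ g^{ij} ∂ᵢv ∂ⱼv`. -/
def gradSq {n : ℕ} (u v : EuclideanSpace ℝ (Fin n) → ℝ) (x : EuclideanSpace ℝ (Fin n)) : ℝ :=
  ∑ i, ∑ j, (gMat u x)⁻¹ i j * fderiv ℝ v x (EuclideanSpace.single i 1) *
    fderiv ℝ v x (EuclideanSpace.single j 1)

/-- The volume element `V = √(det g)`. -/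
def Vol {n : ℕ} (u : EuclideanSpace ℝ (Fin n) → ℝ) (x : EuclideanSpace ℝ (Fin n)) : ℝ :=
  Real.sqrt ((gMat u x).det)

end

namespace SLag
open scoped ContDiff

lemma _root_.ContDiff.nat {E F : Type*} [NormedAddCommGroup E] [NormedSpace ℝ E] [NormedAddCommGroup F]
    [NormedSpace ℝ F] {f : E → F} (hf : ContDiff ℝ ∞ f) (k : ℕ) : ContDiff ℝ k f :=
  hf.of_le (by exact_mod_cast (le_top : (k : ℕ∞) ≤ ⊤))

abbrev Eu (n : ℕ) := EuclideanSpace ℝ (Fin n)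

noncomputable def pd {n : ℕ} (v : Eu n) (f : Eu n → ℝ) (x : Eu n) : ℝ := fderiv ℝ f x v

section Calculus
variable {n : ℕ} {f g : Eu n → ℝ} {v w x : Eu n}

lemma pd_contDiff (hf : ContDiff ℝ ∞ f) (v : Eu n) : ContDiff ℝ ∞ (pd v f) := by
  have := hf.fderiv_right (m := ∞) (by simp)
  exact this.clm_apply contDiff_const

lemma pd_contDiff_nat {k : ℕ} (hf : ContDiff ℝ (k+1 : ℕ) f) (v : Eu n) : ContDiff ℝ k (pd v f) := by
  have := hf.fderiv_right (m := k) (by norm_cast)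
  exact this.clm_apply contDiff_const

lemma pd_const (c : ℝ) : pd v (fun _ => c) x = 0 := by simp [pd]

lemma pd_add (hf : DifferentiableAt ℝ f x) (hg : DifferentiableAt ℝ g x) :
    pd v (fun y => f y + g y) x = pd v f x + pd v g x := by
  unfold pd; rw [fderiv_fun_add hf hg]; simp

lemma pd_sub (hf : DifferentiableAt ℝ f x) (hg : DifferentiableAt ℝ g x) :
    pd v (fun y => f y - g y) x = pd v f x - pd v g x := by
  unfold pd; rw [fderiv_fun_sub hf hg]; simp

lemma pd_neg : pd v (fun y => - f y) x = - pd v f x := by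
  unfold pd; rw [fderiv_fun_neg]; simp

lemma pd_mul (hf : DifferentiableAt ℝ f x) (hg : DifferentiableAt ℝ g x) :
    pd v (fun y => f y * g y) x = pd v f x * g x + f x * pd v g x := by
  unfold pd; rw [fderiv_fun_mul hf hg]; simp; ring

lemma pd_const_mul (c : ℝ) (hf : DifferentiableAt ℝ f x) :
    pd v (fun y => c * f y) x = c * pd v f x := by
  rw [pd_mul (by fun_prop) hf, pd_const]; ring

lemma pd_sum {ι : Type*} {s : Finset ι} {F : ι → Eu n → ℝ} (hF : ∀ i ∈ s, DifferentiableAt ℝ (F i) x) :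
    pd v (fun y => ∑ i ∈ s, F i y) x = ∑ i ∈ s, pd v (F i) x := by
  unfold pd; rw [fderiv_fun_sum hF]; simp

lemma pd_comp {ψ : ℝ → ℝ} {ψ' : ℝ} (hψ : HasDerivAt ψ ψ' (f x)) (hf : DifferentiableAt ℝ f x) :
    pd v (fun y => ψ (f y)) x = ψ' * pd v f x := by
  unfold pd
  have := (hψ.comp_hasFDerivAt x hf.hasFDerivAt).fderiv
  simp only [Function.comp_def] at this
  rw [this]; simp

lemma pd_comm (hf : ContDiff ℝ 2 f) (v w : Eu n) : pd v (pd w f) = pd w (pd v f) := by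
  funext x
  have h2 : DifferentiableAt ℝ (fderiv ℝ f) x :=
    ((hf.fderiv_right (m := 1) (by norm_num)).differentiable (by norm_num)).differentiableAt
  have key : ∀ a b : Eu n, pd a (pd b f) x = fderiv ℝ (fderiv ℝ f) x a b := by
    intro a b
    unfold pd
    rw [fderiv_clm_apply h2 (by fun_prop)]
    simp
  rw [key, key]
  have hs : IsSymmSndFDerivAt ℝ f x :=
    (hf.contDiffAt).isSymmSndFDerivAt (by simp)
  exact hs v w

lemma pd_lin (v : Eu n) {ι : Type*} (s : Finset ι) (c : ι → ℝ) (e : ι → Eu n) (hv : v = ∑ i ∈ s, c i • e i)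
    (f : Eu n → ℝ) (x : Eu n) : pd v f x = ∑ i ∈ s, c i * pd (e i) f x := by
  unfold pd; subst hv; simp

lemma pd_coord (i : Fin n) : pd v (fun y => y i) x = v i := by
  unfold pd
  have : HasFDerivAt (fun y : Eu n => y i) (EuclideanSpace.proj i : Eu n →L[ℝ] ℝ) x :=
    (EuclideanSpace.proj i : Eu n →L[ℝ] ℝ).hasFDerivAt
  rw [this.fderiv]; simp

end Calculus

/-- standard basis vector -/
noncomputable abbrev sb {n : ℕ} (i : Fin n) : Eu n := EuclideanSpace.single i (1:ℝ)

lemma Hess_entry {n : ℕ} {u : Eu n → ℝ} (hu : ContDiff ℝ ∞ u) (x : Eu n) (v w : Eu n) :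
    iteratedFDeriv ℝ 2 u x ![v, w] = pd v (pd w u) x := by
  have h2 : DifferentiableAt ℝ (fderiv ℝ u) x :=
    (((hu.nat 2).fderiv_right (m := 1) (by norm_num)).differentiable (by norm_num)).differentiableAt
  rw [iteratedFDeriv_two_apply]
  unfold pd
  rw [fderiv_clm_apply h2 (by fun_prop)]
  simp

end SLag

namespace SLag
open scoped ContDiff

lemma S_nonneg {x y z : ℝ} (h1 : 0 ≤ 3 + x^2 + 2*x*y) (h2 : 0 ≤ 3 + y^2 + 2*y*x)
    (h3 : 0 ≤ 3 + y^2 + 2*y*z) (h4 : 0 ≤ 3 + z^2 + 2*z*y) (h5 : 0 ≤ 3 + x^2+2*x*z) (h6 : 0 ≤ 3 + z^2+2*z*x) :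
    0 ≤ 3 + x*y + y*z + z*x := by
  -- core: one negative
  have core : ∀ a p q : ℝ, 0 ≤ a → 0 ≤ p → 0 ≤ q → 0 ≤ 3 + p^2 - 2*a*p → 0 ≤ 3 + q^2 - 2*a*q →
      0 ≤ 3 + a^2 - 2*a*p → 0 ≤ 3 + a^2-2*a*q → 0 ≤ 3 - a*(p+q) + p*q := by
    intro a p q ha hp hq e1 e2 e3 e4
    rcases le_or_gt (a^2) 3 with h | h
    · rcases eq_or_lt_of_le ha with h0 | h0
      · subst h0; nlinarith [mul_nonneg hp hq]
      · by_contra hc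
        push Not at hc
        -- a * (3 - a^2 + (p-a)(q-a)) < 0
        rcases le_total p a with hpa | hpa <;> rcases le_total q a with hqa | hqa
        · nlinarith [mul_nonneg (sub_nonneg.2 hpa) (sub_nonneg.2 hqa)]
        · nlinarith [mul_nonneg hp (sub_nonneg.2 hqa)]
        · nlinarith [mul_nonneg hq (sub_nonneg.2 hpa)]
        · nlinarith [mul_nonneg (sub_nonneg.2 hpa) (sub_nonneg.2 hqa)]
    · have hpa : p < a := by nlinarith
      have hqa : q < a := by nlinarith
      have : (a^2-3)^2 ≤ ((a-p)*(a-q))^2 := by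
        have f1 : a^2-3 ≤ (a-p)^2 := by nlinarith
        have f2 : a^2-3 ≤ (a-q)^2 := by nlinarith
        rw [mul_pow]; nlinarith [mul_le_mul f1 f2 (by linarith) (by positivity)]
      have := abs_le_of_sq_le_sq this (by nlinarith)
      nlinarith [le_abs_self (a^2-3)]
  rcases le_total 0 x with hx | hx <;> rcases le_total 0 y with hy | hy <;>
    rcases le_total 0 z with hz | hz
  · positivity
  · have := core (-z) x y; nlinarith [this (by linarith) hx hy (by linarith) (by linarith) (by linarith) (by linarith)]
  · have := core (-y) x z; nlinarith [this (by linarith) hx hz (by linarith) (by linarith) (by linarith) (by linarith)]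
  · have := core (x) (-y) (-z); nlinarith [this (by linarith) (by linarith) (by linarith) (by linarith) (by linarith) (by linarith) (by linarith)]
  · have := core (-x) y z; nlinarith [this (by linarith) (by linarith) (by linarith) (by linarith) (by linarith) (by linarith) (by linarith)]
  · have := core (y) (-x) (-z); nlinarith [this (by linarith) (by linarith) (by linarith) (by linarith) (by linarith) (by linarith) (by linarith)]
  · have := core (z) (-x) (-y); nlinarith [this (by linarith) (by linarith) (by linarith) (by linarith) (by linarith) (by linarith) (by linarith)]
  · nlinarith [mul_nonneg_of_nonpos_of_nonpos hx hy, mul_nonneg_of_nonpos_of_nonpos hy hz, mul_nonneg_of_nonpos_of_nonpos hz hx]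

lemma hasDerivAt_det {n : ℕ} {M : ℝ → Matrix (Fin n) (Fin n) ℂ} {M' N : Matrix (Fin n) (Fin n) ℂ} {t : ℝ}
    (hM : ∀ i j, HasDerivAt (fun s => M s i j) (M' i j) t) (hN : M t * N = 1) :
    HasDerivAt (fun s => (M s).det) ((M t).det * (N * M').trace) t := by
  have h1 : HasDerivAt (fun s => (M s).det)
      (∑ σ : Equiv.Perm (Fin n), ((Equiv.Perm.sign σ : ℤ) : ℂ) *
        ∑ i, (∏ j ∈ Finset.univ.erase i, M t (σ j) j) * M' (σ i) i) t := by
    simp only [Matrix.det_apply']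
    apply HasDerivAt.fun_sum
    intro σ _
    apply HasDerivAt.const_mul
    have := HasDerivAt.fun_finsetProd (u := Finset.univ) (f := fun i s => M s (σ i) i) (f' := fun i => M' (σ i) i)
      (x := t) (fun i _ => hM (σ i) i)
    simpa [smul_eq_mul] using this
  convert h1 using 1
  have h2 : (M t).det • N = (M t).adjugate := by
    calc (M t).det • N = ((M t).adjugate * M t) * N := by rw [Matrix.adjugate_mul]; simp
      _ = _ := by rw [Matrix.mul_assoc, hN, Matrix.mul_one]
  have h3 : (M t).det * (N * M').trace = ((M t).adjugate * M').trace := by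
    rw [← h2]; simp
  rw [h3, Matrix.trace]
  simp only [Finset.mul_sum]
  rw [Finset.sum_comm]
  refine Finset.sum_congr rfl fun i _ => ?_
  have h4 : ((M t).adjugate * M').diag i = ((M t).updateCol i (fun k => M' k i)).det := by
    rw [← Matrix.cramer_apply, Matrix.cramer_eq_adjugate_mulVec]
    rfl
  rw [h4, Matrix.det_apply']
  refine Finset.sum_congr rfl fun σ _ => ?_
  congr 1
  rw [← Finset.prod_erase_mul _ _ (Finset.mem_univ i)]
  congr 1
  · refine Finset.prod_congr rfl fun j hj => ?_
    rw [Matrix.updateCol_ne (Finset.ne_of_mem_erase hj)]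
  · simp

end SLag

namespace SLag
open scoped ContDiff

/-- Hessian in an orthonormal basis. -/
noncomputable def Hm {n : ℕ} (u : Eu n → ℝ) (e : OrthonormalBasis (Fin n) ℝ (Eu n)) (x : Eu n) :
    Matrix (Fin n) (Fin n) ℝ := Matrix.of fun a b => pd (e a) (pd (e b) u) x

noncomputable def Gm {n : ℕ} (u : Eu n → ℝ) (e : OrthonormalBasis (Fin n) ℝ (Eu n)) (x : Eu n) :
    Matrix (Fin n) (Fin n) ℝ := (1 + Hm u e x * Hm u e x)⁻¹

noncomputable def cdet {n : ℕ} (A : Matrix (Fin n) (Fin n) ℝ) : ℂ :=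
  (1 + Complex.I • A.map (algebraMap ℝ ℂ)).det

/-- volume element, as a polynomial in the Hessian -/
noncomputable def Vf {n : ℕ} (u : Eu n → ℝ) (c : ℝ) (x : Eu n) : ℝ :=
  (Complex.exp (-(c * Complex.I)) * cdet (Hm u (EuclideanSpace.basisFun (Fin n) ℝ) x)).re

section
variable {n : ℕ} {u : Eu n → ℝ} {e : OrthonormalBasis (Fin n) ℝ (Eu n)} {x : Eu n} {c : ℝ}

noncomputable def Um (e : OrthonormalBasis (Fin n) ℝ (Eu n)) : Matrix (Fin n) (Fin n) ℝ :=
  Matrix.of fun i a => e a i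

lemma Um_orth (e : OrthonormalBasis (Fin n) ℝ (Eu n)) : (Um e).transpose * Um e = 1 := by
  ext a b
  have := e.orthonormal
  rw [orthonormal_iff_ite] at this
  have h := this a b
  rw [PiLp.inner_apply] at h
  simp only [Matrix.mul_apply, Um, Matrix.transpose_apply, Matrix.of_apply, Matrix.one_apply, ← h]
  refine Finset.sum_congr rfl fun i _ => ?_
  simp [mul_comm]

lemma Um_orth' (e : OrthonormalBasis (Fin n) ℝ (Eu n)) : Um e * (Um e).transpose = 1 :=
  mul_eq_one_comm.mp (Um_orth e)

lemma basis_exp (e : OrthonormalBasis (Fin n) ℝ (Eu n)) (a : Fin n) :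
    e a = ∑ i, (Um e) i a • sb i := by
  have := (EuclideanSpace.basisFun (Fin n) ℝ).sum_repr (e a)
  rw [← this]; simp [Um]

lemma Hm_change (hu : ContDiff ℝ ∞ u) :
    Hm u e x = (Um e).transpose * Hm u (EuclideanSpace.basisFun (Fin n) ℝ) x * Um e := by
  ext a b
  have h1 : pd (e b) u = fun y => ∑ j, Um e j b * pd (sb j) u y := by
    funext y; exact pd_lin _ _ _ _ (basis_exp e b) _ _
  simp only [Hm, Matrix.of_apply]
  rw [pd_lin _ _ _ _ (basis_exp e a), h1]
  simp only [Matrix.mul_apply, Matrix.transpose_apply, Matrix.of_apply, EuclideanSpace.basisFun_apply, Finset.sum_mul]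
  rw [Finset.sum_comm]
  refine Finset.sum_congr rfl fun i _ => ?_
  rw [pd_sum (fun j _ => by
    have := ((pd_contDiff hu (sb j)).nat 1).differentiable (by norm_num)
    fun_prop), Finset.mul_sum]
  refine Finset.sum_congr rfl fun j _ => ?_
  rw [pd_const_mul _ (((pd_contDiff hu (sb j)).nat 1).differentiable (by norm_num)).differentiableAt]
  ring

lemma cdet_conj (A : Matrix (Fin n) (Fin n) ℝ) (e : OrthonormalBasis (Fin n) ℝ (Eu n)) :
    cdet ((Um e).transpose * A * Um e) = cdet A := by
  unfold cdet
  have h1 := Um_orth e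
  set U := Um e
  have h2 : (U.transpose.map (algebraMap ℝ ℂ)) * (U.map (algebraMap ℝ ℂ)) = 1 := by
    rw [← Matrix.map_mul, h1]; simp
  have h3 : (1 + Complex.I • (U.transpose * A * U).map (algebraMap ℝ ℂ)) =
     (U.transpose.map (algebraMap ℝ ℂ)) * (1 + Complex.I • A.map (algebraMap ℝ ℂ)) * (U.map (algebraMap ℝ ℂ)) := by
    rw [Matrix.map_mul, Matrix.map_mul, mul_add, add_mul, mul_one, h2]; simp
  rw [h3, Matrix.det_mul_right_comm, h2]; simp

lemma Hm_contDiff (hu : ContDiff ℝ ∞ u) (e : OrthonormalBasis (Fin n) ℝ (Eu n)) (a b : Fin n) :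
    ContDiff ℝ ∞ (fun y => Hm u e y a b) := pd_contDiff (pd_contDiff hu _) _

lemma Hm_symm (hu : ContDiff ℝ ∞ u) (e : OrthonormalBasis (Fin n) ℝ (Eu n)) (x : Eu n) (a b : Fin n) :
    Hm u e x a b = Hm u e x b a := by
  simp only [Hm, Matrix.of_apply]
  rw [pd_comm (hu.nat 2)]

lemma Hm_isSymm (hu : ContDiff ℝ ∞ u) (e : OrthonormalBasis (Fin n) ℝ (Eu n)) (x : Eu n) :
    (Hm u e x).IsSymm := by
  ext a b; exact Hm_symm hu e x b a

lemma posdef_aux {A : Matrix (Fin n) (Fin n) ℝ} (hA : A.IsSymm) : (1 + A * A).PosDef := by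
  have h : (A * A).PosSemidef := by
    have := Matrix.posSemidef_conjTranspose_mul_self A
    rwa [Matrix.conjTranspose_eq_transpose_of_trivial, hA.eq] at this
  exact Matrix.PosDef.one.add_posSemidef h

/-- The hypothesis package for the special Lagrangian equation -/
def SLE (u : Eu n → ℝ) (c : ℝ) : Prop :=
  ∀ x, 0 < Vf u c x ∧
    cdet (Hm u (EuclideanSpace.basisFun (Fin n) ℝ) x) = Vf u c x * Complex.exp (c * Complex.I)

lemma contDiff_cdet (hu : ContDiff ℝ ∞ u) :
    ContDiff ℝ ∞ (fun x => cdet (Hm u e x)) := by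
  unfold cdet
  simp only [Matrix.det_apply']
  refine ContDiff.sum fun σ _ => ContDiff.mul contDiff_const ?_
  refine contDiff_prod fun i _ => ?_
  simp only [Matrix.add_apply, Matrix.smul_apply, Matrix.map_apply]
  refine contDiff_const.add ?_
  simp only [smul_eq_mul]
  refine contDiff_const.mul ?_
  exact Complex.ofRealCLM.contDiff.comp (Hm_contDiff hu e _ _)

lemma contDiff_Vf (hu : ContDiff ℝ ∞ u) (c : ℝ) : ContDiff ℝ ∞ (Vf u c) := by
  unfold Vf
  exact Complex.reCLM.contDiff.comp (contDiff_const.mul (contDiff_cdet hu))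

lemma G_mul (hu : ContDiff ℝ ∞ u) : Gm u e x * (1 + Hm u e x * Hm u e x) = 1 :=
  Matrix.nonsing_inv_mul _ ((Matrix.isUnit_iff_isUnit_det _).1 (posdef_aux (Hm_isSymm hu e x)).isUnit)

lemma mul_G (hu : ContDiff ℝ ∞ u) : (1 + Hm u e x * Hm u e x) * Gm u e x = 1 :=
  mul_eq_one_comm.mp (G_mul hu)

lemma G_comm (hu : ContDiff ℝ ∞ u) : Gm u e x * Hm u e x = Hm u e x * Gm u e x := by
  have h1 := G_mul (e := e) (x := x) hu
  have h2 := mul_G (e := e) (x := x) hu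
  set H := Hm u e x
  set G := Gm u e x
  calc G * H = G * H * ((1 + H * H) * G) := by rw [h2, mul_one]
    _ = (G * (1 + H * H)) * H * G := by noncomm_ring
    _ = H * G := by rw [h1, one_mul]

lemma G_isSymm (hu : ContDiff ℝ ∞ u) : (Gm u e x).IsSymm := by
  unfold Gm Matrix.IsSymm
  rw [Matrix.transpose_nonsing_inv, Matrix.transpose_add, Matrix.transpose_mul, (Hm_isSymm hu e x).eq]
  simp

lemma contDiff_det' {M : Eu n → Matrix (Fin n) (Fin n) ℝ} (hM : ∀ i j, ContDiff ℝ ∞ (fun y => M y i j)) :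
    ContDiff ℝ ∞ (fun y => (M y).det) := by
  simp only [Matrix.det_apply']
  exact ContDiff.sum fun σ _ => ContDiff.mul contDiff_const (contDiff_prod fun i _ => hM _ _)

lemma Hm2_contDiff (hu : ContDiff ℝ ∞ u) (e : OrthonormalBasis (Fin n) ℝ (Eu n)) (a b : Fin n) :
    ContDiff ℝ ∞ (fun y => (1 + Hm u e y * Hm u e y) a b) := by
  simp only [Matrix.add_apply, Matrix.mul_apply]
  exact contDiff_const.add (ContDiff.sum fun i _ => (Hm_contDiff hu e _ _).mul (Hm_contDiff hu e _ _))

lemma Gm_contDiff (hu : ContDiff ℝ ∞ u) (e : OrthonormalBasis (Fin n) ℝ (Eu n)) (a b : Fin n) :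
    ContDiff ℝ ∞ (fun y => Gm u e y a b) := by
  unfold Gm
  simp only [Matrix.inv_def, Matrix.smul_apply, Ring.inverse_eq_inv', smul_eq_mul, Matrix.adjugate_apply]
  refine ContDiff.mul (ContDiff.inv (contDiff_det' (Hm2_contDiff hu e)) fun y => ?_) (contDiff_det' ?_)
  · exact (posdef_aux (Hm_isSymm hu e y)).det_pos.ne'
  · intro i j
    by_cases h : i = b
    · subst h; simp only [Matrix.updateRow_self]; exact contDiff_const
    · simp only [Matrix.updateRow_ne h]; exact Hm2_contDiff hu e i j

/-- entrywise derivative of a matrix field -/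
noncomputable def mpd (v : Eu n) (F : Eu n → Matrix (Fin n) (Fin n) ℝ) (x : Eu n) : Matrix (Fin n) (Fin n) ℝ :=
  Matrix.of fun a b => pd v (fun y => F y a b) x

lemma mpd_mul {v : Eu n} {F K : Eu n → Matrix (Fin n) (Fin n) ℝ} (hF : ∀ a b, DifferentiableAt ℝ (fun y => F y a b) x)
    (hK : ∀ a b, DifferentiableAt ℝ (fun y => K y a b) x) :
    mpd v (fun y => F y * K y) x = mpd v F x * K x + F x * mpd v K x := by
  ext a b
  simp only [mpd, Matrix.of_apply, Matrix.mul_apply, Matrix.add_apply]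
  rw [pd_sum (F := fun i y => F y a i * K y i b) (fun i _ => (hF a i).fun_mul (hK i b)), ← Finset.sum_add_distrib]
  exact Finset.sum_congr rfl fun i _ => pd_mul (hF _ _) (hK _ _)

lemma mpd_add {v : Eu n} {F K : Eu n → Matrix (Fin n) (Fin n) ℝ} (hF : ∀ a b, DifferentiableAt ℝ (fun y => F y a b) x)
    (hK : ∀ a b, DifferentiableAt ℝ (fun y => K y a b) x) :
    mpd v (fun y => F y + K y) x = mpd v F x + mpd v K x := by
  ext a b
  simp only [mpd, Matrix.of_apply, Matrix.add_apply]
  exact pd_add (hF _ _) (hK _ _)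

lemma mpd_const {v : Eu n} {A : Matrix (Fin n) (Fin n) ℝ} : mpd v (fun _ => A) x = 0 := by
  ext a b
  simp [mpd, pd_const]

lemma pd_trace {v : Eu n} {F : Eu n → Matrix (Fin n) (Fin n) ℝ} (hF : ∀ a b, DifferentiableAt ℝ (fun y => F y a b) x) :
    pd v (fun y => (F y).trace) x = (mpd v F x).trace := by
  simp only [Matrix.trace, mpd, Matrix.diag_apply, Matrix.of_apply]
  exact pd_sum fun i _ => hF i i

lemma cd_diff {f : Eu n → ℝ} (hf : ContDiff ℝ ∞ f) (x : Eu n) : DifferentiableAt ℝ f x :=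
  ((hf.nat 1).differentiable (by norm_num)).differentiableAt

lemma mpd_G (hu : ContDiff ℝ ∞ u) (v : Eu n) :
    mpd v (Gm u e) x = - (Gm u e x * (mpd v (Hm u e) x * Hm u e x + Hm u e x * mpd v (Hm u e) x) * Gm u e x) := by
  have dH : ∀ a b, DifferentiableAt ℝ (fun y => Hm u e y a b) x := fun a b => cd_diff (Hm_contDiff hu e a b) x
  have dG : ∀ a b, DifferentiableAt ℝ (fun y => Gm u e y a b) x := fun a b => cd_diff (Gm_contDiff hu e a b) x
  have dg : ∀ a b, DifferentiableAt ℝ (fun y => (1 + Hm u e y * Hm u e y) a b) x :=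
    fun a b => cd_diff (Hm2_contDiff hu e a b) x
  have dHH : ∀ a b, DifferentiableAt ℝ (fun y => (Hm u e y * Hm u e y) a b) x := by
    intro a b
    simp only [Matrix.mul_apply]
    exact DifferentiableAt.fun_sum fun i _ => (dH _ _).fun_mul (dH _ _)
  have h1 : mpd v (fun y => Gm u e y * (1 + Hm u e y * Hm u e y)) x = 0 := by
    have : (fun y => Gm u e y * (1 + Hm u e y * Hm u e y)) = fun _ => 1 := by
      funext y; exact G_mul hu
    rw [this, mpd_const]
  rw [mpd_mul dG dg] at h1
  have h2 : mpd v (fun y => (1 + Hm u e y * Hm u e y)) x =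
      mpd v (Hm u e) x * Hm u e x + Hm u e x * mpd v (Hm u e) x := by
    rw [mpd_add (F := fun _ => (1 : Matrix (Fin n) (Fin n) ℝ)) (K := fun y => Hm u e y * Hm u e y) (fun a b => differentiableAt_const _) dHH, mpd_const, zero_add, mpd_mul dH dH]
  rw [h2] at h1
  have h3 := mul_G (e := e) (x := x) hu
  set P := mpd v (Hm u e) x * Hm u e x + Hm u e x * mpd v (Hm u e) x
  have h4 : (mpd v (Gm u e) x * (1 + Hm u e x * Hm u e x) + Gm u e x * P) * Gm u e x = 0 := by rw [h1, zero_mul]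
  rw [add_mul, mul_assoc, h3, mul_one] at h4
  exact eq_neg_of_add_eq_zero_left h4

/-- first derivatives of the equation -/
lemma first_order (hu : ContDiff ℝ ∞ u) (hS : SLE u c) (e : OrthonormalBasis (Fin n) ℝ (Eu n)) (v x : Eu n) :
    (Gm u e x * mpd v (Hm u e) x).trace = 0 ∧
    pd v (Vf u c) x = Vf u c x * (Hm u e x * Gm u e x * mpd v (Hm u e) x).trace := by
  have hc : ∀ y, cdet (Hm u e y) = Vf u c y * Complex.exp (c * Complex.I) := by
    intro y; rw [Hm_change hu, cdet_conj]; exact (hS y).2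
  set γ : ℝ → Eu n := fun t => x + t • v
  have hγ : HasDerivAt γ v 0 := by
    have := ((hasDerivAt_id (0:ℝ)).smul_const v).const_add x
    simpa [γ] using this
  have hγ0 : γ 0 = x := by simp [γ]
  have hcomp : ∀ f : Eu n → ℝ, DifferentiableAt ℝ f x → HasDerivAt (fun t => f (γ t)) (pd v f x) 0 := by
    intro f hf
    have h : HasFDerivAt f (fderiv ℝ f x) (γ 0) := by rw [hγ0]; exact hf.hasFDerivAt
    exact h.comp_hasDerivAt (0:ℝ) hγ
  set H := Hm u e x with hH
  set G := Gm u e x with hG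
  set T := mpd v (Hm u e) x with hT
  let φ : Matrix (Fin n) (Fin n) ℝ →+* Matrix (Fin n) (Fin n) ℂ := (algebraMap ℝ ℂ).mapMatrix
  set N : Matrix (Fin n) (Fin n) ℂ := (1 - Complex.I • φ H) * φ G with hN
  have hMN : (1 + Complex.I • φ (Hm u e (γ 0))) * N = 1 := by
    rw [hγ0, hN, ← mul_assoc]
    have : (1 + Complex.I • φ H) * (1 - Complex.I • φ H) = φ (1 + H * H) := by
      rw [map_add, map_mul, map_one, add_mul, mul_sub, mul_sub, smul_mul_smul_comm]
      simp; abel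
    rw [this, ← map_mul, mul_G hu, map_one]
  have h1 := hasDerivAt_det (M := fun t => 1 + Complex.I • φ (Hm u e (γ t))) (M' := Complex.I • φ T) (t := 0) (N := N)
    (by
      intro i j
      have := (hcomp _ (cd_diff (Hm_contDiff hu e i j) x)).ofReal_comp
      have := (this.const_mul Complex.I).const_add ((1 : Matrix (Fin n) (Fin n) ℂ) i j)
      simpa [φ, Matrix.add_apply, hT, mpd] using this) hMN
  have h2 : HasDerivAt (fun t => (Vf u c (γ t) : ℂ) * Complex.exp (c * Complex.I))
      ((pd v (Vf u c) x : ℂ) * Complex.exp (c * Complex.I)) 0 :=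
    ((hcomp _ (cd_diff (contDiff_Vf hu c) x)).ofReal_comp).mul_const _
  have h3 : (fun t => (1 + Complex.I • φ (Hm u e (γ t))).det) =
      (fun t => (Vf u c (γ t) : ℂ) * Complex.exp (c * Complex.I)) := by
    funext t; exact hc (γ t)
  rw [h3] at h1
  have h4 := h1.unique h2
  have h5 : (1 + Complex.I • φ (Hm u e (γ 0))).det = (Vf u c x : ℂ) * Complex.exp (c * Complex.I) := by
    rw [hγ0]; exact hc x
  have htr : ∀ A : Matrix (Fin n) (Fin n) ℝ, (φ A).trace = ((A.trace : ℝ) : ℂ) := by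
    intro A; simp [φ, Matrix.trace]
  have h6 : (N * Complex.I • φ T).trace = ((H * G * T).trace : ℝ) + Complex.I * ((G * T).trace : ℝ) := by
    rw [hN, ← htr, ← htr, map_mul, map_mul, map_mul]
    rw [sub_mul, one_mul, sub_mul, Matrix.mul_smul, Matrix.trace_sub, smul_mul_assoc, smul_mul_assoc, Matrix.mul_smul, smul_smul, Complex.I_mul_I]
    simp; ring
  have hexp := Complex.exp_ne_zero (c * Complex.I)
  rw [h5, h6] at h4
  have h7 : (Vf u c x : ℂ) * (((H * G * T).trace : ℝ) + Complex.I * ((G * T).trace : ℝ)) = (pd v (Vf u c) x : ℂ) := by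
    apply mul_right_cancel₀ hexp
    rw [← h4]; ring
  have h8 := congrArg Complex.im h7
  have h9 := congrArg Complex.re h7
  simp at h8 h9
  have hV := (hS x).1
  refine ⟨?_, h9.symm⟩
  rcases h8 with h8 | h8
  · exact absurd h8 hV.ne'
  · exact h8

end
end SLag

namespace SLag
open scoped ContDiff

/-- constant in the pointwise inequality -/
noncomputable def Dc (n : ℕ) (K : ℝ) : ℝ :=
  (6 * n * (3 + 3 * K^2) + 8 * K^2) +
    4 * (9 * n * (3 + 3 * K^2) * K^2 + 12 + 12 * K^2 * (6 * n * (3 + 3 * K^2) + 8 * K^2))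

lemma Dc_pos (n : ℕ) (K : ℝ) : 0 < Dc n K := by unfold Dc; positivity

lemma slice_ineq {n : ℕ} (l y : Fin n → ℝ) (m K : ℝ) (hl : ∀ i, |l i| ≤ K) (hm : |m| ≤ K)
    (hc : ∀ i, 0 ≤ 3 + l i ^ 2 + 2 * l i * m) (hy : ∑ i, y i = 0) :
    (∑ i, (1 + l i ^ 2) * y i)^2 + (2 * ∑ i, l i * ((1 + l i ^ 2) * y i))^2 ≤
      Dc n K * ((∑ i, (3 + l i ^ 2 + 2 * l i * m) * y i ^ 2) / 3 + (∑ i, l i * y i)^2) := by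
  set C : ℝ := 3 + 3 * K^2 with hC
  set P := ∑ i, (3 + l i ^ 2 + 2 * l i * m) * y i ^ 2 with hP
  set B := ∑ i, l i * y i with hB
  set t1 := ∑ i, (1 + l i ^ 2) * y i with ht1
  set t2 := ∑ i, l i * ((1 + l i ^ 2) * y i) with ht2
  have hK : 0 ≤ K := (abs_nonneg m).trans hm
  have hm2 : m^2 ≤ K^2 := sq_le_sq' (by linarith [neg_abs_le m]) ((le_abs_self m).trans hm)
  have hl2 : ∀ i, l i^2 ≤ K^2 := fun i => sq_le_sq' (by linarith [neg_abs_le (l i), hl i]) ((le_abs_self _).trans (hl i))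
  have hcC : ∀ i, 3 + l i ^ 2 + 2 * l i * m ≤ C := by
    intro i; nlinarith [hl2 i, sq_nonneg (l i - m)]
  have hP0 : 0 ≤ P := Finset.sum_nonneg fun i _ => mul_nonneg (hc i) (sq_nonneg _)
  -- Cauchy-Schwarz
  have cs : ∀ (f : Fin n → ℝ) (F : ℝ), (∀ i, f i ^ 2 ≤ F) → 0 ≤ F →
      (∑ i, f i * ((3 + l i ^ 2 + 2 * l i * m) * y i))^2 ≤ n * C * F * P := by
    intro f F hf hF
    have h := Finset.sum_mul_sq_le_sq_mul_sq Finset.univ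
      (fun i => f i * Real.sqrt (3 + l i ^ 2 + 2 * l i * m)) (fun i => Real.sqrt (3 + l i ^ 2 + 2 * l i * m) * y i)
    have e1 : ∑ i, f i * Real.sqrt (3 + l i ^ 2 + 2 * l i * m) * (Real.sqrt (3 + l i ^ 2 + 2 * l i * m) * y i)
       = ∑ i, f i * ((3 + l i ^ 2 + 2 * l i * m) * y i) := by
      refine Finset.sum_congr rfl fun i _ => ?_
      have := Real.mul_self_sqrt (hc i)
      calc _ = f i * ((Real.sqrt (3 + l i ^ 2 + 2 * l i * m) * Real.sqrt (3 + l i ^ 2 + 2 * l i * m)) * y i) := by ring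
        _ = _ := by rw [this]
    have e2 : ∑ i, (Real.sqrt (3 + l i ^ 2 + 2 * l i * m) * y i)^2 = P := by
      refine Finset.sum_congr rfl fun i _ => ?_
      rw [mul_pow, Real.sq_sqrt (hc i)]
    have e3 : ∑ i, (f i * Real.sqrt (3 + l i ^ 2 + 2 * l i * m))^2 ≤ n * C * F := by
      calc _ ≤ ∑ _i : Fin n, F * C := by
            refine Finset.sum_le_sum fun i _ => ?_
            rw [mul_pow, Real.sq_sqrt (hc i)]
            exact mul_le_mul (hf i) (hcC i) (hc i) hF
        _ = _ := by simp; ring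
    rw [e1, e2] at h
    exact h.trans (mul_le_mul_of_nonneg_right e3 hP0)
  have cs1 := cs (fun _ => 1) 1 (by simp) (by simp)
  have cs2 := cs l (K^2) hl2 (by positivity)
  set A1 := ∑ i, 1 * ((3 + l i ^ 2 + 2 * l i * m) * y i) with hA1
  set A2 := ∑ i, l i * ((3 + l i ^ 2 + 2 * l i * m) * y i) with hA2
  have r1 : t1 = A1 - 2 * m * B := by
    have : t1 - A1 + 2 * m * B = -2 * ∑ i, y i := by
      rw [ht1, hA1, hB, Finset.mul_sum, Finset.mul_sum, ← Finset.sum_sub_distrib, ← Finset.sum_add_distrib]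
      exact Finset.sum_congr rfl fun i _ => by ring
    rw [hy] at this; linarith
  have r2 : t2 = A2 - 2 * B - 2 * m * t1 := by
    have : t2 - A2 + 2 * B + 2 * m * t1 = 2 * m * ∑ i, y i := by
      rw [ht2, hA2, hB, ht1, Finset.mul_sum, Finset.mul_sum, Finset.mul_sum, ← Finset.sum_sub_distrib, ← Finset.sum_add_distrib, ← Finset.sum_add_distrib]
      exact Finset.sum_congr rfl fun i _ => by ring
    rw [hy] at this; linarith
  have s1 : t1^2 ≤ (6 * n * C + 8 * K^2) * (P/3 + B^2) := by
    have h1 : t1^2 ≤ 2 * A1^2 + 8 * (m^2 * B^2) := by rw [r1]; nlinarith [sq_nonneg (A1 + 2 * m * B)]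
    have h2 : m^2 * B^2 ≤ K^2 * B^2 := mul_le_mul_of_nonneg_right hm2 (sq_nonneg _)
    have h3 : 0 ≤ (n:ℝ) * C * B^2 := by positivity
    have h4 : 0 ≤ K^2 * P := by positivity
    nlinarith
  have s2 : (2*t2)^2 ≤ 4 * (9 * n * C * K^2 + 12 + 12 * K^2 * (6 * n * C + 8 * K^2)) * (P/3 + B^2) := by
    have h1 : t2^2 ≤ 3 * A2^2 + 12 * B^2 + 12 * (m^2 * t1^2) := by
      rw [r2]; nlinarith [sq_nonneg (A2 + 2 * B), sq_nonneg (A2 + 2 * m * t1), sq_nonneg (2 * B - 2 * m * t1)]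
    have h2 : m^2 * t1^2 ≤ K^2 * t1^2 := mul_le_mul_of_nonneg_right hm2 (sq_nonneg _)
    have h3 : 0 ≤ (n:ℝ) * C * K^2 * B^2 := by positivity
    have h5 : K^2 * t1^2 ≤ K^2 * ((6 * n * C + 8 * K^2) * (P/3 + B^2)) := mul_le_mul_of_nonneg_left s1 (by positivity)
    nlinarith
  unfold Dc
  rw [← hC]
  linarith

/-- the algebraic core -/
lemma alg_core {n : ℕ} (l g : Fin n → ℝ) (T : Fin n → Fin n → Fin n → ℝ) (K : ℝ) (hl : ∀ i, |l i| ≤ K)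
    (hg : ∀ i, g i * (1 + l i ^ 2) = 1)
    (hc : ∀ i j, 0 ≤ 3 + l i ^ 2 + 2 * l i * l j)
    (hT1 : ∀ i j k, T i j k = T j i k) (hT2 : ∀ i j k, T i j k = T i k j)
    (h0 : ∀ k, ∑ i, g i * T i i k = 0) :
    ∑ k, ((∑ i, T i i k)^2 + (2 * ∑ i, l i * T i i k)^2) ≤ Dc n K * (1 + K^2) *
     ((∑ i, ∑ j, ∑ k, g i * g j * g k * T i j k ^ 2 * (1 - l i * l j + l k * (l i + l j))) +
        ∑ k, g k * (∑ i, l i * (g i * T i i k))^2) := by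
  have hgpos : ∀ i, 0 < g i := by
    intro i
    have h : 0 < 1 + l i ^2 := by positivity
    exact (pos_iff_pos_of_mul_pos (by rw [hg i]; norm_num)).2 h
  have hl2 : ∀ i, l i^2 ≤ K^2 := fun i => sq_le_sq' (by linarith [neg_abs_le (l i), hl i]) ((le_abs_self _).trans (hl i))
  have hglow : ∀ i, 1 ≤ (1 + K^2) * g i := by
    intro i
    have h := mul_le_mul_of_nonneg_left (show 1 + l i^2 ≤ 1 + K^2 by linarith [hl2 i]) (hgpos i).le
    rw [hg i] at h; linarith
  -- symmetrization
  set w : Fin n → Fin n → Fin n → ℝ := fun i j k => g i * g j * g k * T i j k ^ 2 with hw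
  have w1 : ∀ i j k, w i j k = w j i k := by intro i j k; simp only [hw]; rw [hT1 i j k]; ring
  have w2 : ∀ i j k, w i j k = w i k j := by intro i j k; simp only [hw]; rw [hT2 i j k]; ring
  have hw0 : ∀ i j k, 0 ≤ w i j k := by
    intro i j k
    have := hgpos i; have := hgpos j; have := hgpos k
    simp only [hw]; positivity
  have e1 : ∑ i, ∑ j, ∑ k, w i j k * (l i * l k) = ∑ i, ∑ j, ∑ k, w i j k * (l i * l j) := by
    refine Finset.sum_congr rfl fun i _ => ?_
    rw [Finset.sum_comm]
    refine Finset.sum_congr rfl fun j _ => Finset.sum_congr rfl fun k _ => ?_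
    rw [w2]
  have e2 : ∑ i, ∑ j, ∑ k, w i j k * (l j * l k) = ∑ i, ∑ j, ∑ k, w i j k * (l i * l k) := by
    rw [Finset.sum_comm]
    refine Finset.sum_congr rfl fun i _ => Finset.sum_congr rfl fun j _ => Finset.sum_congr rfl fun k _ => ?_
    rw [w1]
  have hQ : (∑ i, ∑ j, ∑ k, g i * g j * g k * T i j k ^ 2 * (1 - l i * l j + l k * (l i + l j))) =
      (∑ i, ∑ j, ∑ k, w i j k * (3 + l i * l j + l j * l k + l k * l i)) / 3 := by
    have a1 : (∑ i, ∑ j, ∑ k, g i * g j * g k * T i j k ^ 2 * (1 - l i * l j + l k * (l i + l j))) =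
       (∑ i, ∑ j, ∑ k, w i j k) - (∑ i, ∑ j, ∑ k, w i j k * (l i * l j)) + (∑ i, ∑ j, ∑ k, w i j k * (l i * l k))
        + (∑ i, ∑ j, ∑ k, w i j k * (l j * l k)) := by
      simp only [← Finset.sum_sub_distrib, ← Finset.sum_add_distrib]
      refine Finset.sum_congr rfl fun i _ => Finset.sum_congr rfl fun j _ => Finset.sum_congr rfl fun k _ => ?_
      simp only [hw]; ring
    have a2 : (∑ i, ∑ j, ∑ k, w i j k * (3 + l i * l j + l j * l k + l k * l i)) =
       (∑ i, ∑ j, ∑ k, w i j k) + (∑ i, ∑ j, ∑ k, w i j k) + (∑ i, ∑ j, ∑ k, w i j k)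
         + (∑ i, ∑ j, ∑ k, w i j k * (l i * l j)) + (∑ i, ∑ j, ∑ k, w i j k * (l i * l k))
        + (∑ i, ∑ j, ∑ k, w i j k * (l j * l k)) := by
      simp only [← Finset.sum_add_distrib]
      refine Finset.sum_congr rfl fun i _ => Finset.sum_congr rfl fun j _ => Finset.sum_congr rfl fun k _ => ?_
      ring
    rw [a1, a2]; linarith
  have hQ2 : ∑ k, ∑ i, w i i k * (3 + l i ^2 + 2 * l i * l k) ≤
      ∑ i, ∑ j, ∑ k, w i j k * (3 + l i * l j + l j * l k + l k * l i) := by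
    have : ∑ i, ∑ j, ∑ k, w i j k * (3 + l i * l j + l j * l k + l k * l i) =
      ∑ k, ∑ i, ∑ j, w i j k * (3 + l i * l j + l j * l k + l k * l i) := by
      rw [Finset.sum_congr rfl fun i _ => Finset.sum_comm, Finset.sum_comm]
    rw [this]
    refine Finset.sum_le_sum fun k _ => Finset.sum_le_sum fun i _ => ?_
    have h1 := Finset.single_le_sum (f := fun j => w i j k * (3 + l i * l j + l j * l k + l k * l i)) (s := Finset.univ)
      (fun j _ => mul_nonneg (hw0 _ _ _) (S_nonneg (hc _ _) (hc _ _) (hc _ _) (hc _ _) (hc _ _) (hc _ _))) (Finset.mem_univ i)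
    refine le_trans (le_of_eq ?_) h1
    ring
  rw [hQ]
  have main : ∀ k, (∑ i, T i i k)^2 + (2 * ∑ i, l i * T i i k)^2 ≤ Dc n K * (1 + K^2) *
     ((∑ i, w i i k * (3 + l i ^2 + 2 * l i * l k))/3 + g k * (∑ i, l i * (g i * T i i k))^2) := by
    intro k
    have h := slice_ineq l (fun i => g i * T i i k) (l k) K hl (hl k) (fun i => hc i k) (h0 k)
    have q : ∀ i, (1 + l i^2) * (g i * T i i k) = T i i k := by
      intro i; rw [← mul_assoc, mul_comm (1 + l i^2), hg, one_mul]
    simp only [q] at h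
    refine h.trans ?_
    rw [mul_assoc]
    refine mul_le_mul_of_nonneg_left ?_ (Dc_pos n K).le
    have e : ∑ i, w i i k * (3 + l i ^2 + 2 * l i * l k) = g k * ∑ i, (3 + l i ^ 2 + 2 * l i * l k) * (g i * T i i k)^2 := by
      rw [Finset.mul_sum]
      exact Finset.sum_congr rfl fun i _ => by simp only [hw]; ring
    rw [e]
    have hP0 : 0 ≤ (∑ i, (3 + l i ^ 2 + 2 * l i * l k) * (g i * T i i k)^2)/3 + (∑ i, l i * (g i * T i i k))^2 := by
      have : 0 ≤ ∑ i, (3 + l i ^ 2 + 2 * l i * l k) * (g i * T i i k)^2 :=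
        Finset.sum_nonneg fun i _ => mul_nonneg (hc i k) (sq_nonneg _)
      positivity
    have := mul_le_mul_of_nonneg_right (hglow k) hP0
    rw [one_mul] at this
    refine this.trans (le_of_eq ?_)
    ring
  refine (Finset.sum_le_sum fun k _ => main k).trans ?_
  rw [← Finset.mul_sum]
  refine mul_le_mul_of_nonneg_left ?_ (by have := (Dc_pos n K).le; positivity)
  rw [Finset.sum_add_distrib, ← Finset.sum_div]
  gcongr

end SLag

namespace SLag
open scoped ContDiff

/-- the standard basis as an orthonormal basis -/
noncomputable abbrev sB (n : ℕ) : OrthonormalBasis (Fin n) ℝ (Eu n) := EuclideanSpace.basisFun (Fin n) ℝ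

noncomputable def lap {n : ℕ} (u : Eu n → ℝ) (e : OrthonormalBasis (Fin n) ℝ (Eu n)) (f : Eu n → ℝ) (x : Eu n) : ℝ :=
  (Gm u e x * Hm f e x).trace

noncomputable def gsq {n : ℕ} (f : Eu n → ℝ) (x : Eu n) : ℝ := ∑ i, (pd (sb i) f x)^2

noncomputable def tau1 {n : ℕ} (u : Eu n → ℝ) (x : Eu n) : ℝ := (Hm u (sB n) x).trace
noncomputable def tau2 {n : ℕ} (u : Eu n → ℝ) (x : Eu n) : ℝ := (Hm u (sB n) x * Hm u (sB n) x).trace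

section
variable {n : ℕ} {u : Eu n → ℝ} {e : OrthonormalBasis (Fin n) ℝ (Eu n)} {x : Eu n} {c : ℝ}

lemma conj_mul (A B : Matrix (Fin n) (Fin n) ℝ) (e : OrthonormalBasis (Fin n) ℝ (Eu n)) :
    ((Um e).transpose * A * Um e) * ((Um e).transpose * B * Um e) = (Um e).transpose * (A * B) * Um e := by
  calc _ = (Um e).transpose * A * (Um e * (Um e).transpose) * B * Um e := by noncomm_ring
    _ = _ := by rw [Um_orth']; noncomm_ring

lemma conj_trace (A : Matrix (Fin n) (Fin n) ℝ) (e : OrthonormalBasis (Fin n) ℝ (Eu n)) :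
    ((Um e).transpose * A * Um e).trace = A.trace := by
  rw [Matrix.trace_mul_comm, ← mul_assoc, Um_orth', one_mul]

lemma Gm_change (hu : ContDiff ℝ ∞ u) :
    Gm u e x = (Um e).transpose * Gm u (sB n) x * Um e := by
  unfold Gm
  apply Matrix.inv_eq_left_inv
  rw [Hm_change (e := e) hu, conj_mul]
  have : 1 + (Um e).transpose * (Hm u (sB n) x * Hm u (sB n) x) * Um e =
    (Um e).transpose * (1 + Hm u (sB n) x * Hm u (sB n) x) * Um e := by
    rw [mul_add, add_mul, mul_one, Um_orth]
  rw [this, conj_mul]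
  have h := G_mul (e := sB n) (x := x) hu
  unfold Gm at h
  rw [h, mul_one, Um_orth]

lemma lap_change (hu : ContDiff ℝ ∞ u) {f : Eu n → ℝ} (hf : ContDiff ℝ ∞ f) :
    lap u e f x = lap u (sB n) f x := by
  unfold lap
  rw [Gm_change hu, Hm_change hf, conj_mul, conj_trace]

lemma gsq_change (f : Eu n → ℝ) : ∑ a, (pd (e a) f x)^2 = gsq f x := by
  have h : ∀ a, pd (e a) f x = ((Um e).transpose.mulVec (fun i => pd (sb i) f x)) a := by
    intro a
    rw [pd_lin _ _ _ _ (basis_exp e a)]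
    simp [Matrix.mulVec, dotProduct]
  unfold gsq
  have h2 : ∑ a, (pd (e a) f x)^2 = dotProduct ((Um e).transpose.mulVec (fun i => pd (sb i) f x))
     ((Um e).transpose.mulVec (fun i => pd (sb i) f x)) := by
    simp only [dotProduct, h, sq]
  rw [h2, Matrix.dotProduct_mulVec, Matrix.vecMul_transpose, Matrix.mulVec_mulVec, Um_orth', Matrix.one_mulVec]
  simp [dotProduct, sq]

lemma tau1_eq (hu : ContDiff ℝ ∞ u) (e : OrthonormalBasis (Fin n) ℝ (Eu n)) :
    tau1 u = fun x => (Hm u e x).trace := by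
  funext x; rw [Hm_change hu, conj_trace]; rfl

lemma tau2_eq (hu : ContDiff ℝ ∞ u) (e : OrthonormalBasis (Fin n) ℝ (Eu n)) :
    tau2 u = fun x => (Hm u e x * Hm u e x).trace := by
  funext x; rw [Hm_change hu, conj_mul, conj_trace]; rfl

lemma T_symm1 (hu : ContDiff ℝ ∞ u) (v : Eu n) (a b : Fin n) :
    mpd v (Hm u e) x a b = mpd v (Hm u e) x b a := by
  simp only [mpd, Matrix.of_apply]
  congr 1; funext y; exact Hm_symm hu e y a b

lemma T_symm2 (hu : ContDiff ℝ ∞ u) (a b k : Fin n) :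
    mpd (e k) (Hm u e) x a b = mpd (e b) (Hm u e) x a k := by
  simp only [mpd, Hm, Matrix.of_apply]
  change pd (e k) (pd (e a) (pd (e b) u)) x = pd (e b) (pd (e a) (pd (e k) u)) x
  rw [pd_comm ((pd_contDiff hu (e b)).nat 2) (e k) (e a), pd_comm (hu.nat 2) (e k) (e b),
    pd_comm ((pd_contDiff hu (e k)).nat 2) (e a) (e b)]

lemma mpdH_contDiff (hu : ContDiff ℝ ∞ u) (v : Eu n) (a b : Fin n) :
    ContDiff ℝ ∞ (fun y => mpd v (Hm u e) y a b) := pd_contDiff (Hm_contDiff hu e a b) v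

lemma four_symm (hu : ContDiff ℝ ∞ u) (i k : Fin n) :
    mpd (e k) (mpd (e k) (Hm u e)) x i i = mpd (e i) (mpd (e i) (Hm u e)) x k k := by
  simp only [mpd, Hm, Matrix.of_apply]
  change pd (e k) (pd (e k) (pd (e i) (pd (e i) u))) x = pd (e i) (pd (e i) (pd (e k) (pd (e k) u))) x
  have c2 : ∀ {f : Eu n → ℝ}, ContDiff ℝ ∞ f → pd (e k) (pd (e i) f) = pd (e i) (pd (e k) f) := by
    intro f hf; exact pd_comm (hf.nat 2) _ _
  have h1 := pd_contDiff hu (e i)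
  have h2 := pd_contDiff hu (e k)
  have h3 := pd_contDiff h2 (e i)
  have h4 := pd_contDiff h2 (e k)
  rw [c2 h1, c2 hu, c2 h3, c2 h2]

lemma G_diag {l : Fin n → ℝ} (hd : Hm u e x = Matrix.diagonal l) :
    Gm u e x = Matrix.diagonal (fun i => 1 / (1 + l i ^2)) := by
  unfold Gm
  apply Matrix.inv_eq_left_inv
  rw [hd, Matrix.diagonal_mul_diagonal, ← Matrix.diagonal_one, Matrix.diagonal_add, Matrix.diagonal_mul_diagonal]
  congr 1
  funext i
  have : 1 + l i ^2 ≠ 0 := by positivity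
  field_simp

lemma trace_mul' (A B : Matrix (Fin n) (Fin n) ℝ) : (A * B).trace = ∑ i, ∑ j, A i j * B j i := by
  simp only [Matrix.trace, Matrix.diag_apply, Matrix.mul_apply]

lemma mpdH_trace_diag (hu : ContDiff ℝ ∞ u) (hS : SLE u c) {l : Fin n → ℝ} (hd : Hm u e x = Matrix.diagonal l) (k : Fin n) :
    ∑ i, (1 / (1 + l i ^2)) * mpd (e k) (Hm u e) x i i = 0 := by
  have := (first_order hu hS e (e k) x).1
  rw [G_diag hd] at this
  simpa [Matrix.trace, Matrix.diagonal_mul] using this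

lemma second_order (hu : ContDiff ℝ ∞ u) (hS : SLE u c) {l : Fin n → ℝ} (hd : Hm u e x = Matrix.diagonal l)
    (g : Fin n → ℝ) (hg : g = fun i => 1 / (1 + l i ^2)) (T : Fin n → Fin n → Fin n → ℝ)
    (hT : T = fun i j k => mpd (e k) (Hm u e) x i j) :
    lap u e (Vf u c) x = Vf u c x *
      ((∑ i, ∑ j, ∑ k, g i * g j * g k * T i j k ^ 2 * (1 - l i * l j + l k * (l i + l j))) +
        ∑ k, g k * (∑ i, l i * (g i * T i i k))^2) := by
  have hG : Gm u e x = Matrix.diagonal g := by rw [G_diag hd, hg]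
  have hgl : ∀ i, g i * (1 + l i^2) = 1 := by
    intro i; rw [hg]; have : 1 + l i ^2 ≠ 0 := by positivity
    field_simp
  have hTs1 : ∀ i j k, T i j k = T j i k := by
    intro i j k; rw [hT]; exact T_symm1 hu _ _ _
  have dH : ∀ a b, DifferentiableAt ℝ (fun y => Hm u e y a b) x := fun a b => cd_diff (Hm_contDiff hu e a b) x
  have dG : ∀ a b, DifferentiableAt ℝ (fun y => Gm u e y a b) x := fun a b => cd_diff (Gm_contDiff hu e a b) x
  have dT : ∀ v, ∀ a b, DifferentiableAt ℝ (fun y => mpd v (Hm u e) y a b) x := fun v a b => cd_diff (mpdH_contDiff hu v a b) x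
  have dHG : ∀ a b, DifferentiableAt ℝ (fun y => (Hm u e y * Gm u e y) a b) x := by
    intro a b
    simp only [Matrix.mul_apply]
    exact DifferentiableAt.fun_sum fun i _ => (dH _ _).fun_mul (dG _ _)
  have dHGT : ∀ v a b, DifferentiableAt ℝ (fun y => (Hm u e y * Gm u e y * mpd v (Hm u e) y) a b) x := by
    intro v a b
    simp only [Matrix.mul_apply (M := _ * _)]
    exact DifferentiableAt.fun_sum fun i _ => (dHG _ _).fun_mul (dT _ _ _)
  have dGT : ∀ v a b, DifferentiableAt ℝ (fun y => (Gm u e y * mpd v (Hm u e) y) a b) x := by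
    intro v a b
    simp only [Matrix.mul_apply]
    exact DifferentiableAt.fun_sum fun i _ => (dG _ _).fun_mul (dT _ _ _)
  set β : Fin n → ℝ := fun k => ∑ i, l i * (g i * T i i k) with hβ
  set B : Fin n → Eu n → ℝ := fun k y => (Hm u e y * Gm u e y * mpd (e k) (Hm u e) y).trace with hB
  have hBβ : ∀ k, B k x = β k := by
    intro k
    simp only [hB, hβ]
    rw [hd, hG, Matrix.diagonal_mul_diagonal]
    simp [Matrix.trace, Matrix.diagonal_mul, hT, mul_assoc]
  have dB : ∀ k, DifferentiableAt ℝ (B k) x := by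
    intro k
    simp only [hB, Matrix.trace, Matrix.diag_apply]
    exact DifferentiableAt.fun_sum fun i _ => dHGT _ _ _
  -- fourth order terms
  have four : ∀ i, ∑ k, g k * mpd (e k) (mpd (e k) (Hm u e)) x i i = ∑ j, ∑ k, g j * (l j + l k) * g k * T j k i ^2 := by
    intro i
    have h0 : (fun y => (Gm u e y * mpd (e i) (Hm u e) y).trace) = fun _ => 0 := by
      funext y; exact (first_order hu hS e (e i) y).1
    have h1 := pd_trace (v := e i) (dGT (e i))
    rw [h0, pd_const, mpd_mul dG (dT (e i)), mpd_G hu, hd, hG, Matrix.trace_add] at h1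
    have h2 : (Matrix.diagonal g * mpd (e i) (mpd (e i) (Hm u e)) x).trace = ∑ k, g k * mpd (e k) (mpd (e k) (Hm u e)) x i i := by
      simp only [Matrix.trace, Matrix.diag_apply, Matrix.diagonal_mul]
      exact Finset.sum_congr rfl fun k _ => by rw [four_symm hu]
    have h3 : (-(Matrix.diagonal g * (mpd (e i) (Hm u e) x * Matrix.diagonal l + Matrix.diagonal l * mpd (e i) (Hm u e) x) * Matrix.diagonal g) *
            mpd (e i) (Hm u e) x).trace = - ∑ j, ∑ k, g j * (l j + l k) * g k * T j k i ^2 := by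
      rw [neg_mul, Matrix.trace_neg]
      congr 1
      rw [trace_mul']
      simp only [Matrix.mul_diagonal, Matrix.diagonal_mul, Matrix.add_apply]
      refine Finset.sum_congr rfl fun j _ => Finset.sum_congr rfl fun k _ => ?_
      rw [T_symm1 hu (e i) k j]
      simp only [hT]; ring
    rw [h2, h3] at h1
    linarith
  have key : ∀ k, pd (e k) (B k) x = (∑ i, ∑ j, g i * g j * (1 - l i * l j) * T i j k ^2)
      + ∑ i, l i * (g i * mpd (e k) (mpd (e k) (Hm u e)) x i i) := by
    intro k
    rw [hB]
    rw [pd_trace (dHGT (e k)), mpd_mul dHG (dT _), mpd_mul dH dG, mpd_G hu, hd, hG, Matrix.trace_add]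
    congr 1
    · rw [trace_mul']
      refine Finset.sum_congr rfl fun i _ => Finset.sum_congr rfl fun j _ => ?_
      rw [T_symm1 hu (e k) j i]
      have e1 : mpd (e k) (Hm u e) x i j = T i j k := by rw [hT]
      simp only [Matrix.mul_diagonal, Matrix.diagonal_mul, Matrix.add_apply, Matrix.neg_apply, e1]
      have h2 := hgl i
      have : g j * T i j k ^2 * (g i * (1 + l i^2)) = g j * T i j k ^2 := by rw [h2, mul_one]
      linear_combination -this
    · rw [Matrix.diagonal_mul_diagonal]
      simp [Matrix.trace, Matrix.diagonal_mul, mul_assoc]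
  have hVk : ∀ k, pd (e k) (pd (e k) (Vf u c)) x = Vf u c x * (β k ^2 + pd (e k) (B k) x) := by
    intro k
    have h1 : pd (e k) (Vf u c) = fun y => Vf u c y * B k y := by
      funext y; exact (first_order hu hS e (e k) y).2
    rw [h1, pd_mul (cd_diff (contDiff_Vf hu c) x) (dB k), h1]
    simp only [hBβ]; ring
  unfold lap
  rw [hG]
  have : (Matrix.diagonal g * Hm (Vf u c) e x).trace = ∑ k, g k * (Vf u c x * (β k ^2 + pd (e k) (B k) x)) := by
    simp only [Matrix.trace, Matrix.diag_apply, Matrix.diagonal_mul, Hm, Matrix.of_apply]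
    exact Finset.sum_congr rfl fun k _ => by rw [hVk]
  rw [this]
  have h5 : ∑ k, g k * (Vf u c x * (β k ^2 + pd (e k) (B k) x)) =
     Vf u c x * ((∑ k, g k * pd (e k) (B k) x) + ∑ k, g k * β k ^2) := by
    rw [← Finset.sum_add_distrib, Finset.mul_sum]
    exact Finset.sum_congr rfl fun k _ => by ring
  rw [h5]
  congr 2
  have h6 : ∑ k, g k * pd (e k) (B k) x = (∑ k, ∑ i, ∑ j, g i * g j * g k * T i j k ^2 * (1 - l i * l j))
     + ∑ i, l i * g i * ∑ k, g k * mpd (e k) (mpd (e k) (Hm u e)) x i i := by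
    have : ∑ i, l i * g i * ∑ k, g k * mpd (e k) (mpd (e k) (Hm u e)) x i i =
       ∑ k, ∑ i, l i * g i * (g k * mpd (e k) (mpd (e k) (Hm u e)) x i i) := by
      simp only [Finset.mul_sum]; rw [Finset.sum_comm]
    rw [this, ← Finset.sum_add_distrib]
    refine Finset.sum_congr rfl fun k _ => ?_
    rw [key, mul_add]
    simp only [Finset.mul_sum]
    congr 1
    · exact Finset.sum_congr rfl fun i _ => Finset.sum_congr rfl fun j _ => by ring
    · exact Finset.sum_congr rfl fun i _ => by ring
  rw [h6]
  simp only [four]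
  have h7 : ∑ i, l i * g i * ∑ j, ∑ k, g j * (l j + l k) * g k * T j k i ^2 =
     ∑ k, ∑ i, ∑ j, g i * g j * g k * T i j k ^2 * (l k * (l i + l j)) := by
    refine Finset.sum_congr rfl fun i _ => ?_
    simp only [Finset.mul_sum]
    exact Finset.sum_congr rfl fun i _ => Finset.sum_congr rfl fun j _ => by ring
  rw [h7, ← Finset.sum_add_distrib]
  have h8 : ∑ i, ∑ j, ∑ k, g i * g j * g k * T i j k ^ 2 * (1 - l i * l j + l k * (l i + l j)) =
    ∑ k, ∑ i, ∑ j, g i * g j * g k * T i j k ^ 2 * (1 - l i * l j + l k * (l i + l j)) := by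
      rw [Finset.sum_congr rfl fun i _ => Finset.sum_comm, Finset.sum_comm]
  rw [h8]
  refine Finset.sum_congr rfl fun k _ => ?_
  rw [← Finset.sum_add_distrib]
  refine Finset.sum_congr rfl fun i _ => ?_
  rw [← Finset.sum_add_distrib]
  exact Finset.sum_congr rfl fun j _ => by ring

/-- eigenvalue hypotheses -/
def EH (u : Eu n → ℝ) (K : ℝ) : Prop :=
  ∀ x, ∃ (e : OrthonormalBasis (Fin n) ℝ (Eu n)) (l : Fin n → ℝ), Hm u e x = Matrix.diagonal l ∧
    (∀ i, |l i| ≤ K) ∧ ∀ i j, 0 ≤ 3 + l i ^ 2 + 2 * l i * l j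

theorem lapV_ge (hu : ContDiff ℝ ∞ u) (hS : SLE u c) {K : ℝ} (hE : EH u K) (x : Eu n) :
    Vf u c x * (gsq (tau1 u) x + gsq (tau2 u) x) ≤ Dc n K * (1 + K^2) * lap u (sB n) (Vf u c) x := by
  obtain ⟨e, l, hd, hl, hc⟩ := hE x
  have h := alg_core l (fun i => 1 / (1 + l i ^2)) (fun i j k => mpd (e k) (Hm u e) x i j) K hl
    (fun i => by have : 1 + l i ^2 ≠ 0 := by positivity
                 field_simp) hc (fun i j k => T_symm1 hu _ _ _) (fun i j k => T_symm2 hu _ _ _)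
    (fun k => mpdH_trace_diag hu hS hd k)
  rw [← lap_change (e := e) hu (contDiff_Vf hu c), second_order hu hS hd _ rfl _ rfl]
  have dH : ∀ a b, DifferentiableAt ℝ (fun y => Hm u e y a b) x := fun a b => cd_diff (Hm_contDiff hu e a b) x
  have dHH : ∀ a b, DifferentiableAt ℝ (fun y => (Hm u e y * Hm u e y) a b) x := by
    intro a b
    simp only [Matrix.mul_apply]
    exact DifferentiableAt.fun_sum fun i _ => (dH _ _).fun_mul (dH _ _)
  have e1 : ∀ k, pd (e k) (tau1 u) x = ∑ i, mpd (e k) (Hm u e) x i i := by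
    intro k; rw [tau1_eq hu e, pd_trace dH]; rfl
  have e2 : ∀ k, pd (e k) (tau2 u) x = 2 * ∑ i, l i * mpd (e k) (Hm u e) x i i := by
    intro k; rw [tau2_eq hu e, pd_trace dHH, mpd_mul dH dH, hd, Matrix.trace_add, Matrix.trace_mul_comm, ← two_mul]
    simp [Matrix.trace, Matrix.diagonal_mul]
  rw [← gsq_change (e := e), ← gsq_change (e := e), ← Finset.sum_add_distrib]
  simp only [e1, e2]
  have := mul_le_mul_of_nonneg_left h (hS x).1.le
  refine this.trans (le_of_eq ?_)
  ring

end
end SLag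

namespace SLag
open scoped ContDiff
open MeasureTheory

/-- the standing hypotheses -/
structure Good {n : ℕ} (u : Eu n → ℝ) (c K : ℝ) : Prop where
  sm : ContDiff ℝ ∞ u
  sl : SLE u c
  eh : EH u K

noncomputable def gIn {n : ℕ} (u φ f : Eu n → ℝ) (x : Eu n) : ℝ :=
  ∑ i, ∑ j, Gm u (sB n) x i j * pd (sb i) φ x * pd (sb j) f x

section
variable {n : ℕ} {u : Eu n → ℝ} {x : Eu n} {c K : ℝ}

lemma lap_eq (f : Eu n → ℝ) (x : Eu n) : lap u (sB n) f x =
    ∑ i, ∑ j, Gm u (sB n) x i j * pd (sb j) (pd (sb i) f) x := by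
  unfold lap; rw [trace_mul']; simp [Hm]

lemma div_free (h : Good u c K) (x : Eu n) (j : Fin n) :
    ∑ i, pd (sb i) (fun y => Vf u c y * Gm u (sB n) y i j) x = 0 := by
  set e := sB n with he
  have hu := h.sm
  have dV := cd_diff (contDiff_Vf hu c) x
  have dG : ∀ a b, DifferentiableAt ℝ (fun y => Gm u e y a b) x := fun a b => cd_diff (Gm_contDiff hu e a b) x
  set G := Gm u e x with hG
  set H := Hm u e x with hH
  set T : Fin n → Matrix (Fin n) (Fin n) ℝ := fun k => mpd (e k) (Hm u e) x with hT
  have esb : ∀ i, (sb i : Eu n) = e i := by intro i; simp [he]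
  have f1 : ∀ k, (G * T k).trace = 0 := fun k => (first_order hu h.sl e (e k) x).1
  have f2 : ∀ k, pd (e k) (Vf u c) x = Vf u c x * (H * G * T k).trace := fun k => (first_order hu h.sl e (e k) x).2
  have s : ∀ a b k, T k a b = T b a k := fun a b k => T_symm2 hu a b k
  have s1 : ∀ a b k, T k a b = T k b a := fun a b k => T_symm1 hu _ a b
  have hGs : ∀ a b, G a b = G b a := fun a b => by
    have := congrFun (congrFun (G_isSymm (e := e) (x := x) hu) b) a
    exact this
  have step : ∀ i, pd (sb i) (fun y => Vf u c y * Gm u e y i j) x =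
     Vf u c x * ((H * G * T i).trace * G i j - (G * T i * (H * G)) i j - ((H * G) * T i * G) i j) := by
    intro i
    rw [esb, pd_mul dV (dG i j), f2]
    have : pd (e i) (fun y => Gm u e y i j) x = mpd (e i) (Gm u e) x i j := rfl
    rw [this, mpd_G hu]
    have r : Gm u e x * (mpd (e i) (Hm u e) x * Hm u e x + Hm u e x * mpd (e i) (Hm u e) x) * Gm u e x =
       G * T i * (H * G) + (H * G) * T i * G := by
      have gc := G_comm (e := e) (x := x) hu
      calc _ = G * T i * (H * G) + (G * H) * T i * G := by simp only [hG, hH, hT]; noncomm_ring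
        _ = _ := by rw [gc]
    rw [r]
    simp only [Matrix.neg_apply, Matrix.add_apply]
    ring
  simp only [step]
  rw [← Finset.mul_sum, Finset.sum_sub_distrib, Finset.sum_sub_distrib]
  have t1 : ∑ i, (G * T i * (H * G)) i j = 0 := by
    have : ∀ b, ∑ i, (G * T i) i b = (G * T b).trace := by
      intro b
      rw [trace_mul']
      simp only [Matrix.mul_apply]
      refine Finset.sum_congr rfl fun i _ => Finset.sum_congr rfl fun a _ => ?_
      rw [s a b i]
    simp only [Matrix.mul_apply (M := _ * _)]
    rw [Finset.sum_comm]
    simp only [← Finset.sum_mul]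
    refine Finset.sum_eq_zero fun b _ => ?_
    rw [this, f1, zero_mul]
  have t2 : ∑ i, ((H * G) * T i * G) i j = ∑ i, (H * G * T i).trace * G i j := by
    have : ∀ b, ∑ i, ((H * G) * T i) i b = ((H * G) * T b).trace := by
      intro b
      rw [trace_mul']
      simp only [Matrix.mul_apply (M := H * G)]
      refine Finset.sum_congr rfl fun i _ => Finset.sum_congr rfl fun a _ => ?_
      rw [s a b i]
    simp only [Matrix.mul_apply (M := _ * _) (N := G)]
    rw [Finset.sum_comm]
    simp only [← Finset.sum_mul]
    refine Finset.sum_congr rfl fun b _ => ?_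
    rw [this]
  rw [t1, t2]; simp

lemma int_pd_zero {F : Eu n → ℝ} (hF : ContDiff ℝ 1 F) (hc : HasCompactSupport F) (v : Eu n) :
    ∫ x, pd v F x = 0 := by
  have hd : ∀ x, HasFDerivAt F (fderiv ℝ F x) x := fun x => (hF.differentiable (by norm_num) x).hasFDerivAt
  have hcont : Continuous (fun x => fderiv ℝ F x v) :=
    (hF.continuous_fderiv (by norm_num)).clm_apply continuous_const
  have hcs : HasCompactSupport (fun x => fderiv ℝ F x v) := by
    exact (hc.fderiv (𝕜 := ℝ)).comp_left (g := fun L : Eu n →L[ℝ] ℝ => L v) (by simp)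
  have := integral_mul_fderiv_eq_neg_fderiv_mul_of_integrable (μ := volume) (𝕜 := ℝ) (f := fun _ : Eu n => (1:ℝ)) (g := F) (v := v)
    (by simp) (by simpa using hcont.integrable_of_hasCompactSupport hcs)
    (by simpa using hF.continuous.integrable_of_hasCompactSupport hc) (fun _ _ => by fun_prop) (fun x _ => hF.differentiable (by norm_num) x)
  simpa [pd] using this

lemma pd_compact {F : Eu n → ℝ} (hc : HasCompactSupport F) (v : Eu n) : HasCompactSupport (pd v F) :=
  (hc.fderiv (𝕜 := ℝ)).comp_left (g := fun L : Eu n →L[ℝ] ℝ => L v) (by simp)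

lemma gIn_continuous (hu : ContDiff ℝ ∞ u) {φ f : Eu n → ℝ} (hφ : ContDiff ℝ 1 φ) (hf : ContDiff ℝ 1 f) :
    Continuous (gIn u φ f) := by
  unfold gIn
  have h1 : ∀ i, Continuous (pd (sb i) φ) := fun i => (pd_contDiff_nat (k := 0) (by exact_mod_cast hφ) _).continuous
  have h2 : ∀ i, Continuous (pd (sb i) f) := fun i => (pd_contDiff_nat (k := 0) (by exact_mod_cast hf) _).continuous
  have h3 : ∀ i j, Continuous (fun x => Gm u (sB n) x i j) := fun i j => (Gm_contDiff hu _ i j).continuous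
  fun_prop

lemma lap_continuous (hu : ContDiff ℝ ∞ u) {f : Eu n → ℝ} (hf : ContDiff ℝ 2 f) :
    Continuous (lap u (sB n) f) := by
  have : lap u (sB n) f = fun x => ∑ i, ∑ j, Gm u (sB n) x i j * pd (sb j) (pd (sb i) f) x := funext (lap_eq f)
  rw [this]
  have h2 : ∀ i j, Continuous (pd (sb j) (pd (sb i) f)) := fun i j =>
    (pd_contDiff_nat (k := 0) (pd_contDiff_nat (k := 1) (by exact_mod_cast hf) _) _).continuous
  have h3 : ∀ i j, Continuous (fun x => Gm u (sB n) x i j) := fun i j => (Gm_contDiff hu _ i j).continuous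
  fun_prop

/-- integration by parts for the metric Laplacian -/
lemma ibp (h : Good u c K) {φ f : Eu n → ℝ} (hφ : ContDiff ℝ 1 φ) (hc : HasCompactSupport φ) (hf : ContDiff ℝ 2 f) :
    ∫ x, φ x * (Vf u c x * lap u (sB n) f x) = - ∫ x, Vf u c x * gIn u φ f x := by
  have hu := h.sm
  have hV := contDiff_Vf hu c
  have hG := Gm_contDiff hu (sB n)
  have hf1 : ∀ j, ContDiff ℝ 1 (pd (sb j) f) := fun j => pd_contDiff_nat (k := 1) (by exact_mod_cast hf) _
  have hVG : ∀ i j, ContDiff ℝ 1 (fun y => Vf u c y * Gm u (sB n) y i j) := fun i j => (hV.mul (hG i j)).nat 1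
  set F : Fin n → Fin n → Eu n → ℝ := fun i j y => φ y * ((Vf u c y * Gm u (sB n) y i j) * pd (sb j) f y) with hF
  have cF : ∀ i j, ContDiff ℝ 1 (F i j) := fun i j => hφ.mul ((hVG i j).mul (hf1 j))
  have sF : ∀ i j, HasCompactSupport (F i j) := fun i j => hc.mul_right
  have z : ∀ i j, ∫ x, pd (sb i) (F i j) x = 0 := fun i j => int_pd_zero (cF i j) (sF i j) _
  have pw : ∀ x, φ x * (Vf u c x * lap u (sB n) f x) + Vf u c x * gIn u φ f x = ∑ i, ∑ j, pd (sb i) (F i j) x := by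
    intro x
    have d1 := (hφ.differentiable (by norm_num)) x
    have d2 := fun i j => ((hVG i j).differentiable (by norm_num)) x
    have d3 := fun j => ((hf1 j).differentiable (by norm_num)) x
    have e1 : ∀ i j, pd (sb i) (F i j) x = pd (sb i) φ x * ((Vf u c x * Gm u (sB n) x i j) * pd (sb j) f x) +
       φ x * (pd (sb i) (fun y => Vf u c y * Gm u (sB n) y i j) x * pd (sb j) f x +
        (Vf u c x * Gm u (sB n) x i j) * pd (sb i) (pd (sb j) f) x) := by
      intro i j
      rw [hF]; simp only
      rw [pd_mul d1 ((d2 i j).fun_mul (d3 j)), pd_mul (d2 i j) (d3 j)]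
    have e2 : ∑ i, ∑ j, φ x * (pd (sb i) (fun y => Vf u c y * Gm u (sB n) y i j) x * pd (sb j) f x) = 0 := by
      rw [Finset.sum_comm]
      refine Finset.sum_eq_zero fun j _ => ?_
      rw [← Finset.mul_sum, ← Finset.sum_mul, div_free h x j]; simp
    have e3 : ∑ i, ∑ j, pd (sb i) (F i j) x = (∑ i, ∑ j, pd (sb i) φ x * ((Vf u c x * Gm u (sB n) x i j) * pd (sb j) f x))
      + (∑ i, ∑ j, φ x * (pd (sb i) (fun y => Vf u c y * Gm u (sB n) y i j) x * pd (sb j) f x)) +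
       ∑ i, ∑ j, φ x * (Vf u c x * Gm u (sB n) x i j) * pd (sb i) (pd (sb j) f) x := by
      simp only [← Finset.sum_add_distrib, e1]
      exact Finset.sum_congr rfl fun i _ => Finset.sum_congr rfl fun j _ => by ring
    rw [e3, e2, lap_eq]
    unfold gIn
    simp only [Finset.mul_sum]
    rw [add_zero, add_comm]
    congr 1
    · exact Finset.sum_congr rfl fun i _ => Finset.sum_congr rfl fun j _ => by ring
    · refine Finset.sum_congr rfl fun i _ => Finset.sum_congr rfl fun j _ => ?_
      rw [pd_comm (f := f) hf (sb j) (sb i)]; ring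
  have i1 : Integrable (fun x => φ x * (Vf u c x * lap u (sB n) f x)) := by
    refine Continuous.integrable_of_hasCompactSupport ?_ hc.mul_right
    exact hφ.continuous.mul (hV.continuous.mul (lap_continuous hu hf))
  have i2 : Integrable (fun x => Vf u c x * gIn u φ f x) := by
    refine Continuous.integrable_of_hasCompactSupport
      (hV.continuous.mul (gIn_continuous hu hφ (hf.of_le (by norm_num)))) ?_
    refine HasCompactSupport.mul_left ?_
    refine hc.fderiv (𝕜 := ℝ) |>.mono ?_
    intro x hx
    simp only [Function.mem_support] at hx ⊢
    contrapose! hx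
    unfold gIn pd; simp [hx]
  have := integral_add i1 i2
  simp only [pw] at this
  rw [integral_finsetSum] at this
  · have z2 : ∀ i, ∫ x, ∑ j, pd (sb i) (F i j) x = 0 := by
      intro i
      rw [integral_finsetSum]
      · simp [z]
      · intro j _
        exact ((pd_contDiff_nat (k := 0) (by exact_mod_cast cF i j) _).continuous).integrable_of_hasCompactSupport (pd_compact (sF i j) _)
    simp only [z2, Finset.sum_const_zero] at this
    linarith
  · intro i _
    refine integrable_finsetSum _ fun j _ => ?_
    exact ((pd_contDiff_nat (k := 0) (by exact_mod_cast cF i j) _).continuous).integrable_of_hasCompactSupport (pd_compact (sF i j) _)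

lemma V_eq (h : Good u c K) {e : OrthonormalBasis (Fin n) ℝ (Eu n)} {l : Fin n → ℝ} (hd : Hm u e x = Matrix.diagonal l) :
    Vf u c x = ∏ i, Real.sqrt (1 + l i ^2) := by
  have h1 : cdet (Hm u e x) = Vf u c x * Complex.exp (c * Complex.I) := by
    rw [Hm_change h.sm, cdet_conj]; exact (h.sl x).2
  have h2 : cdet (Hm u e x) = ∏ i, (1 + Complex.I * l i) := by
    rw [hd]; unfold cdet
    rw [Matrix.diagonal_map (by simp), ← Matrix.diagonal_smul, ← Matrix.diagonal_one, Matrix.diagonal_add, Matrix.det_diagonal]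
    simp
  have h3 := congrArg norm (h1.symm.trans h2)
  rw [norm_mul, Complex.norm_exp_ofReal_mul_I, mul_one, Complex.norm_real, Real.norm_of_nonneg (h.sl x).1.le, norm_prod] at h3
  rw [h3]
  refine Finset.prod_congr rfl fun i _ => ?_
  rw [Complex.norm_def, Complex.normSq_apply]
  simp [sq]

lemma V_ge_one (h : Good u c K) (x : Eu n) : 1 ≤ Vf u c x := by
  obtain ⟨e, l, hd, -, -⟩ := h.eh x
  rw [V_eq h hd]
  have : ∏ _i : Fin n, (1:ℝ) ≤ ∏ i, Real.sqrt (1 + l i ^2) := by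
    refine Finset.prod_le_prod (fun i _ => by norm_num) fun i _ => ?_
    rw [Real.one_le_sqrt]; nlinarith [sq_nonneg (l i)]
  simpa using this

lemma V_le (h : Good u c K) (x : Eu n) : Vf u c x ≤ (1 + K)^n := by
  obtain ⟨e, l, hd, hl, -⟩ := h.eh x
  rw [V_eq h hd]
  calc _ ≤ ∏ _i : Fin n, (1 + K) := by
        refine Finset.prod_le_prod (fun i _ => Real.sqrt_nonneg _) fun i _ => ?_
        have hK : 0 ≤ K := (abs_nonneg _).trans (hl i)
        rw [Real.sqrt_le_left (by linarith)]
        have := sq_le_sq' (by linarith [neg_abs_le (l i), hl i]) ((le_abs_self _).trans (hl i))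
        nlinarith
    _ = _ := by simp

end
end SLag

namespace SLag
open scoped ContDiff Topology
open MeasureTheory

noncomputable def Q3 (s : ℝ) : ℝ := (max (1 - s) 0)^3
noncomputable def Q2 (s : ℝ) : ℝ := 3 * (max (1 - s) 0)^2
noncomputable def Q1 (s : ℝ) : ℝ := 6 * (max (1 - s) 0)

lemma pospow_deriv (k : ℕ) (t : ℝ) : HasDerivAt (fun t : ℝ => (max t 0)^(k+2)) ((k+2) * (max t 0)^(k+1)) t := by
  have key : ∀ y : ℝ, y ≠ 0 → HasDerivAt (fun t : ℝ => (max t 0)^(k+2)) ((k+2) * (max y 0)^(k+1)) y := by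
    intro y hy
    rcases lt_or_gt_of_ne hy with h | h
    · have e : (fun t : ℝ => (max t 0)^(k+2)) =ᶠ[𝓝 y] fun _ => 0 := by
        filter_upwards [gt_mem_nhds h] with z hz
        rw [max_eq_right hz.le]; simp
      rw [max_eq_right h.le]
      simpa using (hasDerivAt_const y (0:ℝ)).congr_of_eventuallyEq e
    · have e : (fun t : ℝ => (max t 0)^(k+2)) =ᶠ[𝓝 y] fun z => z^(k+2) := by
        filter_upwards [lt_mem_nhds h] with z hz
        rw [max_eq_left hz.le]
      rw [max_eq_left h.le]
      have := (hasDerivAt_pow (k+2) y).congr_of_eventuallyEq e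
      simpa using this
  by_cases ht : t = 0
  · subst ht
    exact hasDerivAt_of_hasDerivAt_of_ne (g := fun y => (k+2) * (max y 0)^(k+1)) key
      (by fun_prop) (by fun_prop)
  · exact key t ht

lemma Q3_deriv (s : ℝ) : HasDerivAt Q3 (- Q2 s) s := by
  have h := (pospow_deriv 1 (1 - s)).comp s ((hasDerivAt_id s).const_sub 1)
  change HasDerivAt (fun s => (max (1-s) 0)^3) _ s
  refine HasDerivAt.congr_deriv (f := fun s => (max (1-s) 0)^3) h ?_
  unfold Q2; push_cast; ring

lemma Q2_deriv (s : ℝ) : HasDerivAt Q2 (- Q1 s) s := by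
  have h := ((pospow_deriv 0 (1 - s)).comp s ((hasDerivAt_id s).const_sub 1)).const_mul 3
  change HasDerivAt (fun s => 3 * (max (1-s) 0)^2) _ s
  refine HasDerivAt.congr_deriv (f := fun s => 3 * (max (1-s) 0)^2) h ?_
  unfold Q1; push_cast; ring

lemma Q1_cont : Continuous Q1 := by unfold Q1; fun_prop
lemma Q2_cont : Continuous Q2 := by unfold Q2; fun_prop
lemma Q3_cont : Continuous Q3 := by unfold Q3; fun_prop

lemma Q2_contDiff : ContDiff ℝ 1 Q2 := by
  rw [contDiff_one_iff_deriv]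
  refine ⟨fun s => (Q2_deriv s).differentiableAt, ?_⟩
  have : deriv Q2 = fun s => - Q1 s := funext fun s => (Q2_deriv s).deriv
  rw [this]; exact Q1_cont.neg

lemma Q3_contDiff : ContDiff ℝ 1 Q3 := by
  rw [contDiff_one_iff_deriv]
  refine ⟨fun s => (Q3_deriv s).differentiableAt, ?_⟩
  have : deriv Q3 = fun s => - Q2 s := funext fun s => (Q3_deriv s).deriv
  rw [this]; exact Q2_cont.neg

lemma Q1_nonneg (s : ℝ) : 0 ≤ Q1 s := by unfold Q1; positivity
lemma Q2_nonneg (s : ℝ) : 0 ≤ Q2 s := by unfold Q2; positivity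
lemma Q3_nonneg (s : ℝ) : 0 ≤ Q3 s := by unfold Q3; positivity
lemma Q1_zero {s : ℝ} (h : 1 ≤ s) : Q1 s = 0 := by unfold Q1; rw [max_eq_right (by linarith)]; simp
lemma Q2_zero {s : ℝ} (h : 1 ≤ s) : Q2 s = 0 := by unfold Q2; rw [max_eq_right (by linarith)]; simp
lemma Q3_zero {s : ℝ} (h : 1 ≤ s) : Q3 s = 0 := by unfold Q3; rw [max_eq_right (by linarith)]; simp
lemma Q1_pos {s : ℝ} (h : s < 1) : 0 < Q1 s := by
  unfold Q1; have : 0 < max (1-s) 0 := lt_max_of_lt_left (by linarith)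
  positivity
lemma Q1_le {s : ℝ} (h : 0 ≤ s) : Q1 s ≤ 6 := by
  unfold Q1; have : max (1-s) 0 ≤ 1 := max_le (by linarith) (by norm_num)
  linarith
lemma Q2_le {s : ℝ} (h : 0 ≤ s) : Q2 s ≤ 3 := by
  unfold Q2; have h1 : max (1-s) 0 ≤ 1 := max_le (by linarith) (by norm_num)
  have h0 : 0 ≤ max (1-s) 0 := le_max_right _ _
  nlinarith

noncomputable def qf {n : ℕ} (u : Eu n → ℝ) (i : Fin n) (x : Eu n) : ℝ := pd (sb i) u x - pd (sb i) u 0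

noncomputable def rho {n : ℕ} (u : Eu n → ℝ) (x : Eu n) : ℝ := (∑ i, x i ^2) + ∑ i, qf u i x ^2

/-- the defect vector -/
noncomputable def dv {n : ℕ} (u : Eu n → ℝ) (x : Eu n) : Fin n → ℝ :=
  (fun i => qf u i x) - (Hm u (sB n) x).mulVec (fun j => x j)

noncomputable def Xp {n : ℕ} (u : Eu n → ℝ) (x : Eu n) : ℝ := dv u x ⬝ᵥ (Gm u (sB n) x).mulVec (dv u x)

section
variable {n : ℕ} {u : Eu n → ℝ} {x : Eu n} {c K : ℝ}

lemma qf_contDiff (hu : ContDiff ℝ ∞ u) (i : Fin n) : ContDiff ℝ ∞ (qf u i) :=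
  (pd_contDiff hu _).sub contDiff_const

lemma coord_contDiff (i : Fin n) : ContDiff ℝ ∞ (fun x : Eu n => x i) :=
  (EuclideanSpace.proj i : Eu n →L[ℝ] ℝ).contDiff

lemma rho_contDiff (hu : ContDiff ℝ ∞ u) : ContDiff ℝ ∞ (rho u) := by
  unfold rho
  exact (ContDiff.sum fun i _ => (coord_contDiff i).pow 2).add (ContDiff.sum fun i _ => (qf_contDiff hu i).pow 2)

lemma rho_ge (x : Eu n) : ‖x‖^2 ≤ rho u x := by
  unfold rho
  rw [EuclideanSpace.norm_sq_eq]
  simp only [Real.norm_eq_abs, sq_abs]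
  have : 0 ≤ ∑ i, qf u i x ^2 := Finset.sum_nonneg fun i _ => sq_nonneg _
  linarith

lemma rho_nonneg (x : Eu n) : 0 ≤ rho u x := (sq_nonneg _).trans (rho_ge x)

lemma pd_qf (hu : ContDiff ℝ ∞ u) (v : Eu n) (i : Fin n) : pd v (qf u i) x = pd v (pd (sb i) u) x := by
  unfold qf
  rw [pd_sub (cd_diff (pd_contDiff hu _) x) (by fun_prop), pd_const, sub_zero]

lemma pd_rho (hu : ContDiff ℝ ∞ u) (j : Fin n) (x : Eu n) :
    pd (sb j) (rho u) x = 2 * (x j + ∑ k, Hm u (sB n) x j k * qf u k x) := by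
  unfold rho
  have h1 := fun i => cd_diff (coord_contDiff (n := n) i) x
  have h2 := fun i => cd_diff (qf_contDiff hu i) x
  rw [pd_add (DifferentiableAt.fun_sum fun i _ => (h1 i).fun_pow 2) (DifferentiableAt.fun_sum fun i _ => (h2 i).fun_pow 2),
    pd_sum (fun i _ => (h1 i).fun_pow 2), pd_sum (fun i _ => (h2 i).fun_pow 2), mul_add, Finset.mul_sum]
  congr 1
  · have : ∀ i, pd (sb j) (fun y : Eu n => y i ^2) x = 2 * (if i = j then 1 else 0) * x i := by
      intro i
      simp only [sq]
      rw [pd_mul (h1 i) (h1 i), pd_coord]; simp [PiLp.single_apply]; split_ifs <;> ring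
    simp only [this]
    simp
  · refine Finset.sum_congr rfl fun i _ => ?_
    simp only [sq]
    rw [pd_mul (h2 i) (h2 i), pd_qf hu]
    simp [Hm]; ring

lemma lap_rho (h : Good u c K) (x : Eu n) : lap u (sB n) (rho u) x = 2 * n := by
  have hu := h.sm
  have h1 := fun i => cd_diff (coord_contDiff (n := n) i) x
  have h2 := fun i => cd_diff (qf_contDiff hu i) x
  have h3 := fun i j => cd_diff (Hm_contDiff hu (sB n) i j) x
  have hh : Hm (rho u) (sB n) x = (2:ℝ) • ((1 + Hm u (sB n) x * Hm u (sB n) x) +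
     ∑ k, qf u k x • mpd (sB n k) (Hm u (sB n)) x) := by
    ext i j
    have e1 : pd (sB n j) (rho u) = fun x => 2 * (x j + ∑ k, Hm u (sB n) x j k * qf u k x) := by
      funext y; simpa using pd_rho hu j y
    have e2 : Hm (rho u) (sB n) x i j = pd (sB n i) (pd (sB n j) (rho u)) x := rfl
    rw [e2, e1, pd_const_mul _ ((h1 j).fun_add (DifferentiableAt.fun_sum fun k _ => (h3 j k).fun_mul (h2 k))),
      pd_add (h1 j) (DifferentiableAt.fun_sum fun k _ => (h3 j k).fun_mul (h2 k)),
      pd_sum (fun k _ => (h3 j k).fun_mul (h2 k)), pd_coord]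
    have e3 : ∀ k, pd (sB n i) (fun x => Hm u (sB n) x j k * qf u k x) x =
       mpd (sB n k) (Hm u (sB n)) x i j * qf u k x + Hm u (sB n) x j k * Hm u (sB n) x i k := by
      intro k
      rw [pd_mul (h3 j k) (h2 k), pd_qf hu]
      congr 2
      · have : pd (sB n i) (fun y => Hm u (sB n) y j k) x = mpd (sB n i) (Hm u (sB n)) x j k := rfl
        rw [this, T_symm2 hu, T_symm1 hu]
      · simp [Hm]
    simp only [e3]
    rw [Finset.sum_add_distrib]
    simp only [Matrix.smul_apply, Matrix.add_apply, Matrix.sum_apply, Matrix.mul_apply, Matrix.one_apply, smul_eq_mul]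
    have e4 : (sB n i) j = if i = j then (1:ℝ) else 0 := by
      simp [PiLp.single_apply, eq_comm]
    rw [e4]
    have e5 : ∑ k, mpd (sB n k) (Hm u (sB n)) x i j * qf u k x = ∑ k, qf u k x * mpd (sB n k) (Hm u (sB n)) x i j :=
      Finset.sum_congr rfl fun k _ => mul_comm _ _
    have e6 : ∑ k, Hm u (sB n) x j k * Hm u (sB n) x i k = ∑ k, Hm u (sB n) x i k * Hm u (sB n) x k j :=
      Finset.sum_congr rfl fun k _ => by rw [Hm_symm hu _ _ j k]; ring
    rw [e5, e6]; ring
  unfold lap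
  rw [hh, Matrix.mul_smul, Matrix.trace_smul, mul_add, G_mul hu, Matrix.mul_sum, Matrix.trace_add, Matrix.trace_sum]
  have : ∀ k, (Gm u (sB n) x * qf u k x • mpd (sB n k) (Hm u (sB n)) x).trace = 0 := by
    intro k
    rw [Matrix.mul_smul, Matrix.trace_smul, (first_order hu h.sl (sB n) _ x).1, smul_zero]
  rw [Finset.sum_eq_zero (fun k _ => this k)]; simp

lemma gIn_dot (φ f : Eu n → ℝ) (x : Eu n) : gIn u φ f x =
    (fun i => pd (sb i) φ x) ⬝ᵥ (Gm u (sB n) x).mulVec (fun i => pd (sb i) f x) := by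
  unfold gIn
  simp only [dotProduct, Matrix.mulVec, Finset.mul_sum]
  exact Finset.sum_congr rfl fun i _ => Finset.sum_congr rfl fun j _ => by ring

lemma gIn_symm (hu : ContDiff ℝ ∞ u) (φ f : Eu n → ℝ) (x : Eu n) : gIn u φ f x = gIn u f φ x := by
  rw [gIn_dot, gIn_dot, Matrix.dotProduct_mulVec, ← Matrix.mulVec_transpose, (G_isSymm hu).eq, dotProduct_comm]

lemma gIn_rho (hu : ContDiff ℝ ∞ u) (x : Eu n) : gIn u (rho u) (rho u) x = 4 * (rho u x - Xp u x) := by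
  rw [gIn_dot]
  set G := Gm u (sB n) x with hG
  set H := Hm u (sB n) x with hH
  set z : Fin n → ℝ := fun j => x j with hz
  set q : Fin n → ℝ := fun i => qf u i x with hq
  have e1 : (fun i => pd (sb i) (rho u) x) = (2:ℝ) • (z + H.mulVec q) := by
    funext i
    rw [pd_rho hu]
    simp [Matrix.mulVec, dotProduct, hz, hq, hH]
  have e2 : rho u x = z ⬝ᵥ z + q ⬝ᵥ q := by
    simp [rho, dotProduct, sq, hz, hq]
  have e3 : Xp u x = (q - H.mulVec z) ⬝ᵥ G.mulVec (q - H.mulVec z) := rfl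
  have gs : G.transpose = G := (G_isSymm hu).eq
  have hs : H.transpose = H := (Hm_isSymm hu _ _).eq
  have gc : G * H = H * G := G_comm hu
  have gm : G + H * G * H = 1 := by
    have := G_mul (e := sB n) (x := x) hu
    rw [← hG, ← hH, mul_add, mul_one, ← mul_assoc, gc] at this
    exact this
  have mv : ∀ (A : Matrix (Fin n) (Fin n) ℝ) (a b : Fin n → ℝ), A.mulVec a ⬝ᵥ b = a ⬝ᵥ A.transpose.mulVec b := by
    intro A a b
    rw [dotProduct_comm, Matrix.dotProduct_mulVec, ← Matrix.mulVec_transpose, dotProduct_comm]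
  have idt : ∀ a : Fin n → ℝ, a ⬝ᵥ a = a ⬝ᵥ G.mulVec a + a ⬝ᵥ H.mulVec (G.mulVec (H.mulVec a)) := by
    intro a
    rw [Matrix.mulVec_mulVec, Matrix.mulVec_mulVec, ← dotProduct_add, ← Matrix.add_mulVec, gm, Matrix.one_mulVec]
  have cr : q ⬝ᵥ G.mulVec (H.mulVec z) = z ⬝ᵥ G.mulVec (H.mulVec q) := by
    rw [Matrix.mulVec_mulVec, dotProduct_comm, mv, Matrix.transpose_mul, gs, hs, ← gc, ← Matrix.mulVec_mulVec]
  have s1 : z ⬝ᵥ H.mulVec (G.mulVec q) = z ⬝ᵥ G.mulVec (H.mulVec q) := by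
    rw [Matrix.mulVec_mulVec, ← gc, ← Matrix.mulVec_mulVec]
  have s2 : q ⬝ᵥ H.mulVec (G.mulVec z) = q ⬝ᵥ G.mulVec (H.mulVec z) := by
    rw [Matrix.mulVec_mulVec, ← gc, ← Matrix.mulVec_mulVec]
  rw [e1, e2, e3, idt z, idt q]
  simp only [Matrix.mulVec_add, Matrix.mulVec_sub, Matrix.mulVec_smul, smul_dotProduct, dotProduct_smul, add_dotProduct, sub_dotProduct,
    dotProduct_add, dotProduct_sub, mv, hs, smul_eq_mul, s1, s2, cr]
  ring

lemma Xp_continuous (hu : ContDiff ℝ ∞ u) : Continuous (Xp u) := by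
  have h1 : ∀ i, Continuous (fun x => dv u x i) := by
    intro i
    have a := fun j => (Hm_contDiff hu (sB n) i j).continuous
    have b := fun j => (coord_contDiff (n := n) j).continuous
    have d := (qf_contDiff hu i).continuous
    simp only [dv, Pi.sub_apply, Matrix.mulVec, dotProduct]
    fun_prop
  have h2 := fun i j => (Gm_contDiff hu (sB n) i j).continuous
  unfold Xp
  simp only [dotProduct, Matrix.mulVec]
  fun_prop

lemma Gm_posDef (hu : ContDiff ℝ ∞ u) : (Gm u (sB n) x).PosDef := (posdef_aux (Hm_isSymm hu _ x)).inv

lemma Xp_nonneg (hu : ContDiff ℝ ∞ u) (x : Eu n) : 0 ≤ Xp u x := by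
  have := (Gm_posDef (x := x) hu).posSemidef.dotProduct_mulVec_nonneg (dv u x)
  simpa [Xp] using this

lemma Xp_zero (hu : ContDiff ℝ ∞ u) {x : Eu n} (h : Xp u x = 0) : dv u x = 0 := by
  by_contra hne
  have := (Gm_posDef (x := x) hu).dotProduct_mulVec_pos hne
  simp only [star_trivial] at this
  exact absurd h this.ne'

end
end SLag

namespace SLag
open scoped ContDiff Topology
open MeasureTheory

lemma integrable_ball {n : ℕ} {F : Eu n → ℝ} (hF : Continuous F) {R : ℝ} (h : ∀ x, R ≤ ‖x‖ → F x = 0) : Integrable F := by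
  refine hF.integrable_of_hasCompactSupport ?_
  refine HasCompactSupport.intro (isCompact_closedBall (0 : Eu n) R) fun x hx => h x ?_
  simp at hx; exact hx.le

lemma compact_ball {n : ℕ} {F : Eu n → ℝ} {R : ℝ} (h : ∀ x, R ≤ ‖x‖ → F x = 0) : HasCompactSupport F := by
  refine HasCompactSupport.intro (isCompact_closedBall (0 : Eu n) R) fun x hx => h x ?_
  simp at hx; exact hx.le

lemma gIn_comp {n : ℕ} {u : Eu n → ℝ} {ψ : ℝ → ℝ} {ψ' : ℝ} {g f : Eu n → ℝ} {x : Eu n} (hψ : HasDerivAt ψ ψ' (g x)) (hg : DifferentiableAt ℝ g x) :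
    gIn u (fun y => ψ (g y)) f x = ψ' * gIn u g f x := by
  unfold gIn
  simp only [pd_comp hψ hg, Finset.mul_sum]
  exact Finset.sum_congr rfl fun i _ => Finset.sum_congr rfl fun j _ => by ring

lemma gIn_mul {n : ℕ} {u : Eu n → ℝ} {a b f : Eu n → ℝ} {x : Eu n} (ha : DifferentiableAt ℝ a x) (hb : DifferentiableAt ℝ b x) :
    gIn u (fun y => a y * b y) f x = b x * gIn u a f x + a x * gIn u b f x := by
  unfold gIn
  simp only [pd_mul ha hb, Finset.mul_sum, ← Finset.sum_add_distrib]
  exact Finset.sum_congr rfl fun i _ => Finset.sum_congr rfl fun j _ => by ring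

noncomputable def Jf {n : ℕ} (u : Eu n → ℝ) (c : ℝ) (f : Eu n → ℝ) (R : ℝ) : ℝ :=
  ∫ x, Q2 (rho u x / R^2) * (f x * Vf u c x)

noncomputable def Df {n : ℕ} (u : Eu n → ℝ) (c : ℝ) (f : Eu n → ℝ) (R : ℝ) : ℝ :=
  (2 / R^3) * (∫ x, Q1 (rho u x / R^2) * (f x * Vf u c x * Xp u x)) +
    (R / 2) * ∫ x, Q3 (rho u x / R^2) * (Vf u c x * lap u (sB n) f x)

section
variable {n : ℕ} {u f : Eu n → ℝ} {x : Eu n} {c K : ℝ}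

lemma rho_out {R : ℝ} (hR : 0 < R) (hx : R ≤ ‖x‖) : 1 ≤ rho u x / R^2 := by
  rw [le_div_iff₀ (by positivity), one_mul]
  exact (pow_le_pow_left₀ hR.le hx 2).trans (rho_ge x)

lemma Jf_hasDeriv (h : Good u c K) (hf : ContDiff ℝ ∞ f) {R : ℝ} (hR : 0 < R) :
    HasDerivAt (Jf u c f) ((2 / R^3) * ∫ x, Q1 (rho u x / R^2) * (f x * Vf u c x * rho u x)) R := by
  have hr := (rho_contDiff h.sm).continuous
  have hV := (contDiff_Vf h.sm c).continuous
  have hfc := hf.continuous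
  have hq2 := Q2_cont
  have hq1 := Q1_cont
  have key := hasDerivAt_integral_of_dominated_loc_of_deriv_le (μ := (volume : Measure (Eu n))) (𝕜 := ℝ)
    (F := fun R x => Q2 (rho u x / R^2) * (f x * Vf u c x))
    (F' := fun R x => (2 / R^3) * (Q1 (rho u x / R^2) * (f x * Vf u c x * rho u x)))
    (x₀ := R) (s := Set.Ioo (R/2) (2*R))
    (bound := (Metric.closedBall (0 : Eu n) (2*R)).indicator fun x => (24 / R) * |f x * Vf u c x|)
    (Ioo_mem_nhds (by linarith) (by linarith)) ?_ ?_ ?_ ?_ ?_ ?_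
  · have := key.2
    rw [integral_const_mul] at this
    exact this
  · exact Filter.Eventually.of_forall fun R => (Continuous.aestronglyMeasurable (by fun_prop))
  · refine integrable_ball (R := R) (by fun_prop) fun x hx => ?_
    rw [Q2_zero (rho_out hR hx), zero_mul]
  · exact (Continuous.aestronglyMeasurable (by fun_prop))
  · refine Filter.Eventually.of_forall fun x r hr' => ?_
    have hr0 : 0 < r := by have := hr'.1; linarith
    have hb0 : 0 ≤ (24 / R) * |f x * Vf u c x| := by positivity
    by_cases h1 : 1 ≤ rho u x / r^2
    · rw [Q1_zero h1]; simp only [zero_mul, mul_zero, norm_zero]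
      exact Set.indicator_nonneg (fun _ _ => by positivity) _
    · push Not at h1
      have hx : x ∈ Metric.closedBall (0 : Eu n) (2*R) := by
        simp only [mem_closedBall_zero_iff]
        by_contra hc
        push Not at hc
        have := rho_out (u := u) hr0 (x := x) (by have := hr'.2; linarith)
        linarith
      rw [Set.indicator_of_mem hx]
      have h0 : 0 ≤ rho u x := rho_nonneg x
      have h2 : Q1 (rho u x / r^2) ≤ 6 := Q1_le (by positivity)
      have h3 := Q1_nonneg (rho u x / r^2)
      have h4 : rho u x ≤ r^2 := by rw [div_lt_one (by positivity)] at h1; exact h1.le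
      rw [Real.norm_eq_abs]
      have e1 : |2 / r ^ 3 * (Q1 (rho u x / r ^ 2) * (f x * Vf u c x * rho u x))| =
        |f x * Vf u c x| * ((2 / r^3) * (Q1 (rho u x / r^2) * rho u x)) := by
        rw [abs_mul, abs_mul, abs_mul (f x * Vf u c x), abs_of_nonneg h3, abs_of_nonneg h0, abs_of_nonneg (show 0 ≤ 2 / r^3 by positivity)]
        ring
      rw [e1, mul_comm]
      refine mul_le_mul_of_nonneg_right ?_ (abs_nonneg _)
      calc 2 / r^3 * (Q1 (rho u x / r^2) * rho u x) ≤ 2 / r^3 * (6 * r^2) := by gcongr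
        _ = 12 / r := by field_simp; ring
        _ ≤ 24 / R := by
          rw [div_le_div_iff₀ hr0 hR]; have := hr'.1; linarith
  · refine IntegrableOn.integrable_indicator ?_ measurableSet_closedBall
    exact (Continuous.continuousOn (by fun_prop)).integrableOn_compact (isCompact_closedBall _ _)
  · refine Filter.Eventually.of_forall fun x r hr' => ?_
    have hr0 : 0 < r := by have := hr'.1; linarith
    have d1 : HasDerivAt (fun r : ℝ => rho u x / r^2) (- 2 * rho u x / r^3) r := by
      have := (hasDerivAt_const r (rho u x)).fun_div (hasDerivAt_pow 2 r) (by positivity)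
      refine this.congr_deriv ?_
      field_simp; push_cast; ring
    have := ((Q2_deriv (rho u x / r^2)).comp r d1).mul_const (f x * Vf u c x)
    refine HasDerivAt.congr_deriv (f := fun r => Q2 (rho u x / r^2) * (f x * Vf u c x)) this ?_
    field_simp

set_option maxHeartbeats 1000000 in
lemma Jf_identity (h : Good u c K) (hf : ContDiff ℝ ∞ f) {R : ℝ} (hR : 0 < R) :
    (2 / R^3) * (∫ x, Q1 (rho u x / R^2) * (f x * Vf u c x * rho u x)) = n / R * Jf u c f R + Df u c f R := by
  have hr' := rho_contDiff h.sm
  have hr := hr'.continuous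
  have hV := (contDiff_Vf h.sm c).continuous
  have hfc := hf.continuous
  have hq2 := Q2_cont
  have hq1 := Q1_cont
  have hq3 := Q3_cont
  have hX := Xp_continuous h.sm
  have hrR : ContDiff ℝ ∞ (fun x => rho u x / R^2) := hr'.div_const _
  have c2 : ContDiff ℝ 1 (fun x => Q2 (rho u x / R^2)) := Q2_contDiff.comp (hrR.nat 1)
  have c3 : ContDiff ℝ 1 (fun x => Q3 (rho u x / R^2)) := Q3_contDiff.comp (hrR.nat 1)
  have I1 := ibp h (φ := fun x => f x * Q2 (rho u x / R^2)) (f := rho u) ((hf.nat 1).mul c2)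
    (compact_ball (R := R) fun x hx => by rw [Q2_zero (rho_out hR hx), mul_zero]) (hr'.nat 2)
  have I2 := ibp h (φ := fun x => Q3 (rho u x / R^2)) (f := f) c3
    (compact_ball (R := R) fun x hx => by rw [Q3_zero (rho_out hR hx)]) (hf.nat 2)
  have gR : ∀ g x, gIn u (fun x => rho u x / R^2) g x = (1/R^2) * gIn u (rho u) g x := by
    intro g x
    have : HasDerivAt (fun t : ℝ => t / R^2) (1/R^2) (rho u x) := (hasDerivAt_id _).div_const _
    exact gIn_comp (ψ := fun t : ℝ => t / R^2) (g := rho u) this (cd_diff hr' x)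
  have g3 : ∀ x, gIn u (fun x => Q3 (rho u x / R^2)) f x = - Q2 (rho u x / R^2) * ((1/R^2) * gIn u f (rho u) x) := by
    intro x
    rw [gIn_comp (ψ := Q3) (g := fun x => rho u x / R^2) (Q3_deriv _) (cd_diff hrR x), gR, gIn_symm h.sm]
  have g2 : ∀ x, gIn u (fun x => f x * Q2 (rho u x / R^2)) (rho u) x = Q2 (rho u x / R^2) * gIn u f (rho u) x
      - f x * Q1 (rho u x / R^2) * ((4/R^2) * (rho u x - Xp u x)) := by
    intro x
    rw [gIn_mul (a := f) (b := fun x => Q2 (rho u x / R^2)) (cd_diff hf x) ((c2.differentiable (by norm_num)).differentiableAt),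
      gIn_comp (ψ := Q2) (g := fun x => rho u x / R^2) (Q2_deriv _) (cd_diff hrR x), gR, gIn_rho h.sm]
    ring
  simp only [lap_rho h, g2] at I1
  simp only [g3] at I2
  have hg := gIn_continuous (u := u) h.sm (hf.nat 1) (hr'.nat 1)
  have hl := lap_continuous h.sm (hf.nat 2)
  -- base integrals
  set A := ∫ x, Vf u c x * (Q2 (rho u x / R^2) * gIn u f (rho u) x) with hA
  have iA : Integrable (fun x => Vf u c x * (Q2 (rho u x / R^2) * gIn u f (rho u) x)) :=
    integrable_ball (R := R) (by fun_prop) fun x hx => by rw [Q2_zero (rho_out hR hx)]; ring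
  have iB : Integrable (fun x => Q1 (rho u x / R^2) * (f x * Vf u c x * rho u x)) :=
    integrable_ball (R := R) (by fun_prop) fun x hx => by rw [Q1_zero (rho_out hR hx)]; ring
  have iC : Integrable (fun x => Q1 (rho u x / R^2) * (f x * Vf u c x * Xp u x)) :=
    integrable_ball (R := R) (by fun_prop) fun x hx => by rw [Q1_zero (rho_out hR hx)]; ring
  have iBC : Integrable (fun x => (4/R^2) * (Q1 (rho u x / R^2) * (f x * Vf u c x * rho u x)) -
      (4/R^2) * (Q1 (rho u x / R^2) * (f x * Vf u c x * Xp u x))) := (iB.const_mul _).sub (iC.const_mul _)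
  have E1 : ∫ x, f x * Q2 (rho u x / R^2) * (Vf u c x * (2 * n)) = 2 * n * Jf u c f R := by
    unfold Jf; rw [← integral_const_mul]; congr 1; funext x; ring
  have E2 : ∫ x, Vf u c x * (Q2 (rho u x / R^2) * gIn u f (rho u) x
      - f x * Q1 (rho u x / R^2) * ((4/R^2) * (rho u x - Xp u x))) = A -
      ((4/R^2) * (∫ x, Q1 (rho u x / R^2) * (f x * Vf u c x * rho u x)) - (4/R^2) * ∫ x, Q1 (rho u x / R^2) * (f x * Vf u c x * Xp u x)) := by
    rw [← integral_const_mul, ← integral_const_mul, ← integral_sub (iB.const_mul _) (iC.const_mul _), hA,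
      ← integral_sub iA iBC]
    congr 1; funext x; ring
  have E3 : ∫ x, Vf u c x * (- Q2 (rho u x / R^2) * ((1/R^2) * gIn u f (rho u) x)) = - (1/R^2) * A := by
    rw [hA, ← integral_const_mul]; congr 1; funext x; ring
  rw [E1, E2] at I1
  rw [E3] at I2
  unfold Df
  rw [I2]
  have I1' : n * Jf u c f R = - A / 2 + (2/R^2) * (∫ x, Q1 (rho u x / R^2) * (f x * Vf u c x * rho u x)) -
     (2/R^2) * ∫ x, Q1 (rho u x / R^2) * (f x * Vf u c x * Xp u x) := by linear_combination I1 / 2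
  have e0 : n / R * Jf u c f R = (n * Jf u c f R) / R := by ring
  rw [e0, I1']
  field_simp; ring

noncomputable def If {n : ℕ} (u : Eu n → ℝ) (c : ℝ) (f : Eu n → ℝ) (R : ℝ) : ℝ := Jf u c f R / R^n

lemma If_hasDeriv (h : Good u c K) (hf : ContDiff ℝ ∞ f) {R : ℝ} (hR : 0 < R) :
    HasDerivAt (If u c f) (Df u c f R / R^n) R := by
  have h1 := Jf_hasDeriv h hf hR
  rw [Jf_identity h hf hR] at h1
  refine (h1.fun_div (hasDerivAt_pow n R) (by positivity)).congr_deriv ?_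
  have hR' : R^n ≠ 0 := by positivity
  rcases n with _ | m
  · simp
  · field_simp; simp; ring

end
end SLag

namespace SLag
open scoped ContDiff Topology
open MeasureTheory

noncomputable def uR {n : ℕ} (u : Eu n → ℝ) (R : ℝ) (y : Eu n) : ℝ := (R^2)⁻¹ * u (R • y)

section
variable {n : ℕ} {u f : Eu n → ℝ} {x : Eu n} {c K : ℝ}

lemma pd_scale (f : Eu n → ℝ) (R : ℝ) (v y : Eu n) : pd v (fun y => f (R • y)) y = R * pd v f (R • y) := by
  unfold pd
  rw [fderiv_comp_smul]; simp

lemma pd_scale' (f : Eu n → ℝ) (hf : ContDiff ℝ ∞ f) (a R : ℝ) (v y : Eu n) : pd v (fun y => a * f (R • y)) y = a * R * pd v f (R • y) := by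
  rw [pd_const_mul, pd_scale]; · ring
  · exact cd_diff (hf.comp (contDiff_const_smul R)) y

lemma uR_contDiff (hu : ContDiff ℝ ∞ u) (R : ℝ) : ContDiff ℝ ∞ (uR u R) :=
  contDiff_const.mul (hu.comp (contDiff_const_smul R))

lemma pd_uR (hu : ContDiff ℝ ∞ u) {R : ℝ} (hR : 0 < R) (v : Eu n) : pd v (uR u R) = fun y => R⁻¹ * pd v u (R • y) := by
  funext y
  unfold uR
  rw [pd_scale' u hu]; congr 1; field_simp

lemma Hm_uR (hu : ContDiff ℝ ∞ u) {R : ℝ} (hR : 0 < R) (e : OrthonormalBasis (Fin n) ℝ (Eu n)) (y : Eu n) :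
    Hm (uR u R) e y = Hm u e (R • y) := by
  ext a b
  simp only [Hm, Matrix.of_apply]
  rw [pd_uR hu hR, pd_scale' _ (pd_contDiff hu _)]
  field_simp

lemma Vf_uR (hu : ContDiff ℝ ∞ u) {R : ℝ} (hR : 0 < R) (y : Eu n) : Vf (uR u R) c y = Vf u c (R • y) := by
  unfold Vf; rw [Hm_uR hu hR]

lemma Good.scale (h : Good u c K) {R : ℝ} (hR : 0 < R) : Good (uR u R) c K where
  sm := uR_contDiff h.sm R
  sl := by
    intro y; rw [Vf_uR h.sm hR, Hm_uR h.sm hR]; exact h.sl _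
  eh := by
    intro y; obtain ⟨e, l, h1⟩ := h.eh (R • y)
    exact ⟨e, l, by rw [Hm_uR h.sm hR]; exact h1⟩

lemma rho_uR (hu : ContDiff ℝ ∞ u) {R : ℝ} (hR : 0 < R) (y : Eu n) : rho (uR u R) y = rho u (R • y) / R^2 := by
  unfold rho qf
  simp only [pd_uR hu hR, smul_zero]
  rw [add_div, Finset.sum_div, Finset.sum_div]
  congr 1
  · refine Finset.sum_congr rfl fun i _ => ?_
    simp only [PiLp.smul_apply, smul_eq_mul]; field_simp
  · refine Finset.sum_congr rfl fun i _ => ?_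
    field_simp

lemma mpd_uR (hu : ContDiff ℝ ∞ u) {R : ℝ} (hR : 0 < R) (v : Eu n) (y : Eu n) :
    mpd v (Hm (uR u R) (sB n)) y = R • mpd v (Hm u (sB n)) (R • y) := by
  ext a b
  simp only [mpd, Matrix.of_apply, Matrix.smul_apply, Hm_uR hu hR]
  exact pd_scale (fun y => Hm u (sB n) y a b) R v y

lemma gsq_tau_uR (hu : ContDiff ℝ ∞ u) {R : ℝ} (hR : 0 < R) (y : Eu n) :
    gsq (tau1 (uR u R)) y = R^2 * gsq (tau1 u) (R • y) ∧ gsq (tau2 (uR u R)) y = R^2 * gsq (tau2 u) (R • y) := by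
  have e1 : tau1 (uR u R) = fun y => tau1 u (R • y) := by funext y; unfold tau1; rw [Hm_uR hu hR]
  have e2 : tau2 (uR u R) = fun y => tau2 u (R • y) := by funext y; unfold tau2; rw [Hm_uR hu hR]
  unfold gsq
  rw [e1, e2]
  simp only [pd_scale, mul_pow, Finset.mul_sum, and_self]

lemma lap_uR (hu : ContDiff ℝ ∞ u) {R : ℝ} (hR : 0 < R) (hf : ContDiff ℝ ∞ f) (y : Eu n) :
    lap (uR u R) (sB n) (fun y => f (R • y)) y = R^2 * lap u (sB n) f (R • y) := by
  unfold lap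
  have e1 : Gm (uR u R) (sB n) y = Gm u (sB n) (R • y) := by unfold Gm; rw [Hm_uR hu hR]
  have e2 : Hm (fun y => f (R • y)) (sB n) y = R^2 • Hm f (sB n) (R • y) := by
    ext a b
    simp only [Hm, Matrix.of_apply, Matrix.smul_apply, smul_eq_mul]
    have : pd (sB n b) (fun y => f (R • y)) = fun y => R * pd (sB n b) f (R • y) := funext fun y => pd_scale f R _ y
    rw [this, pd_scale' _ (pd_contDiff hf _)]; ring
  rw [e1, e2, Matrix.mul_smul, Matrix.trace_smul, smul_eq_mul]

lemma int_scale (F : Eu n → ℝ) {R : ℝ} (hR : 0 < R) : ∫ x, F x = R^n * ∫ y, F (R • y) := by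
  rw [Measure.integral_comp_smul]
  simp only [finrank_euclideanSpace, Fintype.card_fin, smul_eq_mul]
  rw [abs_of_pos (by positivity)]
  field_simp

lemma uR_uR {R s : ℝ} : uR (uR u R) s = uR u (R * s) := by
  funext y; unfold uR; rw [smul_smul, mul_pow, mul_inv]; ring

lemma If_one (h : Good u c K) {R : ℝ} (hR : 0 < R) :
    If u c (fun _ => 1) R = ∫ y, Q2 (rho (uR u R) y) * Vf (uR u R) c y := by
  unfold If Jf
  rw [int_scale _ hR, mul_div_cancel_left₀ _ (by positivity)]
  congr 1; funext y; rw [rho_uR h.sm hR, Vf_uR h.sm hR]; ring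

lemma If_V (h : Good u c K) {R : ℝ} (hR : 0 < R) :
    If u c (Vf u c) R = ∫ y, Q2 (rho (uR u R) y) * (Vf (uR u R) c y * Vf (uR u R) c y) := by
  unfold If Jf
  rw [int_scale _ hR, mul_div_cancel_left₀ _ (by positivity)]
  congr 1; funext y; rw [rho_uR h.sm hR, Vf_uR h.sm hR]

lemma F_scale (h : Good u c K) {R : ℝ} (hR : 0 < R) :
    ∫ x, Q3 (rho u x / R^2) * (Vf u c x * lap u (sB n) (Vf u c) x) =
    R^n / R^2 * ∫ y, Q3 (rho (uR u R) y) * (Vf (uR u R) c y * lap (uR u R) (sB n) (Vf (uR u R) c) y) := by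
  rw [int_scale _ hR, div_mul_eq_mul_div, mul_div_assoc, ← integral_div]
  congr 2; funext y
  have e : Vf (uR u R) c = fun y => Vf u c (R • y) := funext fun y => Vf_uR h.sm hR y
  rw [rho_uR h.sm hR, e, lap_uR h.sm hR (contDiff_Vf h.sm c)]
  field_simp

-- bounds
lemma H_bound (h : Good u c K) (hK : 0 ≤ K) (x : Eu n) (i j : Fin n) : |Hm u (sB n) x i j| ≤ K := by
  obtain ⟨e, l, hd, hl, -⟩ := h.eh x
  have e1 : Hm u (sB n) x = Um e * Matrix.diagonal l * (Um e).transpose := by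
    rw [← hd, Hm_change (e := e) h.sm]
    change _ = Um e * ((Um e).transpose * Hm u (sB n) x * Um e) * (Um e).transpose
    calc _ = (Um e * (Um e).transpose) * Hm u (sB n) x * (Um e * (Um e).transpose) := by rw [Um_orth']; simp
      _ = _ := by simp only [mul_assoc]
  have o : ∀ i, ∑ a, Um e i a ^2 = 1 := by
    intro i
    have := congrFun (congrFun (Um_orth' e) i) i
    simp only [Matrix.mul_apply, Matrix.transpose_apply, Matrix.one_apply_eq] at this
    rw [← this]; exact Finset.sum_congr rfl fun a _ => by ring
  rw [e1]
  rw [Matrix.mul_apply]; simp only [Matrix.mul_diagonal, Matrix.transpose_apply]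
  calc |∑ a, Um e i a * l a * Um e j a| ≤ ∑ a, |Um e i a * l a * Um e j a| := Finset.abs_sum_le_sum_abs _ _
    _ ≤ ∑ a, K / 2 * (Um e i a^2 + Um e j a^2) := by
      refine Finset.sum_le_sum fun a _ => ?_
      rw [abs_mul, abs_mul]
      have h2 : |Um e i a| * |Um e j a| ≤ (Um e i a^2 + Um e j a^2) / 2 := by
        nlinarith [sq_nonneg (|Um e i a| - |Um e j a|), sq_abs (Um e i a), sq_abs (Um e j a)]
      have h3 : 0 ≤ |Um e i a| * |Um e j a| := by positivity
      calc |Um e i a| * |l a| * |Um e j a| = |l a| * (|Um e i a| * |Um e j a|) := by ring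
        _ ≤ K * ((Um e i a^2 + Um e j a^2) / 2) := mul_le_mul (hl a) h2 h3 hK
        _ = _ := by ring
    _ = K := by rw [← Finset.mul_sum, Finset.sum_add_distrib, o, o]; ring

lemma fderiv_norm_le (f : Eu n → ℝ) (x : Eu n) : ‖fderiv ℝ f x‖ ≤ ∑ j, |pd (sb j) f x| := by
  refine ContinuousLinearMap.opNorm_le_bound _ (Finset.sum_nonneg fun _ _ => abs_nonneg _) fun v => ?_
  have hv : v = ∑ i, v i • (sb i : Eu n) := by
    have := (EuclideanSpace.basisFun (Fin n) ℝ).sum_repr v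
    simpa using this.symm
  have : fderiv ℝ f x v = ∑ i, v i * pd (sb i) f x := pd_lin v _ _ _ hv f x
  rw [this, Real.norm_eq_abs, Finset.sum_mul]
  refine (Finset.abs_sum_le_sum_abs _ _).trans (Finset.sum_le_sum fun i _ => ?_)
  rw [abs_mul, mul_comm]
  exact mul_le_mul_of_nonneg_left (by simpa using PiLp.norm_apply_le v i) (abs_nonneg _)

lemma lip_of_pd {f : Eu n → ℝ} (hf : ContDiff ℝ ∞ f) {C : ℝ} {s : Set (Eu n)} (hs : Convex ℝ s) (hC : ∀ x ∈ s, ∑ j, |pd (sb j) f x| ≤ C) {x y : Eu n} (hx : x ∈ s) (hy : y ∈ s) :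
    |f y - f x| ≤ C * ‖y - x‖ :=
  Convex.norm_image_sub_le_of_norm_fderiv_le (𝕜 := ℝ) (fun z _ => cd_diff hf z) (fun z hz => (fderiv_norm_le f z).trans (hC z hz)) hs hx hy

lemma qf_lip (h : Good u c K) (hK : 0 ≤ K) (i : Fin n) (x y : Eu n) : |qf u i y - qf u i x| ≤ n * K * ‖y - x‖ := by
  refine lip_of_pd (qf_contDiff h.sm i) convex_univ (fun z _ => ?_) (Set.mem_univ _) (Set.mem_univ _)
  calc _ ≤ ∑ _j : Fin n, K := by
        refine Finset.sum_le_sum fun j _ => ?_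
        rw [pd_qf h.sm]
        simpa [Hm] using H_bound h hK z j i
    _ = n * K := by simp

lemma qf_zero (i : Fin n) : qf u i 0 = 0 := by simp [qf]

noncomputable def Cr (n : ℕ) (K : ℝ) : ℝ := 1 + n * (n * K)^2

lemma rho_le (h : Good u c K) (hK : 0 ≤ K) (x : Eu n) : rho u x ≤ Cr n K * ‖x‖^2 := by
  unfold rho Cr
  rw [add_mul, one_mul, EuclideanSpace.norm_sq_eq]
  simp only [Real.norm_eq_abs, sq_abs]
  refine add_le_add le_rfl ?_
  calc _ ≤ ∑ _i : Fin n, (n * K)^2 * ‖x‖^2 := by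
        refine Finset.sum_le_sum fun i _ => ?_
        have := qf_lip h hK i 0 x
        rw [qf_zero, sub_zero, sub_zero] at this
        rw [← mul_pow]
        exact sq_le_sq' (by linarith [neg_abs_le (qf u i x)]) (by linarith [le_abs_self (qf u i x)])
    _ = _ := by
      simp only [Finset.sum_const, Finset.card_univ, Fintype.card_fin, nsmul_eq_mul]
      rw [EuclideanSpace.norm_sq_eq]; simp only [Real.norm_eq_abs, sq_abs]; ring

lemma Cr_ge (n : ℕ) (K : ℝ) : 1 ≤ Cr n K := by unfold Cr; have : 0 ≤ n * (n * K)^2 := by positivity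
                                               linarith
noncomputable def r0 (n : ℕ) (K : ℝ) : ℝ := 1 / (2 * Cr n K)

lemma r0_pos (n : ℕ) (K : ℝ) : 0 < r0 n K := by unfold r0; have := Cr_ge n K; positivity

lemma gsq_nonneg (f : Eu n → ℝ) (x : Eu n) : 0 ≤ gsq f x := Finset.sum_nonneg fun _ _ => sq_nonneg _

lemma lapV_nonneg (h : Good u c K) (x : Eu n) : 0 ≤ lap u (sB n) (Vf u c) x := by
  have h1 := lapV_ge h.sm h.sl h.eh x
  have h2 : 0 ≤ Vf u c x * (gsq (tau1 u) x + gsq (tau2 u) x) :=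
    mul_nonneg (h.sl x).1.le (add_nonneg (gsq_nonneg _ _) (gsq_nonneg _ _))
  have h3 : 0 < Dc n K * (1 + K^2) := mul_pos (Dc_pos ..) (by positivity)
  by_contra hc
  push Not at hc
  nlinarith [mul_pos h3 (neg_pos.2 hc)]

lemma gsq_continuous {f : Eu n → ℝ} (hf : ContDiff ℝ ∞ f) : Continuous (gsq f) := by
  unfold gsq
  have := fun i => (pd_contDiff hf (sb i)).continuous
  fun_prop

lemma tau1_contDiff (hu : ContDiff ℝ ∞ u) : ContDiff ℝ ∞ (tau1 u) := by
  unfold tau1 Matrix.trace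
  exact ContDiff.sum fun i _ => Hm_contDiff hu _ i i

lemma tau2_contDiff (hu : ContDiff ℝ ∞ u) : ContDiff ℝ ∞ (tau2 u) := by
  have : tau2 u = fun x => ∑ i, ∑ j, Hm u (sB n) x i j * Hm u (sB n) x j i := by
    funext x; unfold tau2; rw [trace_mul']
  rw [this]
  exact ContDiff.sum fun i _ => ContDiff.sum fun j _ => (Hm_contDiff hu _ i j).mul (Hm_contDiff hu _ j i)

noncomputable def gt {n : ℕ} (u : Eu n → ℝ) (x : Eu n) : ℝ := gsq (tau1 u) x + gsq (tau2 u) x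

lemma gt_nonneg (x : Eu n) : 0 ≤ gt u x := add_nonneg (gsq_nonneg _ _) (gsq_nonneg _ _)

lemma gt_continuous (hu : ContDiff ℝ ∞ u) : Continuous (gt u) :=
  (gsq_continuous (tau1_contDiff hu)).add (gsq_continuous (tau2_contDiff hu))

noncomputable def F1 {n : ℕ} (u : Eu n → ℝ) (c : ℝ) : ℝ := ∫ y, Q3 (rho u y) * (Vf u c y * lap u (sB n) (Vf u c) y)

lemma F1_ge (h : Good u c K) (hK : 0 ≤ K) :
    ∫ x in Metric.closedBall (0 : Eu n) (r0 n K), gt u x ≤ 8 * (Dc n K * (1 + K^2)) * F1 u c := by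
  have hVc := contDiff_Vf h.sm c
  have hl := lap_continuous h.sm (hVc.nat 2)
  have hr := (rho_contDiff h.sm).continuous
  have hV := hVc.continuous
  have hq := Q3_cont
  have hg := gt_continuous h.sm
  unfold F1
  rw [← integral_const_mul, ← integral_indicator measurableSet_closedBall]
  have hD : 0 < Dc n K * (1 + K^2) := mul_pos (Dc_pos ..) (by positivity)
  refine integral_mono ?_ ?_ ?_
  · exact IntegrableOn.integrable_indicator (hg.continuousOn.integrableOn_compact (isCompact_closedBall _ _)) measurableSet_closedBall
  · refine Integrable.const_mul (integrable_ball (R := 1) (by fun_prop) fun x hx => ?_) _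
    have := rho_out (u := u) one_pos hx
    rw [Q3_zero (by simpa using this), zero_mul]
  · intro x
    have hV1 := V_ge_one h x
    have hl0 := lapV_nonneg h x
    have hrhs : 0 ≤ Q3 (rho u x) * (Vf u c x * lap u (sB n) (Vf u c) x) :=
      mul_nonneg (Q3_nonneg _) (mul_nonneg (by linarith) hl0)
    by_cases hx : x ∈ Metric.closedBall (0 : Eu n) (r0 n K)
    · rw [Set.indicator_of_mem hx]
      rw [mem_closedBall_zero_iff] at hx
      have hC := Cr_ge n K
      have h1 : rho u x ≤ 1/4 := by
        refine (rho_le h hK x).trans ?_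
        calc Cr n K * ‖x‖^2 ≤ Cr n K * (r0 n K)^2 := by gcongr
          _ = 1 / (4 * Cr n K) := by unfold r0; field_simp; ring
          _ ≤ 1/4 := by rw [div_le_div_iff₀ (by positivity) (by norm_num)]; linarith
      have h2 : 1/8 ≤ Q3 (rho u x) := by
        unfold Q3; rw [max_eq_left (by linarith)]
        calc (1:ℝ)/8 ≤ (1/2)^3 := by norm_num
          _ ≤ _ := by gcongr; linarith
      have h3 := lapV_ge h.sm h.sl h.eh x
      have h4 : gt u x ≤ Vf u c x * gt u x := le_mul_of_one_le_left (gt_nonneg x) hV1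
      have h5 : Vf u c x * gt u x ≤ Dc n K * (1 + K^2) * lap u (sB n) (Vf u c) x := h3
      have h6 : lap u (sB n) (Vf u c) x ≤ Vf u c x * lap u (sB n) (Vf u c) x := le_mul_of_one_le_left hl0 hV1
      have h7 : 1/8 * (Vf u c x * lap u (sB n) (Vf u c) x) ≤ Q3 (rho u x) * (Vf u c x * lap u (sB n) (Vf u c) x) :=
        mul_le_mul_of_nonneg_right h2 (by linarith)
      have h8 : lap u (sB n) (Vf u c) x ≤ 8 * (Q3 (rho u x) * (Vf u c x * lap u (sB n) (Vf u c) x)) := by linarith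
      have h9 := mul_le_mul_of_nonneg_left h8 hD.le
      dsimp only
      linarith
    · rw [Set.indicator_of_notMem hx]
      dsimp only
      have : 0 ≤ 8 * (Dc n K * (1 + K^2)) := by linarith
      exact mul_nonneg this hrhs

end
end SLag

namespace SLag
open scoped ContDiff Topology
open MeasureTheory

section
variable {n : ℕ} {u f : Eu n → ℝ} {x : Eu n} {c K : ℝ}

lemma rho_out1 (hx : 1 ≤ ‖x‖) : 1 ≤ rho u x := by simpa using rho_out (u := u) one_pos hx

lemma IfV_bound (h : Good u c K) {R : ℝ} (hR : 0 < R) :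
    If u c (Vf u c) R ≤ (volume : Measure (Eu n)).real (Metric.closedBall 0 1) * (3 * ((1+K)^n * (1+K)^n)) := by
  rw [If_V h hR]
  have h' := h.scale hR
  set w := uR u R
  have hV := (contDiff_Vf h'.sm c).continuous
  have hr := (rho_contDiff h'.sm).continuous
  have hq := Q2_cont
  rw [← smul_eq_mul, ← integral_indicator_const _ measurableSet_closedBall]
  refine integral_mono ?_ ?_ ?_
  · refine integrable_ball (R := 1) (by fun_prop) fun x hx => ?_
    rw [Q2_zero (rho_out1 hx), zero_mul]
  · exact IntegrableOn.integrable_indicator (continuousOn_const.integrableOn_compact (isCompact_closedBall _ _)) measurableSet_closedBall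
  · intro x
    have h1 := V_ge_one h' x
    have h2 := V_le h' x
    have h3 := Q2_le (rho_nonneg (u := w) x)
    have h4 := Q2_nonneg (rho w x)
    by_cases hx : x ∈ Metric.closedBall (0 : Eu n) 1
    · rw [Set.indicator_of_mem hx]; dsimp only
      gcongr
      linarith
    · rw [Set.indicator_of_notMem hx]; dsimp only
      simp at hx
      rw [Q2_zero (rho_out1 hx.le), zero_mul]

lemma Df_V_ge (h : Good u c K) {R : ℝ} (hR : 0 < R) : F1 (uR u R) c / (2 * R) ≤ Df u c (Vf u c) R / R^n := by
  unfold Df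
  rw [F_scale h hR]
  change _ ≤ (_ + R / 2 * (R^n / R^2 * F1 (uR u R) c)) / R^n
  have : 0 ≤ ∫ x, Q1 (rho u x / R^2) * (Vf u c x * Vf u c x * Xp u x) := by
    refine integral_nonneg fun x => mul_nonneg (Q1_nonneg _) (mul_nonneg ?_ (Xp_nonneg h.sm x))
    exact mul_self_nonneg _
  have e : R / 2 * (R^n / R^2 * F1 (uR u R) c) / R^n = F1 (uR u R) c / (2 * R) := by field_simp
  rw [add_div, e]
  have : 0 ≤ (2 / R^3) * (∫ x, Q1 (rho u x / R^2) * (Vf u c x * Vf u c x * Xp u x)) / R^n := by positivity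
  linarith

lemma small_F1 (h : Good u c K) {δ : ℝ} (hδ : 0 < δ) (R0 : ℝ) : ∃ R, R0 ≤ R ∧ 0 < R ∧ F1 (uR u R) c ≤ δ := by
  by_contra hcon
  push Not at hcon
  set S := max R0 1 with hS
  have hS0 : 0 < S := lt_of_lt_of_le one_pos (le_max_right _ _)
  set g := fun R => If u c (Vf u c) R - (δ/2) * Real.log R with hg
  have hd : ∀ R, 0 < R → HasDerivAt g (Df u c (Vf u c) R / R^n - (δ/2) * R⁻¹) R := fun R hR =>
    (If_hasDeriv h (contDiff_Vf h.sm c) hR).sub ((Real.hasDerivAt_log hR.ne').const_mul _)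
  have hm : MonotoneOn g (Set.Ici S) := by
    refine monotoneOn_of_deriv_nonneg (convex_Ici _) ?_ ?_ ?_
    · intro R hR
      exact (hd R (lt_of_lt_of_le hS0 hR)).continuousAt.continuousWithinAt
    · intro R hR
      rw [interior_Ici] at hR
      exact (hd R (hS0.trans hR)).differentiableAt.differentiableWithinAt
    · intro R hR
      rw [interior_Ici] at hR
      have hR0 : 0 < R := hS0.trans hR
      rw [(hd R hR0).deriv]
      have h1 := Df_V_ge h hR0
      have h2 := hcon R ((le_max_left _ _).trans hR.le) hR0
      have h3 : δ / 2 * R⁻¹ ≤ F1 (uR u R) c / (2 * R) := by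
        rw [show δ / 2 * R⁻¹ = δ / (2 * R) by field_simp]
        gcongr
      linarith
  set B := (volume : Measure (Eu n)).real (Metric.closedBall 0 1) * (3 * ((1+K)^n * (1+K)^n)) with hB
  have ht : Filter.Tendsto (fun R => g S + (δ/2) * Real.log R) Filter.atTop Filter.atTop :=
    Filter.tendsto_atTop_add_const_left _ _ (Real.tendsto_log_atTop.const_mul_atTop (by positivity))
  obtain ⟨R, hR1, hR2⟩ := ((ht.eventually_gt_atTop B).and (Filter.eventually_ge_atTop S)).exists
  have h1 := hm (Set.mem_Ici.2 le_rfl) (Set.mem_Ici.2 hR2) hR2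
  have h2 := IfV_bound h (lt_of_lt_of_le hS0 hR2)
  have h3 : g R = If u c (Vf u c) R - (δ/2) * Real.log R := rfl
  linarith

lemma int_ball_scale (F : Eu n → ℝ) {R : ℝ} (hR : 0 < R) (s : ℝ) :
    ∫ x in Metric.closedBall (0 : Eu n) (R * s), F x = R^n * ∫ y in Metric.closedBall (0 : Eu n) s, F (R • y) := by
  rw [← integral_indicator measurableSet_closedBall, ← integral_indicator measurableSet_closedBall, int_scale _ hR]
  congr 2; funext y
  have : (R • y ∈ Metric.closedBall (0 : Eu n) (R * s)) ↔ y ∈ Metric.closedBall (0 : Eu n) s := by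
    simp only [mem_closedBall_zero_iff, norm_smul, Real.norm_eq_abs, abs_of_pos hR]
    exact mul_le_mul_iff_right₀ hR
  by_cases hy : y ∈ Metric.closedBall (0 : Eu n) s
  · rw [Set.indicator_of_mem hy, Set.indicator_of_mem (this.2 hy)]
  · rw [Set.indicator_of_notMem hy, Set.indicator_of_notMem (fun h => hy (this.1 h))]

lemma lemma_N (h : Good u c K) (hK : 0 ≤ K) {δ : ℝ} (hδ : 0 < δ) (R0 : ℝ) :
    ∃ R, R0 ≤ R ∧ 0 < R ∧ ∫ x in Metric.closedBall (0 : Eu n) 2, gt (uR u R) x ≤ δ := by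
  set s := r0 n K / 2 with hs
  have hs0 : 0 < s := by have := r0_pos n K; positivity
  set D := 8 * (Dc n K * (1 + K^2)) with hD
  have hD0 : 0 < D := by have := mul_pos (Dc_pos n K) (show 0 < 1 + K^2 by positivity); positivity
  obtain ⟨R, h1, h2, h3⟩ := small_F1 h (δ := δ * s^n / (s^2 * D)) (by positivity) (R0 / s)
  refine ⟨R * s, by rwa [div_le_iff₀ hs0] at h1, by positivity, ?_⟩
  have hg := h.scale h2
  have h4 := F1_ge hg hK
  have e1 : ∀ y, gt (uR u (R * s)) y = s^2 * gt (uR u R) (s • y) := by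
    intro y
    rw [← uR_uR]
    unfold gt
    rw [(gsq_tau_uR hg.sm hs0 y).1, (gsq_tau_uR hg.sm hs0 y).2]; ring
  have e2 := int_ball_scale (gt (uR u R)) hs0 2
  rw [show s * 2 = r0 n K by rw [hs]; ring] at e2
  rw [e2] at h4
  simp only [e1]
  rw [integral_const_mul]
  have h5 : s^n * (∫ y in Metric.closedBall (0 : Eu n) 2, gt (uR u R) (s • y)) ≤ D * (δ * s^n / (s^2 * D)) :=
    h4.trans (by gcongr)
  have h6 : D * (δ * s^n / (s^2 * D)) = s^n * (δ / s^2) := by field_simp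
  rw [h6] at h5
  have h7 := le_of_mul_le_mul_left h5 (by positivity)
  rw [le_div_iff₀ (by positivity)] at h7
  linarith

end
end SLag

namespace SLag
open scoped ContDiff Topology
open MeasureTheory

noncomputable def Tsq {n : ℕ} (u : Eu n → ℝ) (x : Eu n) : ℝ :=
  ∑ k, ∑ a, ∑ b, (pd (sb k) (fun y => Hm u (sB n) y a b) x)^2

noncomputable def Wv {n : ℕ} (u : Eu n → ℝ) (a : Fin n) (x : Eu n) : ℝ :=
  (∑ b, Hm u (sB n) x a b * pd (sb b) (tau1 u) x) - (1/2) * pd (sb a) (tau2 u) x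

section
variable {n : ℕ} {u f : Eu n → ℝ} {x : Eu n} {c K : ℝ}

lemma H_sw (hu : ContDiff ℝ ∞ u) (k a b : Fin n) (x : Eu n) :
    pd (sb k) (fun y => Hm u (sB n) y a b) x = pd (sb a) (fun y => Hm u (sB n) y k b) x := by
  have h1 : (fun y => Hm u (sB n) y a b) = pd (sb a) (pd (sb b) u) := by funext y; simp [Hm]
  have h2 : (fun y => Hm u (sB n) y k b) = pd (sb k) (pd (sb b) u) := by funext y; simp [Hm]
  rw [h1, h2, pd_comm ((pd_contDiff hu _).nat 2)]

lemma pd_tau1 (hu : ContDiff ℝ ∞ u) (b : Fin n) :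
    pd (sb b) (tau1 u) = fun x => ∑ a, pd (sb a) (fun y => Hm u (sB n) y a b) x := by
  funext x
  unfold tau1 Matrix.trace
  simp only [Matrix.diag_apply]
  rw [pd_sum (fun i _ => cd_diff (Hm_contDiff hu _ i i) x)]
  refine Finset.sum_congr rfl fun a _ => ?_
  rw [H_sw hu]
  congr 1; funext y; exact Hm_symm hu _ y b a

lemma pd_tau2 (hu : ContDiff ℝ ∞ u) (a : Fin n) :
    pd (sb a) (tau2 u) = fun x => 2 * ∑ b, ∑ k, Hm u (sB n) x b k * pd (sb a) (fun y => Hm u (sB n) y b k) x := by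
  funext x
  have e : tau2 u = fun x => ∑ i, ∑ j, Hm u (sB n) x i j * Hm u (sB n) x i j := by
    funext x; unfold tau2; rw [trace_mul']
    refine Finset.sum_congr rfl fun i _ => Finset.sum_congr rfl fun j _ => ?_
    rw [Hm_symm hu _ x j i]
  have d := fun i j => cd_diff (Hm_contDiff hu (sB n) i j) x
  rw [e, pd_sum (fun i _ => DifferentiableAt.fun_sum fun j _ => (d i j).fun_mul (d i j)), Finset.mul_sum]
  refine Finset.sum_congr rfl fun i _ => ?_
  rw [pd_sum (fun j _ => (d i j).fun_mul (d i j)), Finset.mul_sum]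
  refine Finset.sum_congr rfl fun j _ => ?_
  rw [pd_mul (d i j) (d i j)]; ring

lemma Wv_eq (hu : ContDiff ℝ ∞ u) (a : Fin n) : Wv u a = fun x =>
    (∑ b, Hm u (sB n) x a b * pd (sb b) (tau1 u) x) - ∑ b, ∑ k, Hm u (sB n) x b k * pd (sb a) (fun y => Hm u (sB n) y b k) x := by
  funext x; unfold Wv; rw [pd_tau2 hu]; ring

lemma Wv_contDiff (hu : ContDiff ℝ ∞ u) (a : Fin n) : ContDiff ℝ ∞ (Wv u a) := by
  unfold Wv
  exact (ContDiff.sum fun b _ => (Hm_contDiff hu _ a b).mul (pd_contDiff (tau1_contDiff hu) _)).sub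
    (contDiff_const.mul (pd_contDiff (tau2_contDiff hu) _))

lemma div_W (hu : ContDiff ℝ ∞ u) (x : Eu n) : ∑ a, pd (sb a) (Wv u a) x = gsq (tau1 u) x - Tsq u x := by
  have d := fun i j => cd_diff (Hm_contDiff hu (sB n) i j) x
  have dt := fun b => cd_diff (pd_contDiff (tau1_contDiff hu) (sb b)) x
  have dd := fun a i j => cd_diff (pd_contDiff (Hm_contDiff hu (sB n) i j) (sb a)) x
  have e1 : ∀ a, pd (sb a) (Wv u a) x =
      (∑ b, (pd (sb a) (fun y => Hm u (sB n) y a b) x * pd (sb b) (tau1 u) x + Hm u (sB n) x a b * pd (sb a) (pd (sb b) (tau1 u)) x))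
      - ∑ b, ∑ k, ((pd (sb a) (fun y => Hm u (sB n) y b k) x)^2 + Hm u (sB n) x b k * pd (sb a) (pd (sb a) (fun y => Hm u (sB n) y b k)) x) := by
    intro a
    rw [Wv_eq hu, pd_sub (DifferentiableAt.fun_sum fun b _ => (d a b).fun_mul (dt b))
      (DifferentiableAt.fun_sum fun b _ => DifferentiableAt.fun_sum fun k _ => (d b k).fun_mul (dd a b k)),
      pd_sum (fun b _ => (d a b).fun_mul (dt b)), pd_sum (fun b _ => DifferentiableAt.fun_sum fun k _ => (d b k).fun_mul (dd a b k))]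
    congr 1
    · exact Finset.sum_congr rfl fun b _ => pd_mul (d a b) (dt b)
    · refine Finset.sum_congr rfl fun b _ => ?_
      rw [pd_sum (fun k _ => (d b k).fun_mul (dd a b k))]
      refine Finset.sum_congr rfl fun k _ => ?_
      rw [pd_mul (d b k) (dd a b k)]; ring
  have e2 : ∀ b k, ∑ a, pd (sb a) (pd (sb a) (fun y => Hm u (sB n) y b k)) x = pd (sb b) (pd (sb k) (tau1 u)) x := by
    intro b k
    rw [pd_tau1 hu k, pd_sum (fun a _ => dd a a k)]
    refine Finset.sum_congr rfl fun a _ => ?_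
    have : pd (sb a) (fun y => Hm u (sB n) y b k) = pd (sb b) (fun y => Hm u (sB n) y a k) := funext fun y => H_sw hu a b k y
    rw [this, pd_comm ((Hm_contDiff hu _ a k).nat 2)]
  simp only [e1, Finset.sum_sub_distrib, Finset.sum_add_distrib]
  have e3 : ∑ a, ∑ b, pd (sb a) (fun y => Hm u (sB n) y a b) x * pd (sb b) (tau1 u) x = gsq (tau1 u) x := by
    rw [Finset.sum_comm]; unfold gsq
    refine Finset.sum_congr rfl fun b _ => ?_
    rw [← Finset.sum_mul, sq]; congr 1
    rw [pd_tau1 hu]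
  have e4 : ∑ a, ∑ b, ∑ k, Hm u (sB n) x b k * pd (sb a) (pd (sb a) (fun y => Hm u (sB n) y b k)) x =
      ∑ a, ∑ b, Hm u (sB n) x a b * pd (sb a) (pd (sb b) (tau1 u)) x := by
    rw [Finset.sum_comm]
    refine Finset.sum_congr rfl fun b _ => ?_
    rw [Finset.sum_comm]
    refine Finset.sum_congr rfl fun k _ => ?_
    rw [← Finset.mul_sum, e2]
  rw [e3, e4]; unfold Tsq; ring

lemma Tsq_continuous (hu : ContDiff ℝ ∞ u) : Continuous (Tsq u) := by
  unfold Tsq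
  have := fun k a b => (pd_contDiff (Hm_contDiff hu (sB n) a b) (sb k)).continuous
  fun_prop

lemma Tsq_nonneg (x : Eu n) : 0 ≤ Tsq u x :=
  Finset.sum_nonneg fun _ _ => Finset.sum_nonneg fun _ _ => Finset.sum_nonneg fun _ _ => sq_nonneg _

lemma int_W (hu : ContDiff ℝ ∞ u) {φ : Eu n → ℝ} (hφ : ContDiff ℝ 1 φ) (hc : HasCompactSupport φ) :
    ∫ x, φ x * Tsq u x = ∫ x, (φ x * gsq (tau1 u) x + ∑ a, pd (sb a) φ x * Wv u a x) := by
  have hW := fun a => (Wv_contDiff hu a)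
  have hW1 := fun a => ((Wv_contDiff hu a).nat 1)
  have hWc := fun a => ((Wv_contDiff hu a)).continuous
  have hφc := hφ.continuous
  have hpφ : ∀ i, Continuous (pd (sb i) φ) := fun i => (pd_contDiff_nat (k := 0) (by exact_mod_cast hφ) _).continuous
  have hT := Tsq_continuous hu
  have hg := gsq_continuous (tau1_contDiff hu)
  have z : ∀ a, ∫ x, pd (sb a) (fun y => φ y * Wv u a y) x = 0 := fun a =>
    int_pd_zero (hφ.mul (hW1 a)) (hc.mul_right) _
  have e : ∀ a x, pd (sb a) (fun y => φ y * Wv u a y) x = pd (sb a) φ x * Wv u a x + φ x * pd (sb a) (Wv u a) x := fun a x =>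
    pd_mul ((hφ.differentiable (by norm_num)).differentiableAt) (cd_diff (hW a) x)
  have hInt0 : ∀ a, Integrable (fun x => pd (sb a) (fun y => φ y * Wv u a y) x) := by
    intro a
    refine Continuous.integrable_of_hasCompactSupport ?_ (pd_compact hc.mul_right _)
    exact (pd_contDiff_nat (k := 0) (by exact_mod_cast (hφ.mul (hW1 a))) _).continuous
  have s : ∫ x, ∑ a, pd (sb a) (fun y => φ y * Wv u a y) x = 0 := by
    rw [integral_finsetSum _ (fun a _ => hInt0 a)]; simp [z]
  have iT : Integrable (fun x => φ x * Tsq u x) :=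
    Continuous.integrable_of_hasCompactSupport (by fun_prop) hc.mul_right
  have hcs : HasCompactSupport (fun x => ∑ a, pd (sb a) φ x * Wv u a x) := by
    have hc' := hc.fderiv (𝕜 := ℝ)
    refine hc'.mono' ?_
    intro x hx
    rw [Function.mem_support] at hx
    refine subset_tsupport _ ?_
    rw [Function.mem_support]
    intro h0
    apply hx
    refine Finset.sum_eq_zero fun a _ => ?_
    unfold pd; rw [h0]; simp
  have iG : Integrable (fun x => φ x * gsq (tau1 u) x + ∑ a, pd (sb a) φ x * Wv u a x) := by
    refine Integrable.add ?_ ?_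
    · exact Continuous.integrable_of_hasCompactSupport (by fun_prop) hc.mul_right
    · exact Continuous.integrable_of_hasCompactSupport (by fun_prop) hcs
  have key : ∀ x, ∑ a, pd (sb a) (fun y => φ y * Wv u a y) x =
      (φ x * gsq (tau1 u) x + ∑ a, pd (sb a) φ x * Wv u a x) - φ x * Tsq u x := by
    intro x
    simp only [e, Finset.sum_add_distrib]
    rw [← Finset.mul_sum, div_W hu]; ring
  simp only [key] at s
  rw [integral_sub iG iT] at s
  linarith

noncomputable def cut {n : ℕ} (x : Eu n) : ℝ := Q3 ((∑ i, x i^2) / 4)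

lemma sumsq (x : Eu n) : ∑ i, x i^2 = ‖x‖^2 := by
  rw [EuclideanSpace.norm_sq_eq]; simp only [Real.norm_eq_abs, sq_abs]

lemma cutin_contDiff : ContDiff ℝ ∞ (fun x : Eu n => (∑ i, x i^2) / 4) :=
  (ContDiff.sum fun i _ => (coord_contDiff i).pow 2).div_const _

lemma cut_contDiff : ContDiff ℝ 1 (cut : Eu n → ℝ) := Q3_contDiff.comp (cutin_contDiff.nat 1)

lemma cut_out (hx : 2 ≤ ‖x‖) : 1 ≤ (∑ i, x i^2) / 4 := by
  rw [sumsq]; nlinarith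

lemma pd_cut_eq (a : Fin n) (x : Eu n) : pd (sb a) cut x = - Q2 ((∑ i, x i^2) / 4) * (x a / 2) := by
  have := pd_comp (v := (sb a : Eu n)) (f := fun x : Eu n => (∑ i, x i^2) / 4) (x := x) (Q3_deriv _) (cd_diff cutin_contDiff x)
  change pd (sb a) (fun y : Eu n => Q3 ((∑ i, y i^2) / 4)) x = _
  rw [this]
  congr 1
  have h1 := fun i => cd_diff (coord_contDiff (n := n) i) x
  have e2 : (fun x : Eu n => (∑ i, x i^2) / 4) = fun x : Eu n => (1/4) * ∑ i, x i^2 := by funext y; ring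
  rw [e2, pd_const_mul _ (DifferentiableAt.fun_sum fun i _ => (h1 i).fun_pow 2), pd_sum (fun i _ => (h1 i).fun_pow 2)]
  have : ∀ i, pd (sb a) (fun y : Eu n => y i ^2) x = if i = a then 2 * x i else 0 := by
    intro i
    simp only [sq]
    rw [pd_mul (h1 i) (h1 i), pd_coord]; simp [PiLp.single_apply]; split_ifs <;> ring
  simp only [this]
  simp; ring

lemma pd_cut (a : Fin n) (x : Eu n) : |pd (sb a) cut x| ≤ 3 := by
  rw [pd_cut_eq]
  by_cases hx : 2 ≤ ‖x‖
  · rw [Q2_zero (cut_out hx)]; norm_num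
  · push Not at hx
    have h1 : |x a| ≤ ‖x‖ := by simpa using PiLp.norm_apply_le x a
    have h2 := Q2_nonneg ((∑ i, x i^2) / 4)
    have h3 : Q2 ((∑ i, x i^2) / 4) ≤ 3 := Q2_le (by rw [sumsq]; positivity)
    rw [abs_mul, abs_neg, abs_of_nonneg h2, abs_div, abs_two]
    have h4 : |x a| / 2 ≤ 1 := by linarith
    have h5 : 0 ≤ |x a| / 2 := by positivity
    nlinarith

lemma W_bound (h : Good u c K) (hK : 0 ≤ K) {ε : ℝ} (hε : 0 < ε) (x : Eu n) :
    ∑ a, |Wv u a x| ≤ (n * K + 1) * (2 * n * ε + gt u x / ε) := by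
  have am : ∀ t : ℝ, |t| ≤ ε + t^2 / ε := by
    intro t
    have h1 : |t| * ε ≤ ε * ε + t^2 := by
      rw [← sq_abs t]; nlinarith [sq_nonneg (|t| - ε), sq_nonneg (|t| + ε)]
    have : |t| ≤ (ε * ε + t^2) / ε := by rw [le_div_iff₀ hε]; exact h1
    refine this.trans (le_of_eq ?_)
    field_simp
  have h1 : ∀ a, |Wv u a x| ≤ K * (∑ b, |pd (sb b) (tau1 u) x|) + |pd (sb a) (tau2 u) x| := by
    intro a
    unfold Wv
    refine (abs_sub _ _).trans ?_
    refine add_le_add ?_ ?_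
    · rw [Finset.mul_sum]
      refine (Finset.abs_sum_le_sum_abs _ _).trans (Finset.sum_le_sum fun b _ => ?_)
      rw [abs_mul]
      exact mul_le_mul_of_nonneg_right (H_bound h hK x a b) (abs_nonneg _)
    · rw [abs_mul, abs_of_pos (by norm_num : (0:ℝ) < 1/2)]
      linarith [abs_nonneg (pd (sb a) (tau2 u) x)]
  have s : ∀ f : Eu n → ℝ, ∑ b, |pd (sb b) f x| ≤ n * ε + gsq f x / ε := by
    intro f
    refine (Finset.sum_le_sum fun b _ => am (pd (sb b) f x)).trans (le_of_eq ?_)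
    rw [Finset.sum_add_distrib, ← Finset.sum_div]; simp [gsq]
  calc ∑ a, |Wv u a x| ≤ ∑ a, (K * (∑ b, |pd (sb b) (tau1 u) x|) + |pd (sb a) (tau2 u) x|) := Finset.sum_le_sum fun a _ => h1 a
    _ = n * K * (∑ b, |pd (sb b) (tau1 u) x|) + ∑ a, |pd (sb a) (tau2 u) x| := by
      rw [Finset.sum_add_distrib]; simp; ring
    _ ≤ n * K * (n * ε + gsq (tau1 u) x / ε) + (n * ε + gsq (tau2 u) x / ε) := by
      gcongr
      · exact s _
      · exact s _
    _ ≤ _ := by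
      have p1 : 0 ≤ gsq (tau1 u) x / ε := div_nonneg (gsq_nonneg _ _) hε.le
      have p2 : 0 ≤ gsq (tau2 u) x / ε := div_nonneg (gsq_nonneg _ _) hε.le
      have p3 : 0 ≤ (n : ℝ) * K := by positivity
      have p4 : 0 ≤ (n : ℝ) * ε := by positivity
      unfold gt; rw [add_div]
      nlinarith [mul_nonneg p3 p2, mul_nonneg p3 p4]

lemma lemma_M (h : Good u c K) (hK : 0 ≤ K) {ε : ℝ} (hε : 0 < ε) :
    ∫ x in Metric.closedBall (0 : Eu n) 1, Tsq u x ≤ 8 * ((1 + 3 * (n * K + 1) / ε) * (∫ x in Metric.closedBall (0 : Eu n) 2, gt u x)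
      + (volume : Measure (Eu n)).real (Metric.closedBall 0 2) * (6 * n * (n * K + 1) * ε)) := by
  have hT := Tsq_continuous h.sm
  have hg := gt_continuous h.sm
  have hcut := (cut_contDiff (n := n)).continuous
  have hcc : HasCompactSupport (cut : Eu n → ℝ) := compact_ball (R := 2) fun x hx => by unfold cut; rw [Q3_zero (cut_out hx)]
  have iT : Integrable (fun x => cut x * Tsq u x) :=
    Continuous.integrable_of_hasCompactSupport (by fun_prop) hcc.mul_right
  have cb : ∀ x : Eu n, 0 ≤ cut x := fun x => Q3_nonneg _
  have s1 : ∫ x in Metric.closedBall (0 : Eu n) 1, Tsq u x ≤ 8 * ∫ x, cut x * Tsq u x := by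
    rw [← integral_const_mul, ← integral_indicator measurableSet_closedBall]
    refine integral_mono ?_ (iT.const_mul _) fun x => ?_
    · exact IntegrableOn.integrable_indicator (hT.continuousOn.integrableOn_compact (isCompact_closedBall _ _)) measurableSet_closedBall
    · dsimp only
      by_cases hx : x ∈ Metric.closedBall (0 : Eu n) 1
      · rw [Set.indicator_of_mem hx]
        rw [mem_closedBall_zero_iff] at hx
        have : 1/8 ≤ cut x := by
          have : (∑ i, x i^2) / 4 ≤ 1/2 := by rw [sumsq]; nlinarith [norm_nonneg x]
          unfold cut Q3; rw [max_eq_left (by linarith)]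
          calc (1:ℝ)/8 ≤ (1/2)^3 := by norm_num
            _ ≤ _ := by gcongr; linarith
        have hT0 := Tsq_nonneg (u := u) x
        nlinarith
      · rw [Set.indicator_of_notMem hx]
        exact mul_nonneg (by norm_num) (mul_nonneg (cb x) (Tsq_nonneg x))
  refine s1.trans ?_
  refine mul_le_mul_of_nonneg_left ?_ (by norm_num)
  have ig : Integrable ((Metric.closedBall (0 : Eu n) 2).indicator (gt u)) :=
    IntegrableOn.integrable_indicator (hg.continuousOn.integrableOn_compact (isCompact_closedBall _ _)) measurableSet_closedBall
  have ic : Integrable ((Metric.closedBall (0 : Eu n) 2).indicator (fun _ => 6 * n * (n * K + 1) * ε)) :=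
    IntegrableOn.integrable_indicator (continuousOn_const.integrableOn_compact (isCompact_closedBall _ _)) measurableSet_closedBall
  have e1 : ∫ x in Metric.closedBall (0 : Eu n) 2, gt u x = ∫ x, (Metric.closedBall (0 : Eu n) 2).indicator (gt u) x :=
    (integral_indicator measurableSet_closedBall).symm
  have e2 : (volume : Measure (Eu n)).real (Metric.closedBall 0 2) * (6 * n * (n * K + 1) * ε) =
      ∫ x, (Metric.closedBall (0 : Eu n) 2).indicator (fun _ => 6 * n * (n * K + 1) * ε) x := by
    rw [integral_indicator_const _ measurableSet_closedBall, smul_eq_mul]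
  rw [int_W h.sm cut_contDiff hcc, e1, e2, ← integral_const_mul, ← integral_add (ig.const_mul _) ic]
  have hpφ : ∀ i, Continuous (pd (sb i) (cut : Eu n → ℝ)) := fun i => (pd_contDiff_nat (k := 0) (by exact_mod_cast cut_contDiff) _).continuous
  have hW := fun a => (Wv_contDiff h.sm a).continuous
  have hg1 := gsq_continuous (tau1_contDiff h.sm)
  have out : ∀ x : Eu n, 2 ≤ ‖x‖ → cut x * gsq (tau1 u) x + ∑ a, pd (sb a) cut x * Wv u a x = 0 := by
    intro x hx
    have : cut x = 0 := by unfold cut; rw [Q3_zero (cut_out hx)]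
    rw [this, zero_mul, zero_add]
    refine Finset.sum_eq_zero fun a _ => ?_
    rw [pd_cut_eq, Q2_zero (cut_out hx)]; ring
  refine integral_mono (integrable_ball (R := 2) (by fun_prop) out) ((ig.const_mul _).add ic) fun x => ?_
  dsimp only
  by_cases hx : x ∈ Metric.closedBall (0 : Eu n) 2
  · rw [Set.indicator_of_mem hx, Set.indicator_of_mem hx]
    have c1 : cut x ≤ 1 := by
      have h0 : 0 ≤ (∑ i, x i^2) / 4 := by rw [sumsq]; positivity
      unfold cut Q3
      exact pow_le_one₀ (le_max_right _ _) (max_le (by linarith) (by norm_num))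
    have c2 : cut x * gsq (tau1 u) x ≤ gt u x := by
      have g1 := gsq_nonneg (tau1 u) x
      have g2 := gsq_nonneg (tau2 u) x
      unfold gt; nlinarith
    have c3 : ∑ a, pd (sb a) cut x * Wv u a x ≤ 3 * ∑ a, |Wv u a x| := by
      rw [Finset.mul_sum]
      refine Finset.sum_le_sum fun a _ => ?_
      refine (le_abs_self _).trans ?_
      rw [abs_mul]
      exact mul_le_mul_of_nonneg_right (pd_cut a x) (abs_nonneg _)
    have c4 := W_bound h hK hε x
    calc _ ≤ gt u x + 3 * ((n * K + 1) * (2 * n * ε + gt u x / ε)) := by linarith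
      _ = _ := by ring
  · rw [Set.indicator_of_notMem hx, Set.indicator_of_notMem hx]
    simp at hx
    rw [out x hx.le]; simp

end
end SLag

namespace SLag
open scoped ContDiff Topology ENNReal
open MeasureTheory

noncomputable def gs {n : ℕ} (f : Eu n → ℝ) (x : Eu n) : ℝ := ∑ k, |pd (sb k) f x|

/-- closed unit ball -/
abbrev UB (n : ℕ) : Set (Eu n) := Metric.closedBall (0 : Eu n) 1

section
variable {n : ℕ} {f : Eu n → ℝ}

lemma gs_continuous (hf : ContDiff ℝ ∞ f) : Continuous (gs f) := by
  unfold gs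
  have := fun k => (pd_contDiff hf (sb k)).continuous
  fun_prop

lemma gs_nonneg (x : Eu n) : 0 ≤ gs f x := Finset.sum_nonneg fun _ _ => abs_nonneg _

lemma seg (hf : ContDiff ℝ ∞ f) {x y : Eu n} (hx : x ∈ UB n) (hy : y ∈ UB n) :
    ENNReal.ofReal |f x - f y| ≤ 2 * ∫⁻ t in Set.Icc (0:ℝ) 1, ENNReal.ofReal (gs f ((1 - t) • x + t • y)) := by
  have hg := gs_continuous hf
  have hc : Continuous (fun t : ℝ => gs f ((1 - t) • x + t • y)) := by fun_prop
  have hd : ∀ t : ℝ, HasDerivAt (fun t : ℝ => f ((1 - t) • x + t • y)) (fderiv ℝ f ((1 - t) • x + t • y) (y - x)) t := by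
    intro t
    have h1 : HasDerivAt (fun t : ℝ => (1 - t) • x + t • y) (y - x) t := by
      have := (((hasDerivAt_id t).const_sub 1).smul_const x).add ((hasDerivAt_id t).smul_const y)
      refine HasDerivAt.congr_deriv (f := fun t : ℝ => (1 - t) • x + t • y) this ?_
      simp; abel
    exact (cd_diff hf _).hasFDerivAt.comp_hasDerivAt t h1
  have hcd : Continuous (fun t : ℝ => fderiv ℝ f ((1 - t) • x + t • y) (y - x)) := by
    have : Continuous (fderiv ℝ f) := (hf.nat 1).continuous_fderiv (by norm_num)
    exact (this.comp (by fun_prop)).clm_apply continuous_const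
  have hI := intervalIntegral.integral_eq_sub_of_hasDerivAt (a := 0) (b := 1) (fun t _ => hd t) (hcd.intervalIntegrable _ _)
  simp only [sub_self, one_smul, zero_smul, zero_add, sub_zero, add_zero] at hI
  have hxy : ‖y - x‖ ≤ 2 := by
    rw [mem_closedBall_zero_iff] at hx hy
    exact (norm_sub_le _ _).trans (by linarith)
  have h1 : |f x - f y| ≤ ∫ t in (0:ℝ)..1, 2 * gs f ((1 - t) • x + t • y) := by
    rw [abs_sub_comm, ← hI]
    refine (intervalIntegral.abs_integral_le_integral_abs (by norm_num)).trans ?_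
    refine intervalIntegral.integral_mono_on (by norm_num) (hcd.abs.intervalIntegrable _ _) ((hc.const_mul 2).intervalIntegrable _ _) fun t _ => ?_
    have := (fderiv ℝ f ((1 - t) • x + t • y)).le_opNorm (y - x)
    rw [Real.norm_eq_abs] at this
    refine this.trans ?_
    rw [mul_comm]
    exact mul_le_mul hxy (fderiv_norm_le _ _) (norm_nonneg _) (by norm_num)
  rw [intervalIntegral.integral_of_le (by norm_num), ← integral_Icc_eq_integral_Ioc] at h1
  refine (ENNReal.ofReal_le_ofReal h1).trans (le_of_eq ?_)
  rw [integral_const_mul, ENNReal.ofReal_mul (by norm_num), ofReal_integral_eq_lintegral_ofReal]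
  · simp
  · exact hc.continuousOn.integrableOn_compact isCompact_Icc
  · exact Filter.Eventually.of_forall fun t => gs_nonneg _

lemma cov {h : Eu n → ℝ≥0∞} (hh : Measurable h) {x : Eu n} (hx : x ∈ UB n) {t : ℝ} (ht : 1/2 ≤ t) (ht1 : t ≤ 1) :
    ∫⁻ y in UB n, h ((1 - t) • x + t • y) ≤ 2^n * ∫⁻ y in UB n, h y := by
  have hm : MeasurableSet (UB n) := measurableSet_closedBall
  rw [← lintegral_indicator hm, ← lintegral_indicator hm]
  set F := (UB n).indicator h with hF
  have hFm : Measurable F := hh.indicator hm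
  have ht0 : 0 < t := by linarith
  calc ∫⁻ y, (UB n).indicator (fun y => h ((1 - t) • x + t • y)) y ≤ ∫⁻ y, F ((1 - t) • x + t • y) := by
        refine lintegral_mono fun y => ?_
        by_cases hy : y ∈ UB n
        · have : (1 - t) • x + t • y ∈ UB n :=
            (convex_closedBall (0 : Eu n) 1) hx hy (by linarith) ht0.le (by ring)
          rw [Set.indicator_of_mem hy, hF, Set.indicator_of_mem this]
        · rw [Set.indicator_of_notMem hy]; exact zero_le
    _ = ENNReal.ofReal |(t ^ n)⁻¹| * ∫⁻ y, F y := by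
        have h1 : ∫⁻ y, F ((1 - t) • x + t • y) = ∫⁻ z, F ((1 - t) • x + z) ∂(Measure.map (fun y : Eu n => t • y) volume) := by
          rw [lintegral_map (by fun_prop) (by fun_prop)]
        rw [h1, Measure.map_addHaar_smul _ ht0.ne', lintegral_smul_measure, lintegral_add_left_eq_self]
        simp
    _ ≤ _ := by
        gcongr
        rw [abs_of_pos (by positivity), ← inv_pow, ENNReal.ofReal_pow (by positivity)]
        gcongr
        rw [show (2 : ℝ≥0∞) = ENNReal.ofReal 2 by simp]
        refine ENNReal.ofReal_le_ofReal ?_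
        rw [inv_le_comm₀ ht0 (by norm_num)]; linarith

lemma poinc (hf : ContDiff ℝ ∞ f) :
    ∫⁻ y in UB n, ∫⁻ x in UB n, ENNReal.ofReal |f x - f y| ≤
      2 * (volume (UB n) * (2^n * ∫⁻ x in UB n, ENNReal.ofReal (gs f x))) := by
  have hg := gs_continuous hf
  have hfc := hf.continuous
  have hm : MeasurableSet (UB n) := measurableSet_closedBall
  set μ := (volume : Measure (Eu n)).restrict (UB n) with hμ
  set h := fun x => ENNReal.ofReal (gs f x) with hh
  have hhm : Measurable h := hg.measurable.ennreal_ofReal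
  have hfin : IsFiniteMeasure μ := ⟨by rw [hμ, Measure.restrict_apply_univ]; exact measure_closedBall_lt_top⟩
  have s1 : ∫⁻ y in UB n, ∫⁻ x in UB n, ENNReal.ofReal |f x - f y| ≤
      ∫⁻ y, ∫⁻ x, (2 * ∫⁻ t in Set.Icc (0:ℝ) 1, h ((1 - t) • x + t • y)) ∂μ ∂μ := by
    refine setLIntegral_mono' hm fun y hy => ?_
    exact setLIntegral_mono' hm fun x hx => seg hf hx hy
  refine s1.trans ?_
  have m3 : Measurable (fun p : ℝ × (Eu n × Eu n) => h ((1 - p.1) • p.2.2 + p.1 • p.2.1)) :=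
    hhm.comp (by fun_prop)
  have e1 : ∫⁻ y, ∫⁻ x, (2 * ∫⁻ t in Set.Icc (0:ℝ) 1, h ((1 - t) • x + t • y)) ∂μ ∂μ =
      2 * ∫⁻ t in Set.Icc (0:ℝ) 1, ∫⁻ y, ∫⁻ x, h ((1 - t) • x + t • y) ∂μ ∂μ := by
    have m4 : Measurable (fun p : (Eu n × Eu n) => ∫⁻ t in Set.Icc (0:ℝ) 1, h ((1 - t) • p.2 + t • p.1)) := by
      have : Measurable (fun p : (Eu n × Eu n) × ℝ => h ((1 - p.2) • p.1.2 + p.2 • p.1.1)) := hhm.comp (by fun_prop)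
      exact this.lintegral_prod_right'
    rw [← lintegral_prod (fun p : Eu n × Eu n => 2 * ∫⁻ t in Set.Icc (0:ℝ) 1, h ((1 - t) • p.2 + t • p.1)) (m4.const_mul 2).aemeasurable,
      lintegral_const_mul _ m4]
    rw [lintegral_lintegral_swap]
    · congr 1
      refine lintegral_congr fun t => ?_
      rw [← lintegral_prod (fun p : Eu n × Eu n => h ((1 - t) • p.2 + t • p.1))]
      exact (hhm.comp (by fun_prop)).aemeasurable
    · exact (hhm.comp (by fun_prop : Measurable fun p : (Eu n × Eu n) × ℝ => ((1 - p.2) • p.1.2 + p.2 • p.1.1))).aemeasurable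
  rw [e1]
  refine mul_le_mul_right ?_ 2
  have key : ∀ t ∈ Set.Icc (0:ℝ) 1, ∫⁻ y, ∫⁻ x, h ((1 - t) • x + t • y) ∂μ ∂μ ≤ volume (UB n) * (2^n * ∫⁻ x in UB n, h x) := by
    intro t ht
    have cst : ∫⁻ _y : Eu n, (2^n * ∫⁻ x in UB n, h x) ∂μ = volume (UB n) * (2^n * ∫⁻ x in UB n, h x) := by
      rw [lintegral_const, hμ, Measure.restrict_apply_univ, mul_comm]
    rw [← cst]
    by_cases h2 : 1/2 ≤ t
    · have am : AEMeasurable (Function.uncurry fun y x : Eu n => h ((1 - t) • x + t • y)) (μ.prod μ) :=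
        (hhm.comp (by fun_prop : Measurable fun p : Eu n × Eu n => ((1 - t) • p.2 + t • p.1))).aemeasurable
      rw [lintegral_lintegral_swap (f := fun y x : Eu n => h ((1 - t) • x + t • y)) am]
      refine setLIntegral_mono' hm fun x hx => ?_
      exact cov hhm hx h2 ht.2
    · push Not at h2
      refine setLIntegral_mono' hm fun y hy => ?_
      have := cov hhm hy (t := 1 - t) (by linarith) (by linarith [ht.1])
      simpa [add_comm] using this
  calc _ ≤ ∫⁻ t in Set.Icc (0:ℝ) 1, volume (UB n) * (2^n * ∫⁻ x in UB n, h x) := setLIntegral_mono' measurableSet_Icc key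
    _ = _ := by rw [lintegral_const]; simp; rfl

end
end SLag

namespace SLag
open scoped ContDiff Topology ENNReal
open MeasureTheory

section
variable {n : ℕ} 

lemma UB_int {g : Eu n → ℝ} (hg : Continuous g) : IntegrableOn g (UB n) :=
  hg.continuousOn.integrableOn_compact (isCompact_closedBall _ _)

lemma UB_ofReal {g : Eu n → ℝ} (hg : Continuous g) (h0 : ∀ x, 0 ≤ g x) :
    ENNReal.ofReal (∫ x in UB n, g x) = ∫⁻ x in UB n, ENNReal.ofReal (g x) :=
  ofReal_integral_eq_lintegral_ofReal (UB_int hg) (Filter.Eventually.of_forall h0)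

lemma good_point {ι : Type} [Fintype ι] (f : ι → Eu n → ℝ) (hf : ∀ i, ContDiff ℝ ∞ (f i)) {r : ℝ} (hr : 0 < r)
    (hr1 : r ≤ 1) : ∃ y0 : Eu n, ‖y0‖ ≤ r ∧
      ∑ i, ∫ x in UB n, |f i x - f i y0| ≤ 2^(n+1) / r^n * ∑ i, ∫ x in UB n, gs (f i) x := by
  have hm : MeasurableSet (UB n) := measurableSet_closedBall
  set F : Eu n → ℝ≥0∞ := fun y => ∑ i, ∫⁻ x in UB n, ENNReal.ofReal |f i x - f i y| with hF
  have m1 : ∀ i, Measurable fun y => ∫⁻ x in UB n, ENNReal.ofReal |f i x - f i y| := by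
    intro i
    have hc := (hf i).continuous
    have : Measurable (fun p : Eu n × Eu n => ENNReal.ofReal |f i p.2 - f i p.1|) := by
      have : Continuous (fun p : Eu n × Eu n => |f i p.2 - f i p.1|) := by fun_prop
      exact this.measurable.ennreal_ofReal
    exact this.lintegral_prod_right'
  have hFm : Measurable F := Finset.measurable_sum _ fun i _ => m1 i
  have hsub : Metric.closedBall (0 : Eu n) r ⊆ UB n := Metric.closedBall_subset_closedBall hr1
  have hv : volume (Metric.closedBall (0 : Eu n) r) = ENNReal.ofReal (r^n) * volume (UB n) := by
    rw [Measure.addHaar_closedBall' _ _ hr.le]; simp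
  have hv0 : volume (UB n) ≠ 0 := (Metric.measure_closedBall_pos _ _ one_pos).ne'
  have hv1 : volume (UB n) ≠ ⊤ := measure_closedBall_lt_top.ne
  have hs0 : volume (Metric.closedBall (0 : Eu n) r) ≠ 0 := (Metric.measure_closedBall_pos _ _ hr).ne'
  obtain ⟨y0, hy0, hle⟩ := exists_le_setLAverage (μ := volume) hs0 measure_closedBall_lt_top.ne hFm.aemeasurable
  refine ⟨y0, by simpa using hy0, ?_⟩
  rw [setLAverage_eq] at hle
  set S : ℝ := ∑ i, ∫ x in UB n, gs (f i) x with hS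
  have hS0 : 0 ≤ S := Finset.sum_nonneg fun i _ => setIntegral_nonneg hm fun x _ => gs_nonneg x
  have hSE : ENNReal.ofReal S = ∑ i, ∫⁻ x in UB n, ENNReal.ofReal (gs (f i) x) := by
    rw [hS, ENNReal.ofReal_sum_of_nonneg fun i _ => setIntegral_nonneg hm fun x _ => gs_nonneg x]
    exact Finset.sum_congr rfl fun i _ => UB_ofReal (gs_continuous (hf i)) fun x => gs_nonneg x
  have hLE : ENNReal.ofReal (∑ i, ∫ x in UB n, |f i x - f i y0|) = F y0 := by
    rw [hF, ENNReal.ofReal_sum_of_nonneg fun i _ => setIntegral_nonneg hm fun x _ => abs_nonneg _]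
    refine Finset.sum_congr rfl fun i _ => UB_ofReal ?_ fun x => abs_nonneg _
    have := (hf i).continuous
    fun_prop
  have hInt0 : ∫⁻ y in Metric.closedBall (0 : Eu n) r, F y ≤ 2 * (volume (UB n) * (2^n * ENNReal.ofReal S)) := by
    refine (lintegral_mono_set hsub).trans ?_
    rw [hF, lintegral_finsetSum _ fun i _ => m1 i, hSE, Finset.mul_sum, Finset.mul_sum, Finset.mul_sum]
    exact Finset.sum_le_sum fun i _ => poinc (hf i)
  rw [← ENNReal.ofReal_le_ofReal_iff (by positivity), hLE]
  refine hle.trans ((ENNReal.div_le_div_right hInt0 _).trans (le_of_eq ?_))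
  rw [hv, ENNReal.ofReal_mul (by positivity), ENNReal.ofReal_div_of_pos (by positivity), ENNReal.ofReal_pow (show (0:ℝ) ≤ 2 by norm_num)]
  rw [show 2 * (volume (UB n) * (2^n * ENNReal.ofReal S)) = (2^(n+1) * ENNReal.ofReal S) * volume (UB n) by ring]
  rw [ENNReal.mul_div_mul_right _ _ hv0 hv1]
  simp [ENNReal.div_eq_inv_mul]
  ring

end
end SLag

namespace SLag
open scoped ContDiff Topology
open MeasureTheory

noncomputable def Ts {n : ℕ} (u : Eu n → ℝ) (x : Eu n) : ℝ := ∑ a, ∑ b, gs (fun y => Hm u (sB n) y a b) x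

section
variable {n : ℕ} {u : Eu n → ℝ} {x : Eu n} {c K : ℝ}

lemma Ts_nonneg (x : Eu n) : 0 ≤ Ts u x := Finset.sum_nonneg fun _ _ => Finset.sum_nonneg fun _ _ => gs_nonneg x

lemma Ts_continuous (hu : ContDiff ℝ ∞ u) : Continuous (Ts u) :=
  continuous_finsetSum _ fun a _ => continuous_finsetSum _ fun b _ => gs_continuous (Hm_contDiff hu (sB n) a b)

lemma conj_diag_bound {M : Matrix (Fin n) (Fin n) ℝ} {e : OrthonormalBasis (Fin n) ℝ (Eu n)} {l : Fin n → ℝ} {L : ℝ}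
    (hL : 0 ≤ L) (hM : (Um e).transpose * M * Um e = Matrix.diagonal l) (hl : ∀ i, |l i| ≤ L) (i j : Fin n) : |M i j| ≤ L := by
  have e1 : M = Um e * Matrix.diagonal l * (Um e).transpose := by
    rw [← hM]
    calc _ = (Um e * (Um e).transpose) * M * (Um e * (Um e).transpose) := by rw [Um_orth']; simp
      _ = _ := by simp only [mul_assoc]
  have o : ∀ i, ∑ a, Um e i a ^2 = 1 := by
    intro i
    have := congrFun (congrFun (Um_orth' e) i) i
    simp only [Matrix.mul_apply, Matrix.transpose_apply, Matrix.one_apply_eq] at this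
    rw [← this]; exact Finset.sum_congr rfl fun a _ => by ring
  rw [e1]
  rw [Matrix.mul_apply]; simp only [Matrix.mul_diagonal, Matrix.transpose_apply]
  calc |∑ a, Um e i a * l a * Um e j a| ≤ ∑ a, |Um e i a * l a * Um e j a| := Finset.abs_sum_le_sum_abs _ _
    _ ≤ ∑ a, L / 2 * (Um e i a^2 + Um e j a^2) := by
      refine Finset.sum_le_sum fun a _ => ?_
      rw [abs_mul, abs_mul]
      have h2 : |Um e i a| * |Um e j a| ≤ (Um e i a^2 + Um e j a^2) / 2 := by
        nlinarith [sq_nonneg (|Um e i a| - |Um e j a|), sq_abs (Um e i a), sq_abs (Um e j a)]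
      have h3 : 0 ≤ |Um e i a| * |Um e j a| := by positivity
      calc |Um e i a| * |l a| * |Um e j a| = |l a| * (|Um e i a| * |Um e j a|) := by ring
        _ ≤ L * ((Um e i a^2 + Um e j a^2) / 2) := mul_le_mul (hl a) h2 h3 hL
        _ = _ := by ring
    _ = L := by rw [← Finset.mul_sum, Finset.sum_add_distrib, o, o]; ring

lemma HG_bound (h : Good u c K) (x : Eu n) (i j : Fin n) : |(Hm u (sB n) x * Gm u (sB n) x) i j| ≤ 1 := by
  obtain ⟨e, l, hd, hl, -⟩ := h.eh x
  have e1 : (Um e).transpose * (Hm u (sB n) x * Gm u (sB n) x) * Um e = Matrix.diagonal (fun i => l i * (1 / (1 + l i^2))) := by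
    rw [← conj_mul, ← Matrix.diagonal_mul_diagonal, ← G_diag hd, ← hd, ← Gm_change h.sm]
    congr 1
    exact (Hm_change h.sm).symm
  refine conj_diag_bound zero_le_one e1 (fun i => ?_) i j
  have : 0 < 1 + l i^2 := by positivity
  rw [mul_one_div, abs_div, abs_of_pos this, div_le_one this]
  nlinarith [sq_nonneg (|l i| - 1), sq_abs (l i), abs_nonneg (l i)]

lemma gsV_le (h : Good u c K) (x : Eu n) : gs (Vf u c) x ≤ (1 + K)^n * Ts u x := by
  have e1 : Ts u x = ∑ k, ∑ a, ∑ b, |pd (sb k) (fun y => Hm u (sB n) y a b) x| := by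
    unfold Ts gs
    exact (Finset.sum_congr rfl fun a _ => Finset.sum_comm).trans Finset.sum_comm
  rw [e1, Finset.mul_sum]
  unfold gs
  refine Finset.sum_le_sum fun k _ => ?_
  rw [(first_order h.sm h.sl (sB n) (sb k) x).2, abs_mul]
  have hV := V_ge_one h x
  rw [abs_of_pos (by linarith)]
  refine mul_le_mul (V_le h x) ?_ (abs_nonneg _) (by linarith [V_le h x])
  simp only [Matrix.trace, Matrix.diag_apply, Matrix.mul_apply (M := Hm u (sB n) x * Gm u (sB n) x)]
  rw [Finset.sum_comm]
  refine (Finset.abs_sum_le_sum_abs _ _).trans (Finset.sum_le_sum fun a _ => ?_)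
  refine (Finset.abs_sum_le_sum_abs _ _).trans (Finset.sum_le_sum fun b _ => ?_)
  rw [abs_mul]
  have := HG_bound h x b a
  calc _ ≤ 1 * |mpd (sb k) (Hm u (sB n)) x a b| := by gcongr
    _ = _ := by simp [mpd]

lemma Q2_lip {s t : ℝ} (hs : 0 ≤ s) (ht : 0 ≤ t) : |Q2 s - Q2 t| ≤ 6 * |s - t| := by
  have a1 : max (1 - s) 0 ≤ 1 := max_le (by linarith) (by norm_num)
  have a2 : max (1 - t) 0 ≤ 1 := max_le (by linarith) (by norm_num)
  have a3 := le_max_right (1 - s) 0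
  have a4 := le_max_right (1 - t) 0
  have a5 := abs_max_sub_max_le_abs (1 - s) (1 - t) 0
  have a6 : |1 - s - (1 - t)| = |s - t| := by rw [abs_sub_comm]; congr 1; ring
  rw [a6] at a5
  unfold Q2
  rw [show 3 * (max (1 - s) 0)^2 - 3 * (max (1 - t) 0)^2 = 3 * ((max (1 - s) 0 + max (1 - t) 0)) * (max (1 - s) 0 - max (1 - t) 0) by ring,
    abs_mul, abs_of_nonneg (by positivity)]
  calc _ ≤ (3 * (1 + 1)) * |s - t| := by gcongr
    _ = _ := by ring

lemma lin_change (h : Good u c K) (y0 : Eu n) :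
    ∫ y : Eu n, Q2 ((∑ i, y i^2) + ∑ i, (∑ j, Hm u (sB n) y0 i j * y j)^2) * Vf u c y0 = ∫ y : Eu n, Q2 (∑ i, y i^2) := by
  obtain ⟨e, l, hd, hl, -⟩ := h.eh y0
  set A := Hm u (sB n) y0 with hA
  have hAs : A.transpose = A := Hm_isSymm h.sm (sB n) y0
  set d : Fin n → ℝ := fun i => Real.sqrt (1 + l i^2) with hdd
  set B : Matrix (Fin n) (Fin n) ℝ := Matrix.diagonal d * (Um e).transpose with hB
  have hV : Vf u c y0 = ∏ i, d i := V_eq h hd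
  have hV1 := V_ge_one h y0
  have hdA : (Um e).transpose * A * Um e = Matrix.diagonal l := by rw [← hd]; exact (Hm_change h.sm).symm
  have hBB : B.transpose * B = 1 + A * A := by
    have e1 : Matrix.diagonal d * Matrix.diagonal d = (Um e).transpose * (1 + A * A) * Um e := by
      rw [mul_add, add_mul, mul_one, Um_orth, ← conj_mul, hdA, Matrix.diagonal_mul_diagonal, Matrix.diagonal_mul_diagonal,
        ← Matrix.diagonal_one, Matrix.diagonal_add]
      congr 1; funext i
      rw [hdd]; simp only
      rw [Real.mul_self_sqrt (by positivity)]; simp; ring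
    rw [hB, Matrix.transpose_mul, Matrix.diagonal_transpose, Matrix.transpose_transpose]
    calc _ = Um e * (Matrix.diagonal d * Matrix.diagonal d) * (Um e).transpose := by simp only [mul_assoc]
      _ = (Um e * (Um e).transpose) * (1 + A * A) * (Um e * (Um e).transpose) := by rw [e1]; simp only [mul_assoc]
      _ = _ := by rw [Um_orth']; simp
  have hdet : |B.det| = Vf u c y0 := by
    have : |(Um e).det| = 1 := by
      have h1 := congrArg Matrix.det (Um_orth e)
      rw [Matrix.det_mul, Matrix.det_transpose, Matrix.det_one] at h1
      rw [abs_eq (by norm_num)]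
      exact mul_self_eq_one_iff.mp h1
    rw [hB, Matrix.det_mul, Matrix.det_transpose, abs_mul, this, mul_one, Matrix.det_diagonal, ← hV, abs_of_pos (by linarith)]
  set f := Matrix.toEuclideanLin B with hf
  have hfdet : LinearMap.det f = B.det := by
    rw [hf, Matrix.toEuclideanLin_eq_toLin_orthonormal, LinearMap.det_toLin]
  have hne : LinearMap.det f ≠ 0 := by
    rw [hfdet]; intro h0; rw [h0] at hdet; simp at hdet; linarith
  have hfa : ∀ y i, f y i = ∑ j, B i j * y j := by
    intro y i; simp [hf, Matrix.toEuclideanLin_apply, Matrix.mulVec, dotProduct]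
  have hq : ∀ y : Eu n, (∑ i, y i^2) + ∑ i, (∑ j, A i j * y j)^2 = ∑ i, (f y i)^2 := by
    intro y
    set z : Fin n → ℝ := fun i => y i with hz
    have g1 : ∑ i, (f y i)^2 = B.mulVec z ⬝ᵥ B.mulVec z := by
      simp only [dotProduct, hfa, Matrix.mulVec, hz]
      exact Finset.sum_congr rfl fun i _ => by ring
    have g2 : ∑ i, (∑ j, A i j * y j)^2 = A.mulVec z ⬝ᵥ A.mulVec z := by
      simp only [dotProduct, Matrix.mulVec, hz]
      exact Finset.sum_congr rfl fun i _ => by ring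
    have g3 : ∑ i, y i^2 = z ⬝ᵥ z := by
      simp only [dotProduct, hz]
      exact Finset.sum_congr rfl fun i _ => by ring
    have g4 : ∀ M : Matrix (Fin n) (Fin n) ℝ, M.mulVec z ⬝ᵥ M.mulVec z = z ⬝ᵥ (M.transpose * M).mulVec z := by
      intro M
      rw [← Matrix.mulVec_mulVec, Matrix.dotProduct_mulVec z, Matrix.vecMul_transpose]
    rw [g1, g2, g3, g4, g4, hBB, hAs, Matrix.add_mulVec, dotProduct_add, Matrix.one_mulVec]
  have hQ : Continuous (fun y : Eu n => Q2 (∑ i, y i^2)) := Q2_cont.comp (by fun_prop)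
  have hfc : Continuous f := f.continuous_of_finiteDimensional
  have hmap := Measure.map_linearMap_addHaar_eq_smul_addHaar (μ := (volume : Measure (Eu n))) hne
  have k1 : ∫ y : Eu n, Q2 (∑ i, (f y i)^2) = ∫ y, Q2 (∑ i, y i^2) ∂(Measure.map f volume) := by
    rw [integral_map hfc.measurable.aemeasurable hQ.aestronglyMeasurable]
  simp_rw [hq]
  rw [integral_mul_const, k1, hmap, integral_smul_measure, hfdet, abs_inv, hdet, ENNReal.toReal_ofReal (by positivity)]
  rw [smul_eq_mul, mul_comm, ← mul_assoc, mul_inv_cancel₀ (by positivity), one_mul]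

end
end SLag

namespace SLag
open scoped ContDiff Topology
open MeasureTheory

noncomputable def C2 (n : ℕ) (K : ℝ) : ℝ := 2^(n+1) * (1 + (1 + K)^n)

section
variable {n : ℕ} {u : Eu n → ℝ} {x : Eu n} {c K : ℝ}

lemma good1 (h : Good u c K) : ∃ y0 : Eu n,
    (∑ a, ∑ b, ∫ x in UB n, |Hm u (sB n) x a b - Hm u (sB n) y0 a b|) + ∫ x in UB n, |Vf u c x - Vf u c y0|
      ≤ C2 n K * ∫ x in UB n, Ts u x := by
  let F : Option (Fin n × Fin n) → Eu n → ℝ := fun o => match o with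
    | none => Vf u c
    | some p => fun y => Hm u (sB n) y p.1 p.2
  have hF : ∀ o, ContDiff ℝ ∞ (F o) := fun o => match o with
    | none => contDiff_Vf h.sm c
    | some p => Hm_contDiff h.sm (sB n) p.1 p.2
  obtain ⟨y0, -, hy⟩ := good_point F hF one_pos le_rfl
  refine ⟨y0, ?_⟩
  rw [Fintype.sum_option, Fintype.sum_option, Fintype.sum_prod_type, Fintype.sum_prod_type] at hy
  change (∫ x in UB n, |Vf u c x - Vf u c y0|) + (∑ a, ∑ b, ∫ x in UB n, |Hm u (sB n) x a b - Hm u (sB n) y0 a b|) ≤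
    2^(n+1) / 1^n * ((∫ x in UB n, gs (Vf u c) x) + ∑ a, ∑ b, ∫ x in UB n, gs (fun y => Hm u (sB n) y a b) x) at hy
  have e1 : ∑ a, ∑ b, ∫ x in UB n, gs (fun y => Hm u (sB n) y a b) x = ∫ x in UB n, Ts u x := by
    unfold Ts
    have hi : ∀ a b, IntegrableOn (gs (fun y => Hm u (sB n) y a b)) (UB n) := fun a b =>
      UB_int (gs_continuous (Hm_contDiff h.sm (sB n) a b))
    rw [integral_finsetSum _ fun a _ => integrable_finsetSum _ fun b _ => hi a b]
    exact Finset.sum_congr rfl fun a _ => (integral_finsetSum _ fun b _ => hi a b).symm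
  have e2 : ∫ x in UB n, gs (Vf u c) x ≤ (1 + K)^n * ∫ x in UB n, Ts u x := by
    rw [← integral_const_mul]
    exact setIntegral_mono (UB_int (gs_continuous (contDiff_Vf h.sm c))) (UB_int ((Ts_continuous h.sm).const_mul _)) fun x => gsV_le h x
  rw [e1] at hy
  unfold C2
  calc _ ≤ _ := (add_comm _ _).trans_le hy
    _ ≤ 2^(n+1) / 1^n * ((1 + K)^n * (∫ x in UB n, Ts u x) + ∫ x in UB n, Ts u x) := by gcongr
    _ = _ := by rw [one_pow]; ring

lemma good2 (h : Good u c K) (hK : 0 ≤ K) (y0 : Eu n) {r : ℝ} (hr : 0 < r) (hr1 : r ≤ 1) :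
    ∑ i, ∫ x in UB n, |qf u i x - ∑ j, Hm u (sB n) y0 i j * x j| ≤
      2^(n+1) / r^n * (∑ a, ∑ b, ∫ x in UB n, |Hm u (sB n) x a b - Hm u (sB n) y0 a b|)
        + n * (2 * n * K * r * volume.real (UB n)) := by
  set A := Hm u (sB n) y0 with hA
  set E : Fin n → Eu n → ℝ := fun i x => qf u i x - ∑ j, A i j * x j with hE
  have hlin : ∀ i, ContDiff ℝ ∞ (fun x : Eu n => ∑ j, A i j * x j) := fun i =>
    ContDiff.sum fun j _ => contDiff_const.mul (coord_contDiff j)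
  have hEs : ∀ i, ContDiff ℝ ∞ (E i) := fun i => (qf_contDiff h.sm i).sub (hlin i)
  obtain ⟨y1, hy1, hy⟩ := good_point E hEs hr hr1
  have hpd : ∀ i k x, pd (sb k) (E i) x = Hm u (sB n) x i k - A i k := by
    intro i k x
    have p1 : pd (sb k) (fun x : Eu n => ∑ j, A i j * x j) x = A i k := by
      rw [pd_sum fun j _ => cd_diff (contDiff_const.mul (coord_contDiff j)) x]
      simp_rw [pd_const_mul _ (cd_diff (coord_contDiff _) x), pd_coord]
      simp
    rw [hE]; simp only
    rw [pd_sub (cd_diff (qf_contDiff h.sm i) x) (cd_diff (hlin i) x), p1, pd_qf h.sm, Hm_symm h.sm]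
    simp [Hm]
  have hgs : ∑ i, ∫ x in UB n, gs (E i) x = ∑ a, ∑ b, ∫ x in UB n, |Hm u (sB n) x a b - A a b| := by
    refine Finset.sum_congr rfl fun i _ => ?_
    unfold gs
    simp_rw [hpd]
    refine integral_finsetSum _ fun k _ => UB_int ?_
    have := (Hm_contDiff h.sm (sB n) i k).continuous
    fun_prop
  rw [hgs] at hy
  have hE1 : ∀ i, |E i y1| ≤ 2 * n * K * r := by
    intro i
    have q1 := qf_lip h hK i 0 y1
    rw [qf_zero, sub_zero, sub_zero] at q1
    have q2 : |∑ j, A i j * y1 j| ≤ n * K * ‖y1‖ := by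
      calc _ ≤ ∑ j, |A i j * y1 j| := Finset.abs_sum_le_sum_abs _ _
        _ ≤ ∑ _j : Fin n, K * ‖y1‖ := by
            refine Finset.sum_le_sum fun j _ => ?_
            rw [abs_mul]
            exact mul_le_mul (H_bound h hK y0 i j) (PiLp.norm_apply_le y1 j) (abs_nonneg _) hK
        _ = _ := by simp; ring
    calc |E i y1| ≤ |qf u i y1| + |∑ j, A i j * y1 j| := abs_sub _ _
      _ ≤ 2 * n * K * ‖y1‖ := by linarith
      _ ≤ _ := by gcongr
  calc ∑ i, ∫ x in UB n, |E i x| ≤ ∑ i, ((∫ x in UB n, |E i x - E i y1|) + 2 * n * K * r * volume.real (UB n)) := by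
        refine Finset.sum_le_sum fun i _ => ?_
        have hc := (hEs i).continuous
        have : 2 * n * K * r * volume.real (UB n) = ∫ x in UB n, 2 * n * K * r := by
          rw [setIntegral_const, smul_eq_mul, mul_comm]
        rw [this, ← integral_add (UB_int (by fun_prop)) (UB_int (by fun_prop))]
        refine setIntegral_mono (UB_int (by fun_prop)) (UB_int (by fun_prop)) fun x => ?_
        have := abs_add_le (E i x - E i y1) (E i y1)
        rw [sub_add_cancel] at this
        linarith [hE1 i]
    _ ≤ _ := by
        rw [Finset.sum_add_distrib]
        simp only [Finset.sum_const, Finset.card_univ, Fintype.card_fin, nsmul_eq_mul]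
        linarith

noncomputable def c0 (n : ℕ) : ℝ := ∫ y : Eu n, Q2 (∑ i, y i^2)

noncomputable def Pc (n : ℕ) (K : ℝ) : ℝ := 12 * n * K * (1 + K)^n

noncomputable def CL (n : ℕ) (K : ℝ) : ℝ := Pc n K * 2^(n+1) * C2 n K + 3 * C2 n K + Pc n K * (n * (2 * n * K * volume.real (UB n)))

lemma lemma_L (h : Good u c K) (hK : 0 ≤ K) {r : ℝ} (hr : 0 < r) (hr1 : r ≤ 1) :
    |(∫ y, Q2 (rho u y) * Vf u c y) - c0 n| ≤ CL n K * ((∫ x in UB n, Ts u x) / r^n + r) := by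
  obtain ⟨y0, hy0⟩ := good1 h
  have hg2 := good2 h hK y0 hr hr1
  unfold c0
  rw [← lin_change h y0]
  set A := Hm u (sB n) y0 with hA
  set V0 := Vf u c y0 with hV0
  set η := ∫ x in UB n, Ts u x with hη
  have hη0 : 0 ≤ η := setIntegral_nonneg measurableSet_closedBall fun x _ => Ts_nonneg x
  set SH := ∑ a, ∑ b, ∫ x in UB n, |Hm u (sB n) x a b - A a b| with hSH
  set SV := ∫ x in UB n, |Vf u c x - V0| with hSV
  set SE := ∑ i, ∫ x in UB n, |qf u i x - ∑ j, A i j * x j| with hSE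
  have hSH0 : 0 ≤ SH := Finset.sum_nonneg fun a _ => Finset.sum_nonneg fun b _ =>
    setIntegral_nonneg measurableSet_closedBall fun x _ => abs_nonneg _
  have hSV0 : 0 ≤ SV := setIntegral_nonneg measurableSet_closedBall fun x _ => abs_nonneg _
  set ra : Eu n → ℝ := fun y => (∑ i, y i^2) + ∑ i, (∑ j, A i j * y j)^2 with hra
  have hra0 : ∀ y, 0 ≤ ra y := fun y => by rw [hra]; positivity
  have hrac : Continuous ra := by rw [hra]; fun_prop
  have hrc := (rho_contDiff h.sm).continuous
  have hVc := (contDiff_Vf h.sm c).continuous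
  have hQc := Q2_cont
  have hqc := fun i => (qf_contDiff h.sm i).continuous
  have hrao : ∀ y : Eu n, 1 ≤ ‖y‖ → 1 ≤ ra y := by
    intro y hy
    have : ∑ i, y i^2 = ‖y‖^2 := sumsq y
    rw [hra]; simp only
    rw [this]
    have : 0 ≤ ∑ i, (∑ j, A i j * y j)^2 := by positivity
    nlinarith
  have i1 : Integrable (fun y => Q2 (rho u y) * Vf u c y) := integrable_ball (R := 1) (by fun_prop) fun y hy => by
    rw [Q2_zero (rho_out1 hy), zero_mul]
  have i2 : Integrable (fun y => Q2 (ra y) * V0) := integrable_ball (R := 1) (by fun_prop) fun y hy => by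
    rw [Q2_zero (hrao y hy), zero_mul]
  change |(∫ y, Q2 (rho u y) * Vf u c y) - ∫ y, Q2 (ra y) * V0| ≤ _
  have step : |(∫ y, Q2 (rho u y) * Vf u c y) - ∫ y, Q2 (ra y) * V0| ≤ Pc n K * SE + 3 * SV := by
    rw [← integral_sub i1 i2]
    have hz : ∀ y, y ∉ UB n → Q2 (rho u y) * Vf u c y - Q2 (ra y) * V0 = 0 := by
      intro y hy
      have : 1 ≤ ‖y‖ := by simp at hy; exact hy.le
      rw [Q2_zero (rho_out1 this), Q2_zero (hrao y this)]; ring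
    rw [← setIntegral_eq_integral_of_forall_compl_eq_zero hz]
    refine (abs_integral_le_integral_abs).trans ?_
    have hR : Pc n K * SE + 3 * SV = ∫ x in UB n, (Pc n K * (∑ i, |qf u i x - ∑ j, A i j * x j|) + 3 * |Vf u c x - V0|) := by
      rw [integral_add (UB_int (by fun_prop)) (UB_int (by fun_prop)), integral_const_mul, integral_const_mul,
        integral_finsetSum _ fun i _ => UB_int (by fun_prop)]
    rw [hR]
    refine setIntegral_mono_on (UB_int (by fun_prop)) (UB_int (by fun_prop)) measurableSet_closedBall fun y hy => ?_
    have hy1 : ‖y‖ ≤ 1 := by simpa using hy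
    have hrd : |rho u y - ra y| ≤ 2 * n * K * ∑ i, |qf u i y - ∑ j, A i j * y j| := by
      have : rho u y - ra y = ∑ i, (qf u i y - ∑ j, A i j * y j) * (qf u i y + ∑ j, A i j * y j) := by
        rw [hra]; unfold rho; simp only
        rw [add_sub_add_left_eq_sub, ← Finset.sum_sub_distrib]
        exact Finset.sum_congr rfl fun i _ => by ring
      rw [this, Finset.mul_sum]
      refine (Finset.abs_sum_le_sum_abs _ _).trans (Finset.sum_le_sum fun i _ => ?_)
      rw [abs_mul, mul_comm]
      refine mul_le_mul_of_nonneg_right ?_ (abs_nonneg _)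
      have q1 := qf_lip h hK i 0 y
      rw [qf_zero, sub_zero, sub_zero] at q1
      have q2 : |∑ j, A i j * y j| ≤ n * K * ‖y‖ := by
        calc _ ≤ ∑ j, |A i j * y j| := Finset.abs_sum_le_sum_abs _ _
          _ ≤ ∑ _j : Fin n, K * ‖y‖ := by
              refine Finset.sum_le_sum fun j _ => ?_
              rw [abs_mul]
              exact mul_le_mul (H_bound h hK y0 i j) (PiLp.norm_apply_le y j) (abs_nonneg _) hK
          _ = _ := by simp; ring
      have q3 := abs_add_le (qf u i y) (∑ j, A i j * y j)
      have q4 : n * K * ‖y‖ ≤ n * K * 1 := by gcongr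
      linarith
    have l1 := Q2_lip (rho_nonneg (u := u) y) (hra0 y)
    have l2 := Q2_le (hra0 y)
    have l3 := Q2_nonneg (ra y)
    have l4 := V_le h y
    have l5 := V_ge_one h y
    set SS := ∑ i, |qf u i y - ∑ j, A i j * y j| with hSS
    have hSS0 : 0 ≤ SS := Finset.sum_nonneg fun i _ => abs_nonneg _
    rw [show Q2 (rho u y) * Vf u c y - Q2 (ra y) * V0 = (Q2 (rho u y) - Q2 (ra y)) * Vf u c y + Q2 (ra y) * (Vf u c y - V0) by ring]
    refine (abs_add_le _ _).trans (add_le_add ?_ ?_)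
    · rw [abs_mul, abs_of_pos (show 0 < Vf u c y by linarith)]
      calc _ ≤ (6 * (2 * n * K * SS)) * (1 + K)^n := by
            refine mul_le_mul (l1.trans (by linarith)) l4 (by linarith) (by positivity)
        _ = _ := by unfold Pc; ring
    · rw [abs_mul, abs_of_nonneg l3]
      gcongr
  refine step.trans ?_
  have hP : 0 ≤ Pc n K := by unfold Pc; positivity
  have hC2 : 0 ≤ C2 n K := by unfold C2; positivity
  have hrn : 0 < r^n := by positivity
  have hrn1 : r^n ≤ 1 := pow_le_one₀ hr.le hr1
  have hηr : η ≤ η / r^n := by rw [le_div_iff₀ hrn]; nlinarith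
  have b1 : SH ≤ C2 n K * η := by linarith
  have b2 : SV ≤ C2 n K * (η / r^n) := by
    have : C2 n K * η ≤ C2 n K * (η / r^n) := by gcongr
    linarith
  have b3 : SE ≤ 2^(n+1) * C2 n K * (η / r^n) + n * (2 * n * K * volume.real (UB n)) * r := by
    calc SE ≤ _ := hg2
      _ ≤ 2^(n+1) / r^n * (C2 n K * η) + n * (2 * n * K * r * volume.real (UB n)) := by gcongr
      _ = _ := by ring
  calc _ ≤ Pc n K * (2^(n+1) * C2 n K * (η / r^n) + n * (2 * n * K * volume.real (UB n)) * r) + 3 * (C2 n K * (η / r^n)) := by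
        gcongr
    _ ≤ _ := by
        unfold CL
        have z1 : 0 ≤ η / r^n := by positivity
        have z2 : 0 ≤ Pc n K * (n * (2 * n * K * volume.real (UB n))) := by positivity
        have z3 : 0 ≤ Pc n K * 2^(n+1) * C2 n K + 3 * C2 n K := by positivity
        nlinarith [mul_nonneg z2 z1, mul_nonneg z3 hr.le]

end
end SLag

namespace SLag
open scoped ContDiff Topology
open MeasureTheory

lemma small_mul (C : ℝ) {δ : ℝ} (hδ : 0 < δ) : ∃ ε, 0 < ε ∧ ε ≤ 1 ∧ C * ε ≤ δ := by
  have hp : 0 < |C| + 1 := by positivity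
  refine ⟨min 1 (δ / (|C| + 1)), by positivity, min_le_left _ _, ?_⟩
  have h1 : min 1 (δ / (|C| + 1)) ≤ δ / (|C| + 1) := min_le_right _ _
  have h0 : 0 < min 1 (δ / (|C| + 1)) := by positivity
  rw [le_div_iff₀ hp] at h1
  nlinarith [le_abs_self C]

section
variable {n : ℕ} {u : Eu n → ℝ} {x : Eu n} {c K : ℝ}

lemma eta_le (hu : ContDiff ℝ ∞ u) {ε : ℝ} (hε : 0 < ε) :
    ∫ x in UB n, Ts u x ≤ (n * (n * n) * volume.real (UB n)) * ε + ε⁻¹ * ∫ x in UB n, Tsq u x := by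
  have e0 : (n * (n * n) * volume.real (UB n)) * ε = ∫ x in UB n, (n * (n * n) * ε : ℝ) := by
    rw [setIntegral_const, smul_eq_mul]; ring
  rw [e0, ← integral_const_mul, ← integral_add (UB_int (by fun_prop)) (UB_int ((Tsq_continuous hu).const_mul _))]
  refine setIntegral_mono (UB_int (Ts_continuous hu)) (UB_int (continuous_const.add ((Tsq_continuous hu).const_mul _))) fun x => ?_
  have e1 : Ts u x = ∑ k, ∑ a, ∑ b, |pd (sb k) (fun y => Hm u (sB n) y a b) x| := by
    unfold Ts gs
    exact (Finset.sum_congr rfl fun a _ => Finset.sum_comm).trans Finset.sum_comm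
  have e2 : (n * (n * n) * ε : ℝ) = ∑ _k : Fin n, ∑ _a : Fin n, ∑ _b : Fin n, ε := by simp; ring
  change Ts u x ≤ n * (n * n) * ε + ε⁻¹ * Tsq u x
  rw [e1, e2]
  unfold Tsq
  simp only [Finset.mul_sum, ← Finset.sum_add_distrib]
  refine Finset.sum_le_sum fun k _ => Finset.sum_le_sum fun a _ => Finset.sum_le_sum fun b _ => ?_
  set t := pd (sb k) (fun y => Hm u (sB n) y a b) x
  rw [← sq_abs t]
  have h1 : 0 ≤ ε⁻¹ * (|t| - ε)^2 := by positivity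
  have h2 : ε⁻¹ * (|t| - ε)^2 = ε⁻¹ * |t|^2 - 2 * |t| + ε := by field_simp; ring
  linarith [abs_nonneg t]

lemma eta_large (h : Good u c K) (hK : 0 ≤ K) {δ : ℝ} (hδ : 0 < δ) (R0 : ℝ) :
    ∃ R, R0 ≤ R ∧ 0 < R ∧ ∫ x in UB n, Ts (uR u R) x ≤ δ := by
  obtain ⟨ε1, hε1, -, h1⟩ := small_mul (n * (n * n) * volume.real (UB n)) (half_pos hδ)
  have hδ2 : 0 < ε1 * (δ / 2) := by positivity
  obtain ⟨ε2, hε2, -, h2⟩ := small_mul (8 * (volume.real (Metric.closedBall (0 : Eu n) 2) * (6 * n * (n * K + 1)))) (half_pos hδ2)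
  obtain ⟨ε3, hε3, -, h3⟩ := small_mul (8 * (1 + 3 * (n * K + 1) / ε2)) (half_pos hδ2)
  obtain ⟨R, hR0, hR, hN⟩ := lemma_N h hK hε3 R0
  refine ⟨R, hR0, hR, ?_⟩
  have hg := h.scale hR
  have hM := lemma_M hg hK hε2
  have h4 : 8 * (1 + 3 * (n * K + 1) / ε2) * (∫ x in Metric.closedBall 0 2, gt (uR u R) x) ≤ ε1 * (δ / 2) / 2 :=
    (mul_le_mul_of_nonneg_left hN (by positivity)).trans h3
  have h5 : ∫ x in UB n, Tsq (uR u R) x ≤ ε1 * (δ / 2) := by linarith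
  have h6 := eta_le hg.sm hε1
  have h7 : ε1⁻¹ * ∫ x in UB n, Tsq (uR u R) x ≤ ε1⁻¹ * (ε1 * (δ / 2)) := mul_le_mul_of_nonneg_left h5 (by positivity)
  rw [inv_mul_cancel_left₀ hε1.ne'] at h7
  linarith

lemma Ts_uR (hu : ContDiff ℝ ∞ u) {R : ℝ} (hR : 0 < R) (y : Eu n) : Ts (uR u R) y = R * Ts u (R • y) := by
  unfold Ts gs
  simp only [Finset.mul_sum]
  refine Finset.sum_congr rfl fun a _ => Finset.sum_congr rfl fun b _ => Finset.sum_congr rfl fun k _ => ?_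
  have := congrFun (congrFun (mpd_uR hu hR (sb k) y) a) b
  simp only [mpd, Matrix.of_apply, Matrix.smul_apply, smul_eq_mul] at this
  rw [this, abs_mul, abs_of_pos hR]

lemma eta_small (h : Good u c K) {δ : ℝ} (hδ : 0 < δ) {R0 : ℝ} (hR0 : 0 < R0) :
    ∃ R, R ≤ R0 ∧ 0 < R ∧ ∫ x in UB n, Ts (uR u R) x ≤ δ := by
  obtain ⟨M, hM⟩ := (isCompact_closedBall (0 : Eu n) 1).bddAbove_image (Ts_continuous h.sm).continuousOn
  have hM' : ∀ y ∈ UB n, Ts u y ≤ M := fun y hy => hM ⟨y, hy, rfl⟩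
  obtain ⟨ε, hε, hε1, h1⟩ := small_mul (M * volume.real (UB n)) hδ
  have hM0 : 0 ≤ M := (Ts_nonneg 0).trans (hM' 0 (by simp))
  refine ⟨min ε R0, min_le_right _ _, by positivity, ?_⟩
  set R := min ε R0
  have hR : 0 < R := by positivity
  have hRe : R ≤ ε := min_le_left _ _
  calc ∫ x in UB n, Ts (uR u R) x ≤ ∫ x in UB n, ε * M := by
        refine setIntegral_mono_on (UB_int (Ts_continuous (h.scale hR).sm)) (UB_int (by fun_prop)) measurableSet_closedBall fun y hy => ?_
        rw [Ts_uR h.sm hR]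
        refine mul_le_mul hRe (hM' _ ?_) (Ts_nonneg _) hε.le
        rw [mem_closedBall_zero_iff] at hy ⊢
        rw [norm_smul, Real.norm_eq_abs, abs_of_pos hR]
        nlinarith [norm_nonneg y]
    _ ≤ δ := by rw [setIntegral_const, smul_eq_mul]; linarith

lemma If_close (h : Good u c K) (hK : 0 ≤ K) {ε : ℝ} (hε : 0 < ε) : ∃ δ, 0 < δ ∧ ∀ R, 0 < R →
    ∫ x in UB n, Ts (uR u R) x ≤ δ → |If u c (fun _ => 1) R - c0 n| ≤ ε := by
  obtain ⟨r, hr, hr1, h1⟩ := small_mul (CL n K) (half_pos hε)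
  obtain ⟨δ, hδ, -, h2⟩ := small_mul (CL n K / r^n) (half_pos hε)
  have hCL : 0 ≤ CL n K := by unfold CL Pc C2; positivity
  refine ⟨δ, hδ, fun R hR hη => ?_⟩
  rw [If_one h hR]
  refine (lemma_L (h.scale hR) hK hr hr1).trans ?_
  have : CL n K * ((∫ x in UB n, Ts (uR u R) x) / r^n) ≤ CL n K * (δ / r^n) := by gcongr
  have e : CL n K * (δ / r^n) = CL n K / r^n * δ := by ring
  linarith

lemma lap_one : lap u (sB n) (fun _ => 1) x = 0 := by
  have : Hm (fun _ : Eu n => (1:ℝ)) (sB n) x = 0 := by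
    ext a b
    have : pd (sB n b) (fun _ : Eu n => (1:ℝ)) = fun _ => 0 := funext fun y => pd_const _
    simp only [Hm, Matrix.of_apply, this, Matrix.zero_apply]
    exact pd_const _
  simp [lap, this]

lemma Df_one (R : ℝ) : Df u c (fun _ => 1) R = (2 / R^3) * ∫ x, Q1 (rho u x / R^2) * (Vf u c x * Xp u x) := by
  simp [Df, lap_one]

lemma If_mono (h : Good u c K) : MonotoneOn (If u c (fun _ => 1)) (Set.Ioi 0) := by
  have hd : ∀ R ∈ Set.Ioi (0:ℝ), HasDerivAt (If u c (fun _ => 1)) (Df u c (fun _ => 1) R / R^n) R := fun R hR =>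
    If_hasDeriv h contDiff_const hR
  refine monotoneOn_of_deriv_nonneg (convex_Ioi 0) (fun R hR => (hd R hR).continuousAt.continuousWithinAt) ?_ ?_
  · rw [interior_Ioi]; exact fun R hR => (hd R hR).differentiableAt.differentiableWithinAt
  · rw [interior_Ioi]
    intro R hR
    have hR' : 0 < R := hR
    rw [(hd R hR).deriv, Df_one]
    refine div_nonneg (mul_nonneg (by positivity) (integral_nonneg fun x => ?_)) (by positivity)
    have := V_ge_one h x
    exact mul_nonneg (Q1_nonneg _) (mul_nonneg (by linarith) (Xp_nonneg h.sm x))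

lemma If_const (h : Good u c K) (hK : 0 ≤ K) {R : ℝ} (hR : 0 < R) : If u c (fun _ => 1) R = c0 n := by
  refine eq_of_forall_dist_le fun ε hε => ?_
  rw [Real.dist_eq]
  obtain ⟨δ, hδ, hcl⟩ := If_close h hK hε
  obtain ⟨R1, a1, a2, a3⟩ := eta_large h hK hδ R
  obtain ⟨R2, b1, b2, b3⟩ := eta_small h hδ hR
  have m1 := If_mono h hR a2 a1
  have m2 := If_mono h b2 hR b1
  have c1 := abs_le.mp (hcl R1 a2 a3)
  have c2 := abs_le.mp (hcl R2 b2 b3)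
  rw [abs_le]
  constructor <;> linarith [c1.1, c1.2, c2.1, c2.2]

lemma dv_zero (h : Good u c K) (hK : 0 ≤ K) (x : Eu n) : dv u x = 0 := by
  apply Xp_zero h.sm
  have hρ := rho_nonneg (u := u) x
  set R := rho u x + 1 with hRdef
  have hR : 0 < R := by positivity
  have hd := If_hasDeriv h (f := fun _ => 1) contDiff_const hR
  have hd0 : HasDerivAt (If u c (fun _ => 1)) 0 R := by
    refine (hasDerivAt_const R (c0 n)).congr_of_eventuallyEq ?_
    filter_upwards [Ioi_mem_nhds hR] with r hr
    exact If_const h hK hr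
  have e := hd.unique hd0
  rw [Df_one] at e
  have hInt0 : ∫ x, Q1 (rho u x / R^2) * (Vf u c x * Xp u x) = 0 := by
    have p1 : R^n ≠ 0 := by positivity
    have p2 : 2 / R^3 ≠ 0 := by positivity
    rw [div_eq_zero_iff, or_iff_left p1, mul_eq_zero, or_iff_right p2] at e
    exact e
  have hc : Continuous (fun x => Q1 (rho u x / R^2) * (Vf u c x * Xp u x)) := by
    have a1 := (rho_contDiff h.sm).continuous
    have a2 := (contDiff_Vf h.sm c).continuous
    have a3 := Xp_continuous h.sm
    have a4 := Q1_cont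
    fun_prop
  have hnn : ∀ x, 0 ≤ Q1 (rho u x / R^2) * (Vf u c x * Xp u x) := fun x => by
    have := V_ge_one h x
    exact mul_nonneg (Q1_nonneg _) (mul_nonneg (by linarith) (Xp_nonneg h.sm x))
  have hi : Integrable (fun x => Q1 (rho u x / R^2) * (Vf u c x * Xp u x)) :=
    integrable_ball (R := R) hc fun x hx => by rw [Q1_zero (rho_out hR hx)]; ring
  have hae := (integral_eq_zero_iff_of_nonneg hnn hi).mp hInt0
  have hz := congrFun ((hc.ae_eq_iff_eq volume continuous_zero).mp hae) x
  have hlt : rho u x / R^2 < 1 := by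
    rw [div_lt_one (by positivity), hRdef]; nlinarith
  have hQ := Q1_pos hlt
  have hV := V_ge_one h x
  simp only [Pi.zero_apply, mul_eq_zero] at hz
  rcases hz with hz | hz | hz
  · exact absurd hz hQ.ne'
  · linarith
  · exact hz

end
end SLag

namespace SLag
open scoped ContDiff Topology
open MeasureTheory

section
variable {n : ℕ} {u : Eu n → ℝ} {x : Eu n} {c K : ℝ}

lemma ray_deriv {f : Eu n → ℝ} (hf : ContDiff ℝ ∞ f) (x : Eu n) (t : ℝ) :
    HasDerivAt (fun t : ℝ => f (t • x)) (∑ j, x j * pd (sb j) f (t • x)) t := by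
  have h1 : HasDerivAt (fun t : ℝ => t • x) x t := by simpa using (hasDerivAt_id t).smul_const x
  have h2 := (cd_diff hf (t • x)).hasFDerivAt.comp_hasDerivAt t h1
  have hv : x = ∑ i, x i • (sb i : Eu n) := by
    have := (EuclideanSpace.basisFun (Fin n) ℝ).sum_repr x
    simpa using this.symm
  have : fderiv ℝ f (t • x) x = ∑ i, x i * pd (sb i) f (t • x) := pd_lin x _ _ _ hv f (t • x)
  rw [← this]; exact h2

lemma q_linear (h : Good u c K) (hK : 0 ≤ K) (x : Eu n) (i : Fin n) : qf u i x = ∑ j, Hm u (sB n) 0 i j * x j := by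
  have hq : ∀ y, qf u i y = ∑ j, Hm u (sB n) y i j * y j := by
    intro y
    have := congrFun (dv_zero h hK y) i
    simp only [dv, Pi.sub_apply, Pi.zero_apply, Matrix.mulVec, dotProduct] at this
    linarith
  set g : ℝ → ℝ := fun t => qf u i (t • x) with hg
  have hgd : ∀ t, HasDerivAt g (∑ j, x j * Hm u (sB n) (t • x) i j) t := by
    intro t
    have := ray_deriv (qf_contDiff h.sm i) x t
    refine this.congr_deriv (Finset.sum_congr rfl fun j _ => ?_)
    rw [pd_qf h.sm, Hm_symm h.sm]; simp [Hm]
  have hE : ∀ t, t * (∑ j, x j * Hm u (sB n) (t • x) i j) = g t := by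
    intro t
    rw [hg]; simp only
    rw [hq, Finset.mul_sum]
    refine Finset.sum_congr rfl fun j _ => ?_
    simp; ring
  have hk : ∀ s, HasDerivAt (fun s : ℝ => Real.exp (-s) * g (Real.exp s)) 0 s := by
    intro s
    have d1 : HasDerivAt (fun s : ℝ => Real.exp (-s)) (-Real.exp (-s)) s := by
      simpa using (hasDerivAt_neg s).exp
    have d2 := (hgd (Real.exp s)).comp s (Real.hasDerivAt_exp s)
    refine (d1.mul d2).congr_deriv ?_
    simp only [Function.comp]
    rw [mul_comm (∑ j, _) (Real.exp s), hE]; ring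
  have hconst := is_const_of_deriv_eq_zero (fun s => (hk s).differentiableAt) (fun s => (hk s).deriv)
  have hlin : ∀ t ∈ Set.Ici (0:ℝ), g t = t * g 1 := by
    intro t ht
    rcases eq_or_lt_of_le (Set.mem_Ici.mp ht) with h0 | h0
    · rw [← h0, hg]; simp [qf_zero]
    · have := hconst (Real.log t) 0
      simp only [Real.exp_neg, Real.exp_log h0, Real.exp_zero, inv_one, one_mul] at this
      rw [← this]; field_simp
  have w1 := (hgd 0).hasDerivWithinAt (s := Set.Ici 0)
  have w2 : HasDerivWithinAt g (g 1) (Set.Ici 0) 0 := by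
    have : HasDerivWithinAt (fun t : ℝ => t * g 1) (g 1) (Set.Ici 0) 0 := by
      simpa using ((hasDerivAt_id (0:ℝ)).mul_const (g 1)).hasDerivWithinAt
    exact this.congr hlin (hlin 0 (by simp))
  have e := (uniqueDiffOn_Ici (0:ℝ) 0 (by simp)).eq_deriv _ w2 w1
  have g1 : g 1 = qf u i x := by rw [hg]; simp
  rw [← g1, e, zero_smul]
  exact Finset.sum_congr rfl fun j _ => mul_comm _ _

lemma quadratic (h : Good u c K) (hK : 0 ≤ K) (x : Eu n) :
    u x = (1 / 2) * ∑ i, ∑ j, Hm u (sB n) 0 i j * x i * x j + ∑ i, pd (sb i) u 0 * x i + u 0 := by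
  set S2 := ∑ i, ∑ j, Hm u (sB n) 0 i j * x i * x j with hS2
  set S1 := ∑ i, pd (sb i) u 0 * x i with hS1
  have hd : ∀ t : ℝ, HasDerivAt (fun t : ℝ => u (t • x) - (t^2 * (S2 / 2) + t * S1)) 0 t := by
    intro t
    have d1 := ray_deriv h.sm x t
    have d2 := ((hasDerivAt_pow 2 t).mul_const (S2 / 2)).add ((hasDerivAt_id t).mul_const S1)
    refine (d1.sub d2).congr_deriv ?_
    have : ∀ j, pd (sb j) u (t • x) = pd (sb j) u 0 + t * ∑ k, Hm u (sB n) 0 j k * x k := by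
      intro j
      have := q_linear h hK (t • x) j
      unfold qf at this
      have e : ∑ k, Hm u (sB n) 0 j k * (t • x) k = t * ∑ k, Hm u (sB n) 0 j k * x k := by
        rw [Finset.mul_sum]; exact Finset.sum_congr rfl fun k _ => by simp; ring
      rw [e] at this; linarith
    have e3 : ∑ j, x j * pd (sb j) u (t • x) = S1 + t * S2 := by
      simp_rw [this, mul_add, Finset.sum_add_distrib]
      congr 1
      · exact Finset.sum_congr rfl fun _ _ => mul_comm _ _
      · rw [hS2, Finset.mul_sum]
        refine Finset.sum_congr rfl fun j _ => ?_
        rw [Finset.mul_sum, Finset.mul_sum, Finset.mul_sum]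
        exact Finset.sum_congr rfl fun k _ => by ring
    rw [e3]; simp; ring
  have := is_const_of_deriv_eq_zero (fun s => (hd s).differentiableAt) (fun s => (hd s).deriv) 1 0
  simp at this
  linarith

lemma Hess_eq (hu : ContDiff ℝ ∞ u) (x : Eu n) : Hess u x = Hm u (sB n) x := by
  ext i j
  simp only [Hess, Hm, Matrix.of_apply]
  rw [Hess_entry hu]; simp

lemma eigen_diag (hu : ContDiff ℝ ∞ u) (x : Eu n) (hs : (Hess u x).IsHermitian) :
    Hm u hs.eigenvectorBasis x = Matrix.diagonal hs.eigenvalues := by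
  rw [Hm_change hu]
  change (Um _).transpose * Hm u (sB n) x * Um _ = _
  rw [← Hess_eq hu]
  have e1 : Hess u x * Um hs.eigenvectorBasis = Um hs.eigenvectorBasis * Matrix.diagonal hs.eigenvalues := by
    ext i b
    have := congrFun (hs.mulVec_eigenvectorBasis b) i
    rw [Matrix.mul_diagonal, Matrix.mul_apply]
    simp only [Matrix.mulVec, dotProduct, Pi.smul_apply, smul_eq_mul] at this
    simp only [Um, Matrix.of_apply]
    rw [mul_comm]; exact this
  rw [mul_assoc, e1, ← mul_assoc, Um_orth, one_mul]

lemma polar (l : ℝ) : (1 + Complex.I * l : ℂ) = (Real.sqrt (1 + l^2) : ℂ) * Complex.exp (Real.arctan l * Complex.I) := by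
  have hp : Real.sqrt (1 + l^2) ≠ 0 := (Real.sqrt_pos.mpr (by positivity)).ne'
  rw [Complex.exp_mul_I, ← Complex.ofReal_cos, ← Complex.ofReal_sin, Real.cos_arctan, Real.sin_arctan]
  apply Complex.ext
  · simp [hp]
  · simp; field_simp

lemma mk_good (hu : ContDiff ℝ ∞ u) (hsym : ∀ x, (Hess u x).IsHermitian)
    (hsol : ∀ x, ∑ i, Real.arctan ((hsym x).eigenvalues i) = c)
    (hK : ∀ x, ∀ i : Fin n, |(hsym x).eigenvalues i| ≤ K)
    (hcond : ∀ x, ∀ i j : Fin n,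
      0 ≤ 3 + ((hsym x).eigenvalues i) ^ 2 +
        2 * (hsym x).eigenvalues i * (hsym x).eigenvalues j) : Good u c K where
  sm := hu
  eh := fun x => ⟨(hsym x).eigenvectorBasis, (hsym x).eigenvalues, eigen_diag hu x (hsym x), hK x, hcond x⟩
  sl := by
    intro x
    set l := (hsym x).eigenvalues with hl
    have h0 : cdet (Hm u (sB n) x) = cdet (Hm u (hsym x).eigenvectorBasis x) := by
      rw [Hm_change (e := (hsym x).eigenvectorBasis) hu, cdet_conj]
    have h1 : cdet (Hm u (sB n) x) = ((∏ i, Real.sqrt (1 + l i^2) : ℝ) : ℂ) * Complex.exp (c * Complex.I) := by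
      rw [h0, eigen_diag hu x (hsym x)]; unfold cdet
      rw [Matrix.diagonal_map (by simp), ← Matrix.diagonal_smul, ← Matrix.diagonal_one, Matrix.diagonal_add, Matrix.det_diagonal]
      rw [← hsol x]
      push_cast
      rw [Finset.sum_mul, Complex.exp_sum, ← Finset.prod_mul_distrib]
      refine Finset.prod_congr rfl fun i _ => ?_
      have := polar (l i)
      simp only [Pi.smul_apply, Function.comp, smul_eq_mul]
      exact_mod_cast this
    have hV : Vf u c x = ∏ i, Real.sqrt (1 + l i^2) := by
      unfold Vf
      change (_ * cdet (Hm u (sB n) x)).re = _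
      rw [h1, mul_left_comm, ← Complex.exp_add, neg_add_cancel, Complex.exp_zero, mul_one, Complex.ofReal_re]
    constructor
    · rw [hV]; exact Finset.prod_pos fun i _ => Real.sqrt_pos.mpr (by positivity)
    · rw [hV]; exact h1

end
end SLag

/-- Liouville theorem for solutions with bounded Hessian satisfying the weaker
convexity constraint (3.1) (Theorem 3.1). -/
theorem stmt_11 {n : ℕ} (hn : 2 ≤ n) (u : EuclideanSpace ℝ (Fin n) → ℝ) (c : ℝ)
    (hu : ContDiff ℝ (⊤ : ℕ∞) u)
    (hsym : ∀ x, (Hess u x).IsHermitian)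
    (hsol : ∀ x, ∑ i, Real.arctan ((hsym x).eigenvalues i) = c)
    (K : ℝ) (hK : ∀ x, ∀ i : Fin n, |(hsym x).eigenvalues i| ≤ K)
    (hcond : ∀ x, ∀ i j : Fin n,
      0 ≤ 3 + ((hsym x).eigenvalues i) ^ 2 +
        2 * (hsym x).eigenvalues i * (hsym x).eigenvalues j) :
    ∃ (A : Matrix (Fin n) (Fin n) ℝ) (b : Fin n → ℝ) (c₀ : ℝ), A.IsSymm ∧
      ∀ x : EuclideanSpace ℝ (Fin n),
        u x = (1 / 2) * ∑ i, ∑ j, A i j * x i * x j + ∑ i, b i * x i + c₀ := by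
  have hg : SLag.Good u c K := SLag.mk_good hu hsym hsol hK hcond
  have hK0 : 0 ≤ K := (abs_nonneg _).trans (hK 0 ⟨0, by omega⟩)
  exact ⟨SLag.Hm u (SLag.sB n) 0, fun i => SLag.pd (SLag.sb i) u 0, u 0, SLag.Hm_isSymm hu _ _,
    fun x => SLag.quadratic hg hK0 x⟩
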